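/- arXiv:math/0703466 — 2 statements merged into one kernel-verified Lean document; each statement's English description precedes it below -/
import Mathlib

section
/- Let f : ℝ² → ℝ² be a differentiable map such that f(0) = 0. If Spec(f) ∩ ([1, 1+ε) ∪ [0, ε)) = ∅ for some ε > 0, then f is a topological embedding with Fix(f) = {0}. -/
open Topology Filter Metric Set Function

noncomputable section

/-- The plane with the Euclidean norm. -/
abbrev Plane : Type := EuclideanSpace ℝ (Fin 2)

/-- `z : ℂ` is a complex eigenvalue of the continuous `ℝ`-linear map `L : ℝ² → ℝ²`,
i.e. a root of the characteristic polynomial of its matrix in the standard basis. -/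
def IsEigenvalueCLM (L : Plane →L[ℝ] Plane) (z : ℂ) : Prop :=
  (((LinearMap.toMatrix (EuclideanSpace.basisFun (Fin 2) ℝ).toBasis
      (EuclideanSpace.basisFun (Fin 2) ℝ).toBasis) L.toLinearMap).map
      (algebraMap ℝ ℂ)).charpoly.IsRoot z

/-- `Spec` of a map whose derivative at each point `p` is `Df p`: the set of all complex
eigenvalues of all the derivatives. -/
def spec (Df : Plane → Plane →L[ℝ] Plane) : Set ℂ :=
  {z | ∃ p : Plane, IsEigenvalueCLM (Df p) z}

namespace Emb
abbrev W := ℝ × ℝ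
def e (u : W) : ℝ := u.1^2+u.2^2

lemma e_add (u v : W) : e (u+v) ≤ 2 * e u + 2 * e v := by
  simp only [e, Prod.fst_add, Prod.snd_add]; nlinarith [sq_nonneg (u.1-v.1), sq_nonneg (u.2-v.2)]
lemma e_neg (u : W) : e (-u) = e u := by simp [e]
lemma e_cont : Continuous e := by unfold e; fun_prop
lemma e_zero {u : W} (h : e u ≤ 0) : u = 0 := by
  have h1 : u.1 = 0 := by unfold e at h; nlinarith [sq_nonneg u.1, sq_nonneg u.2]
  have h2 : u.2 = 0 := by unfold e at h; nlinarith [sq_nonneg u.1, sq_nonneg u.2]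
  exact Prod.ext h1 h2
lemma norm_sq_le_e (u : W) : ‖u‖^2 ≤ e u := by
  rw [Prod.norm_def]
  rcases max_choice ‖u.1‖ ‖u.2‖ with h | h <;> rw [h] <;> simp [e, sq_nonneg]
lemma e_le_norm_sq (u : W) : e u ≤ 2 * ‖u‖^2 := by
  have h1 : |u.1| ≤ ‖u‖ := norm_fst_le u
  have h2 : |u.2| ≤ ‖u‖ := norm_snd_le u
  unfold e
  nlinarith [sq_abs u.1, sq_abs u.2, abs_nonneg u.1, abs_nonneg u.2]

lemma surj_of_inj {L : W →L[ℝ] W} (h : Injective L) : Surjective L :=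
  LinearMap.injective_iff_surjective (f := (L : W →ₗ[ℝ] W)).1 h

lemma open_aux {h : W → W} {h' : W → W →L[ℝ] W} (hd : ∀ x, HasFDerivAt h (h' x) x)
    (hi : ∀ x, Injective (h' x)) {a : W} {r m: ℝ} (hr : 0<r)
    (hm : ∀ x ∈ sphere a r, m ≤ e (h x - h a)) {y : W} (hy : 4*e (y - h a) < m) :
    ∃ x ∈ ball a r, h x = y := by
  have hc : Continuous h := continuous_iff_continuousAt.2 fun x => (hd x).continuousAt
  obtain ⟨x, hx, hmin⟩ := (isCompact_closedBall a r).exists_isMinOn (f := fun x => e (h x - y))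
    ⟨a, mem_closedBall_self hr.le⟩ (e_cont.comp (hc.sub continuous_const)).continuousOn
  have hxa : e (h x - y) ≤ e (h a - y) := hmin (mem_closedBall_self hr.le)
  have hxa' : e (h a - y) = e (y - h a) := by rw [← e_neg]; simp
  have hxb : x ∈ ball a r := by
    rcases (mem_closedBall.1 hx).lt_or_eq with h1 | h1
    · exact h1
    · have := hm x h1
      have h2 := e_add (h x - y) (y - h a)
      rw [sub_add_sub_cancel] at h2
      linarith
  refine ⟨x, hxb, ?_⟩
  have hloc : IsLocalMin (fun x => e (h x - y)) x :=
    hmin.isLocalMin (mem_of_superset (isOpen_ball.mem_nhds hxb) ball_subset_closedBall)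
  have hu : HasFDerivAt (fun x => h x - y) (h' x) x := (hd x).sub_const y
  have hder := ((hu.fst.pow 2).add (hu.snd.pow 2))
  have h0 := hloc.hasFDerivAt_eq_zero hder
  obtain ⟨v, hv⟩ := surj_of_inj (hi x) (h x - y)
  have h1 := congrArg (fun L : W →L[ℝ] ℝ => L v) h0
  simp [hv] at h1
  have : h x - y = 0 := e_zero (by simp [e]; nlinarith)
  exact sub_eq_zero.1 this

lemma lower_bound {h : W → W} {L : W →L[ℝ] W} {a : W} (hd : HasFDerivAt h L a)
    (hi : Injective L) : ∃ c > 0, ∃ ρ > 0, ∀ x, ‖x - a‖ < ρ → c * ‖x - a‖ ≤ ‖h x - h a‖ := by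
  obtain ⟨c, hc, hL⟩ : ∃ c > 0, ∀ v, c * ‖v‖ ≤ ‖L v‖ := by
    obtain ⟨K, hK, h⟩ := (LinearMap.exists_antilipschitzWith (L : W →ₗ[ℝ] W)
      (LinearMap.ker_eq_bot.2 hi))
    refine ⟨(K:ℝ)⁻¹, by positivity, fun v => ?_⟩
    have h1 := h.le_mul_dist v 0
    simp only [dist_zero_right, map_zero] at h1
    rw [inv_mul_le_iff₀ (by positivity)]; exact h1
  have h1 := (hasFDerivAt_iff_isLittleO.1 hd).def (half_pos hc)
  obtain ⟨ρ, hρ, h2⟩ := Metric.eventually_nhds_iff.1 h1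
  refine ⟨c/2, by positivity, ρ, hρ, fun x hx => ?_⟩
  have h3 := h2 (by rwa [dist_eq_norm] : dist x a < ρ)
  have h4 := hL (x - a)
  have h5 : ‖L (x-a)‖ ≤ ‖h x - h a‖ + ‖h x - h a - L (x - a)‖ := by
    have := norm_sub_le (h x - h a) (h x - h a - L (x - a))
    simpa using this
  linarith

lemma isOpenMap_of {h : W → W} {h' : W → W →L[ℝ] W} (hd : ∀ x, HasFDerivAt h (h' x) x)
    (hi : ∀ x, Injective (h' x)) : IsOpenMap h := by
  rw [isOpenMap_iff_nhds_le]
  intro a s hs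
  rw [mem_map] at hs
  obtain ⟨c, hc, ρ, hρ, hb⟩ := lower_bound (hd a) (hi a)
  obtain ⟨r0, hr0, hs⟩ := Metric.mem_nhds_iff.1 hs
  set r := min (r0/2) (ρ/2)
  have hr : 0 < r := by positivity
  have hrr : r < r0 := (min_le_left _ _).trans_lt (by linarith)
  have hrρ : r < ρ := (min_le_right _ _).trans_lt (by linarith)
  rw [Metric.mem_nhds_iff]
  refine ⟨c*r/4, by positivity, fun y hy => ?_⟩
  obtain ⟨x, hx, rfl⟩ := open_aux hd hi hr (a := a) (m := (c*r)^2) (fun x hx => by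
    have h1 := hb x (by rw [← dist_eq_norm, mem_sphere.1 hx]; exact hrρ)
    rw [← dist_eq_norm, mem_sphere.1 hx] at h1
    refine le_trans ?_ (norm_sq_le_e _)
    gcongr) (y := y) (by
    have h1 := e_le_norm_sq (y - h a)
    rw [mem_ball, dist_eq_norm] at hy
    nlinarith [norm_nonneg (y - h a), mul_pos hc hr])
  exact hs (ball_subset_ball hrr.le hx)
end Emb

namespace Emb

def LI (f : W → W) (E : Set W) : Prop := ∀ q ∈ E, ∃ U ∈ 𝓝 q, InjOn f U

lemma lift_unique {f : W → W} {E : Set W} (hE : LI f E) {X : Type*} [TopologicalSpace X]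
    {S : Set X} (hS : IsPreconnected S)
    {g1 g2 : X → W} (h1 : ContinuousOn g1 S) (h2 : ContinuousOn g2 S)
    (hE1 : ∀ z ∈ S, g1 z ∈ E) (hf : ∀ z ∈ S, f (g1 z) = f (g2 z)) {a : X} (ha : a ∈ S)
    (hag : g1 a = g2 a) : EqOn g1 g2 S := by
  have : PreconnectedSpace S := isPreconnected_iff_preconnectedSpace.1 hS
  have c1 : Continuous (S.domRestrict g1) := continuousOn_iff_continuous_domRestrict.1 h1
  have c2 : Continuous (S.domRestrict g2) := continuousOn_iff_continuous_domRestrict.1 h2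
  have hcl : IsClosed {x : S | S.domRestrict g1 x = S.domRestrict g2 x} := isClosed_eq c1 c2
  have hop : IsOpen {x : S | S.domRestrict g1 x = S.domRestrict g2 x} := by
    rw [isOpen_iff_mem_nhds]
    intro x hx
    obtain ⟨U, hU, hinj⟩ := hE _ (hE1 x x.2)
    have e1 : ∀ᶠ y in 𝓝 x, S.domRestrict g1 y ∈ U := c1.continuousAt hU
    have e2 : ∀ᶠ y in 𝓝 x, S.domRestrict g2 y ∈ U := by
      apply c2.continuousAt
      rw [← (show S.domRestrict g1 x = S.domRestrict g2 x from hx)]; exact hU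
    filter_upwards [e1, e2] with y y1 y2
    exact hinj y1 y2 (hf y y.2)
  have := IsClopen.eq_univ ⟨hcl, hop⟩ ⟨⟨a, ha⟩, hag⟩
  intro z hz
  have hz' : (⟨z, hz⟩ : S) ∈ {x : S | S.domRestrict g1 x = S.domRestrict g2 x} := by rw [this]; trivial
  exact hz'

lemma segment_compact (a b : W) : IsCompact (segment ℝ a b) := by
  rw [segment_eq_image_lineMap]
  exact isCompact_Icc.image (by fun_prop)

lemma local_inv {f : W → W} (ho : IsOpenMap f) {E : Set W} (hEo : IsOpen E) (hE : LI f E)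
    {q : W} (hq : q ∈ E) : ∃ U : Set W, IsOpen U ∧ q ∈ U ∧ U ⊆ E ∧ ∃ η > 0, ∃ k : W → W,
      ContinuousOn k (ball (f q) η) ∧ (∀ z ∈ ball (f q) η, k z ∈ U ∧ f (k z) = z) ∧
      ∀ x ∈ U, f x ∈ ball (f q) η → k (f x) = x := by
  obtain ⟨U0, hU0, hinj0⟩ := hE q hq
  obtain ⟨U, hUs, hU, hqU⟩ := _root_.mem_nhds_iff.1 (inter_mem hU0 (hEo.mem_nhds hq))
  have hinj : InjOn f U := hinj0.mono fun x hx => (hUs hx).1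
  obtain ⟨η, hη, hb⟩ := Metric.mem_nhds_iff.1 ((ho U hU).mem_nhds (mem_image_of_mem f hqU))
  have hk : ∀ z ∈ ball (f q) η, invFunOn f U z ∈ U ∧ f (invFunOn f U z) = z := fun z hz =>
    ⟨invFunOn_mem (hb hz), invFunOn_eq (hb hz)⟩
  have hk2 : ∀ x ∈ U, f x ∈ ball (f q) η → invFunOn f U (f x) = x := fun x hx hz =>
    hinj (hk _ hz).1 hx (hk _ hz).2
  refine ⟨U, hU, hqU, fun x hx => (hUs hx).2, η, hη, invFunOn f U, ?_, hk, hk2⟩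
  intro z hz
  refine ContinuousAt.continuousWithinAt ?_
  intro V hV
  obtain ⟨V', hV's, hV', hzV⟩ := _root_.mem_nhds_iff.1 hV
  have : f '' (V' ∩ U) ∈ 𝓝 z := (ho _ (hV'.inter hU)).mem_nhds
    ⟨_, ⟨hzV, (hk z hz).1⟩, (hk z hz).2⟩
  rw [mem_map]
  filter_upwards [this, isOpen_ball.mem_nhds hz] with w hw hwb
  obtain ⟨x, hx, rfl⟩ := hw
  rw [mem_preimage, hk2 x hx.2 hwb]; exact hV's hx.1

def IsSec (f : W → W) (E : Set W) (p : W) (Q : Set W) (g : W → W) : Prop :=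
  IsOpen Q ∧ Convex ℝ Q ∧ f p ∈ Q ∧ ContinuousOn g Q ∧ (∀ z ∈ Q, f (g z) = z) ∧
    (∀ z ∈ Q, g z ∈ E) ∧ g (f p) = p

def Om (f : W → W) (E : Set W) (p : W) : Set W := {z | ∃ Q g, IsSec f E p Q g ∧ z ∈ Q}

open Classical in
def Gs (f : W → W) (E : Set W) (p : W) (z : W) : W :=
  if h : z ∈ Om f E p then h.choose_spec.choose z else p

lemma Gs_eq {f : W → W} {E : Set W} (hE : LI f E) {p : W} {Q : Set W} {g : W → W}
    (h : IsSec f E p Q g) : EqOn (Gs f E p) g Q := by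
  intro z hz
  have hΩ : z ∈ Om f E p := ⟨Q, g, h, hz⟩
  have h' := hΩ.choose_spec.choose_spec
  rw [Gs, dif_pos hΩ]
  set Q' := hΩ.choose
  set g' := hΩ.choose_spec.choose
  obtain ⟨⟨o1, c1, m1, k1, f1, e1, b1⟩, hz'⟩ := h'
  obtain ⟨o2, c2, m2, k2, f2, e2, b2⟩ := h
  exact lift_unique hE (c1.inter c2).isPreconnected (k1.mono inter_subset_left)
    (k2.mono inter_subset_right) (fun z hz => e1 z hz.1)
    (fun z hz => (f1 z hz.1).trans (f2 z hz.2).symm) ⟨m1, m2⟩ (b1.trans b2.symm) ⟨hz', hz⟩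

lemma Om_open {f : W → W} {E : Set W} {p : W} : IsOpen (Om f E p) := by
  rw [isOpen_iff_mem_nhds]
  rintro z ⟨Q, g, h, hz⟩
  exact mem_of_superset (h.1.mem_nhds hz) fun w hw => ⟨Q, g, h, hw⟩

lemma Gs_cont {f : W → W} {E : Set W} (hE : LI f E) {p : W} :
    ContinuousOn (Gs f E p) (Om f E p) := by
  rintro z ⟨Q, g, h, hz⟩
  refine ContinuousAt.continuousWithinAt ?_
  refine (h.2.2.2.1.continuousAt (h.1.mem_nhds hz)).congr ?_
  filter_upwards [h.1.mem_nhds hz] with w hw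
  exact (Gs_eq hE h hw).symm

lemma Gs_contAt {f : W → W} {E : Set W} (hE : LI f E) {p z : W} (hz : z ∈ Om f E p) :
    ContinuousAt (Gs f E p) z := (Gs_cont hE).continuousAt (Om_open.mem_nhds hz)

lemma f_Gs {f : W → W} {E : Set W} (hE : LI f E) {p z : W} (hz : z ∈ Om f E p) :
    f (Gs f E p z) = z := by
  obtain ⟨Q, g, h, hz⟩ := hz
  rw [Gs_eq hE h hz]; exact h.2.2.2.2.1 z hz

lemma Gs_mem {f : W → W} {E : Set W} (hE : LI f E) {p z : W} (hz : z ∈ Om f E p) :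
    Gs f E p z ∈ E := by
  obtain ⟨Q, g, h, hz⟩ := hz
  rw [Gs_eq hE h hz]; exact h.2.2.2.2.2.1 z hz

lemma Om_base {f : W → W} (ho : IsOpenMap f) {E : Set W} (hEo : IsOpen E) (hE : LI f E)
    {p : W} (hp : p ∈ E) : f p ∈ Om f E p := by
  obtain ⟨U, hU, hpU, hUE, η, hη, k, kc, hk, hk2⟩ := local_inv ho hEo hE hp
  exact ⟨ball (f p) η, k, ⟨isOpen_ball, convex_ball _ _, mem_ball_self hη, kc,
    fun z hz => (hk z hz).2, fun z hz => hUE (hk z hz).1, hk2 p hpU (mem_ball_self hη)⟩,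
    mem_ball_self hη⟩

lemma Gs_base {f : W → W} (ho : IsOpenMap f) {E : Set W} (hEo : IsOpen E) (hE : LI f E)
    {p : W} (hp : p ∈ E) : Gs f E p (f p) = p := by
  obtain ⟨Q, g, h, hz⟩ := Om_base ho hEo hE hp
  rw [Gs_eq hE h hz]; exact h.2.2.2.2.2.2

lemma Om_star {f : W → W} {E : Set W} {p : W} : StarConvex ℝ (f p) (Om f E p) := by
  rintro z ⟨Q, g, h, hz⟩ a b ha hb hab
  exact ⟨Q, g, h, h.2.1 h.2.2.1 hz ha hb hab⟩

lemma Om_seg {f : W → W} {E : Set W} {p z : W} (hz : z ∈ Om f E p) :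
    segment ℝ (f p) z ⊆ Om f E p := Om_star.segment_subset hz

lemma ext_prop {f : W → W} (ho : IsOpenMap f) {E : Set W} (hEo : IsOpen E) (hE : LI f E)
    {p zs q : W} (hseg : ∀ t : ℝ, 0 ≤ t → t < 1 → AffineMap.lineMap (f p) zs t ∈ Om f E p)
    (hq : q ∈ E) (hqz : f q = zs)
    (hfr : ∀ V ∈ 𝓝 q, ∃ᶠ z in 𝓝 zs, z ∈ Om f E p ∧ Gs f E p z ∈ V) : zs ∈ Om f E p := by
  obtain ⟨U, hU, hqU, hUE, η, hη, k, kc, hk, hk2⟩ := local_inv ho hEo hE hq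
  rw [hqz] at kc hk hk2
  set O := f p
  set G := Gs f E p
  obtain ⟨t, ht0, ht1, htb⟩ : ∃ t : ℝ, 0 ≤ t ∧ t < 1 ∧ AffineMap.lineMap O zs t ∈ ball zs η := by
    have hc : Tendsto (fun t : ℝ => AffineMap.lineMap O zs t) (𝓝[<] 1) (𝓝 zs) := by
      have : Continuous (fun t : ℝ => AffineMap.lineMap (k := ℝ) O zs t) := by fun_prop
      have h2 := (this.tendsto 1)
      simp only [AffineMap.lineMap_apply_one] at h2
      exact h2.mono_left nhdsWithin_le_nhds
    have h1 := hc (ball_mem_nhds zs hη)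
    have h2 : Ioo (0:ℝ) 1 ∈ 𝓝[<] (1:ℝ) := Ioo_mem_nhdsLT one_pos
    obtain ⟨t, h3, h4⟩ := (Filter.nonempty_of_mem (Filter.inter_mem (mem_map.1 h1) h2))
    exact ⟨t, h4.1.le, h4.2, h3⟩
  set w := AffineMap.lineMap O zs t with hw
  have hwΩ : w ∈ Om f E p := hseg t ht0 ht1
  have hGk : G w = k w := by
    by_contra hne
    have cG : ContinuousAt G w := Gs_contAt hE hwΩ
    have ck : ContinuousAt k w := kc.continuousAt (isOpen_ball.mem_nhds htb)
    have hev : ∀ᶠ x in 𝓝 w, G x ≠ k x := (cG.tendsto.prodMk_nhds ck.tendsto).eventually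
      ((isOpen_ne_fun continuous_fst continuous_snd).mem_nhds hne)
    have hl : Tendsto (fun z => AffineMap.lineMap O z t) (𝓝 zs) (𝓝 w) := by
      have : Continuous (fun z : W => AffineMap.lineMap (k := ℝ) O z t) := by
        simp only [AffineMap.lineMap_apply_module']; fun_prop
      exact this.tendsto zs
    have h1 := hl.eventually hev
    have h2 := hl.eventually (isOpen_ball.mem_nhds htb)
    obtain ⟨z, ⟨⟨hzΩ, hzU⟩, h3, h4⟩, hzb⟩ :=
      ((hfr U (hU.mem_nhds hqU)).and_eventually (h1.and h2)
        |>.and_eventually (ball_mem_nhds zs hη)).exists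
    apply h3
    have hkz : G z = k z := by
      have := hk2 (G z) hzU (by rw [f_Gs hE hzΩ]; exact hzb)
      rw [f_Gs hE hzΩ] at this; exact this.symm
    have hs1 : segment ℝ (AffineMap.lineMap O z t) z ⊆ ball zs η :=
      (convex_ball zs η).segment_subset h4 hzb
    have hs2 : segment ℝ (AffineMap.lineMap O z t) z ⊆ Om f E p := by
      refine Subset.trans ?_ (Om_seg hzΩ)
      apply (convex_segment O z).segment_subset _ (right_mem_segment ℝ O z)
      rw [segment_eq_image_lineMap]
      exact ⟨t, ⟨ht0, ht1.le⟩, rfl⟩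
    exact lift_unique hE (convex_segment _ z).isPreconnected ((Gs_cont hE).mono hs2)
      (kc.mono hs1) (fun x hx => Gs_mem hE (hs2 hx))
      (fun x hx => (f_Gs hE (hs2 hx)).trans (hk x (hs1 hx)).2.symm)
      (right_mem_segment ℝ _ z) hkz (left_mem_segment ℝ _ z)
  -- new section
  obtain ⟨δ0, hδ0, hδ⟩ := (segment_compact O w).exists_thickening_subset_open Om_open
    (Om_seg hwΩ)
  set δ := min δ0 (η - dist w zs)
  have hδp : 0 < δ := lt_min hδ0 (by rw [mem_ball] at htb; linarith)
  set A := thickening δ (segment ℝ O w)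
  set Bb := ball zs η
  have hA : A ⊆ Om f E p := (thickening_mono (min_le_left _ _) _).trans hδ
  have hcA : Convex ℝ A := (convex_segment O w).thickening δ
  have hwA : w ∈ A := self_subset_thickening hδp _ (right_mem_segment ℝ O w)
  have hAB : EqOn G k (A ∩ Bb) := lift_unique hE (hcA.inter (convex_ball zs η)).isPreconnected
    ((Gs_cont hE).mono (inter_subset_left.trans hA)) (kc.mono inter_subset_right)
    (fun x hx => Gs_mem hE (hA hx.1))
    (fun x hx => (f_Gs hE (hA hx.1)).trans (hk x hx.2).2.symm) ⟨hwA, htb⟩ hGk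
  classical
  set g : W → W := fun z => if z ∈ A then G z else k z
  have gA : EqOn g G A := fun z hz => if_pos hz
  have gB : EqOn g k Bb := fun z hz => by
    by_cases h : z ∈ A
    · rw [gA h, hAB ⟨h, hz⟩]
    · exact if_neg h
  have hQ : thickening δ (segment ℝ O zs) ⊆ A ∪ Bb := by
    intro x hx
    obtain ⟨y, hy, hxy⟩ := mem_thickening_iff.1 hx
    have hy2 : y ∈ segment ℝ O w ∪ segment ℝ w zs := by
      rw [segment_eq_image_lineMap] at hy
      obtain ⟨s, hs, rfl⟩ := hy
      rcases le_total s t with h | h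
      · left
        rcases eq_or_lt_of_le ht0 with h0 | h0
        · have : s = 0 := le_antisymm (by linarith) hs.1
          subst this; simp [left_mem_segment]
        · rw [segment_eq_image_lineMap]
          refine ⟨s / t, ⟨div_nonneg hs.1 ht0, div_le_one_of_le₀ h ht0⟩, ?_⟩
          rw [hw]; simp only [AffineMap.lineMap_apply_module']
          simp only [add_sub_cancel_right, smul_smul]
          rw [div_mul_cancel₀ _ h0.ne']
      · right
        rw [segment_eq_image_lineMap]
        have h1 : 1 - t ≠ 0 := by linarith
        refine ⟨(s - t) / (1 - t), ⟨div_nonneg (by linarith) (by linarith),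
          div_le_one_of_le₀ (by linarith [hs.2]) (by linarith)⟩, ?_⟩
        rw [hw]; simp only [AffineMap.lineMap_apply_module']
        ext <;> simp <;> field_simp <;> ring
    rcases hy2 with h | h
    · left; exact mem_thickening_iff.2 ⟨y, h, hxy⟩
    · right
      have h3 : y ∈ closedBall zs (dist w zs) :=
        (convex_closedBall zs _).segment_subset (by simp) (by simp) h
      rw [mem_ball]
      have := dist_triangle x y zs
      have h4 : δ ≤ η - dist w zs := min_le_right _ _
      rw [mem_closedBall] at h3
      linarith
  refine ⟨thickening δ (segment ℝ O zs), g, ⟨isOpen_thickening, (convex_segment O zs).thickening δ,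
    self_subset_thickening hδp _ (left_mem_segment ℝ _ _), ?_, ?_, ?_, ?_⟩,
    self_subset_thickening hδp _ (right_mem_segment ℝ _ _)⟩
  · intro z hz
    refine ContinuousAt.continuousWithinAt ?_
    rcases hQ hz with h | h
    · refine (Gs_contAt hE (hA h)).congr ?_
      filter_upwards [isOpen_thickening.mem_nhds h] with x hx using (gA hx).symm
    · refine (kc.continuousAt (isOpen_ball.mem_nhds h)).congr ?_
      filter_upwards [isOpen_ball.mem_nhds h] with x hx using (gB hx).symm
  · intro z hz
    rcases hQ hz with h | h
    · rw [gA h, f_Gs hE (hA h)]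
    · rw [gB h, (hk z h).2]
  · intro z hz
    rcases hQ hz with h | h
    · rw [gA h]; exact Gs_mem hE (hA h)
    · rw [gB h]; exact hUE (hk z h).1
  · have h : O ∈ A := self_subset_thickening hδp _ (left_mem_segment ℝ _ _)
    rw [gA h]
    obtain ⟨Q, g', h', hz⟩ := hA h
    exact (Gs_eq hE h' hz).trans h'.2.2.2.2.2.2

lemma ext_compact {f : W → W} (hc : Continuous f) (ho : IsOpenMap f) {E : Set W} (hEo : IsOpen E)
    (hE : LI f E) {p zs : W} {K : Set W} (hK : IsCompact K)
    (hseg : ∀ t : ℝ, 0 ≤ t → t < 1 → AffineMap.lineMap (f p) zs t ∈ Om f E p)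
    (hfr : ∃ᶠ z in 𝓝 zs, z ∈ Om f E p ∧ Gs f E p z ∈ K) :
    ∃ q ∈ K, f q = zs ∧ (q ∈ E → zs ∈ Om f E p) := by
  set G := Gs f E p
  set l := 𝓝 zs ⊓ 𝓟 {z | z ∈ Om f E p ∧ G z ∈ K}
  have : NeBot l := frequently_mem_iff_neBot.1 hfr
  have hl : map G l ≤ 𝓟 K := by
    rw [le_principal_iff, mem_map]
    exact mem_inf_of_right (mem_principal.2 fun z hz => hz.2)
  obtain ⟨q, hqK, hq⟩ := hK hl
  have hfr2 : ∀ V ∈ 𝓝 q, ∃ᶠ z in 𝓝 zs, z ∈ Om f E p ∧ G z ∈ V := by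
    intro V hV
    have h1 : ∃ᶠ z in l, G z ∈ V := (mapClusterPt_iff_frequently.1 hq) V hV
    rw [frequently_inf_principal] at h1
    exact h1.mono fun z hz => ⟨hz.1.1, hz.2⟩
  have hqz : f q = zs := by
    by_contra hne
    obtain ⟨U, V, hU, hV, hqU, hzV, hd⟩ := t2_separation hne
    obtain ⟨z, hz, hzV⟩ := ((hfr2 _ (hc.continuousAt (hU.mem_nhds hqU))).and_eventually
      (hV.mem_nhds hzV)).exists
    have hz2 : f (G z) ∈ U := hz.2
    rw [f_Gs hE hz.1] at hz2
    exact disjoint_left.1 hd hz2 hzV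
  exact ⟨q, hqK, hqz, fun hqE => ext_prop ho hEo hE hseg hqE hqz hfr2⟩

lemma blowup {f : W → W} (hc : Continuous f) (ho : IsOpenMap f) (hE : LI f univ) {p zs : W}
    (hseg : ∀ t : ℝ, 0 ≤ t → t < 1 → AffineMap.lineMap (f p) zs t ∈ Om f univ p)
    (hz : zs ∉ Om f univ p) (M : ℝ) :
    ∃ r > 0, ∀ z ∈ Om f univ p, dist z zs < r → M < ‖Gs f univ p z‖ := by
  by_contra! hcon
  have : ∃ᶠ z in 𝓝 zs, z ∈ Om f univ p ∧ Gs f univ p z ∈ closedBall (0:W) M := by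
    rw [frequently_iff]
    intro U hU
    obtain ⟨r, hr, hb⟩ := Metric.mem_nhds_iff.1 hU
    obtain ⟨z, h1, h2, h3⟩ := hcon r hr
    exact ⟨z, hb h2, h1, by simpa using h3⟩
  obtain ⟨q, -, -, h⟩ := ext_compact hc ho isOpen_univ hE (isCompact_closedBall 0 M) hseg this
  exact hz (h trivial)

lemma exit_point {Om : Set W} (hO : IsOpen Om) {O z : W} (h0 : O ∈ Om) (hz : z ∉ Om) :
    ∃ t : ℝ, 0 < t ∧ t ≤ 1 ∧ AffineMap.lineMap O z t ∉ Om ∧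
      ∀ s : ℝ, 0 ≤ s → s < t → AffineMap.lineMap O z s ∈ Om := by
  have hcont : Continuous (fun t : ℝ => AffineMap.lineMap (k := ℝ) O z t) := by fun_prop
  have hcl : IsCompact (Icc (0:ℝ) 1 ∩ {t | AffineMap.lineMap O z t ∉ Om}) :=
    isCompact_Icc.inter_right (hO.isClosed_compl.preimage hcont)
  obtain ⟨t, ht, hmin⟩ := hcl.exists_isLeast ⟨1, by simp, by simpa using hz⟩
  refine ⟨t, ?_, ht.1.2, ht.2, fun s hs hst => ?_⟩
  · rcases ht.1.1.lt_or_eq with h | h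
    · exact h
    · exfalso; apply ht.2; rw [← h]; simpa using h0
  · by_contra h
    exact absurd (hmin ⟨⟨hs, hst.le.trans ht.1.2⟩, h⟩) (not_le.2 hst)
end Emb

namespace Emb

lemma antilip {L : W →L[ℝ] W} (hi : Injective L) : ∃ c > 0, ∀ v, c * ‖v‖ ≤ ‖L v‖ := by
  obtain ⟨K, hK, h⟩ := (LinearMap.exists_antilipschitzWith (L : W →ₗ[ℝ] W)
    (LinearMap.ker_eq_bot.2 hi))
  refine ⟨(K:ℝ)⁻¹, by positivity, fun v => ?_⟩
  have h1 := h.le_mul_dist v 0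
  simp only [dist_zero_right, map_zero] at h1
  rw [inv_mul_le_iff₀ (by positivity)]; exact h1

lemma seg_frequently {O zs : W} {P : W → Prop}
    (h : ∀ t : ℝ, 0 ≤ t → t < 1 → P (AffineMap.lineMap O zs t)) : ∃ᶠ z in 𝓝 zs, P z := by
  have hc : Tendsto (fun t : ℝ => AffineMap.lineMap O zs t) (𝓝[<] 1) (𝓝 zs) := by
    have : Continuous (fun t : ℝ => AffineMap.lineMap (k := ℝ) O zs t) := by fun_prop
    have h2 := (this.tendsto 1)
    simp only [AffineMap.lineMap_apply_one] at h2
    exact h2.mono_left nhdsWithin_le_nhds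
  refine hc.frequently (Eventually.frequently ?_)
  filter_upwards [Ioo_mem_nhdsLT (one_pos : (0:ℝ) < 1)] with t ht
  exact h t ht.1.le ht.2

lemma lineMap_lineMap_left (O z : W) (s t : ℝ) :
    AffineMap.lineMap O (AffineMap.lineMap O z t) s = AffineMap.lineMap O z (s * t) := by
  simp only [AffineMap.lineMap_apply_module']
  simp [smul_smul]

lemma subset_Om {f : W → W} {E : Set W} {p : W} (h0 : f p ∈ Om f E p) {D : Set W}
    (hD : Convex ℝ D) (hpD : f p ∈ D)
    (h : ∀ zs ∈ D, (∀ t : ℝ, 0 ≤ t → t < 1 → AffineMap.lineMap (f p) zs t ∈ Om f E p) →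
      zs ∈ Om f E p) : D ⊆ Om f E p := by
  intro z hz
  by_contra hzΩ
  obtain ⟨t, ht0, ht1, hn, hs⟩ := exit_point Om_open h0 hzΩ
  apply hn
  apply h
  · apply hD.segment_subset hpD hz
    rw [segment_eq_image_lineMap]
    exact ⟨t, ⟨ht0.le, ht1⟩, rfl⟩
  · intro s hs0 hs1
    rw [lineMap_lineMap_left]
    exact hs _ (by positivity) (by nlinarith)

theorem locInj {f : W → W} {f' : W → W →L[ℝ] W} (hd : ∀ x, HasFDerivAt f (f' x) x)
    (hi : ∀ x, Injective (f' x)) : LI f univ := by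
  have hc : Continuous f := continuous_iff_continuousAt.2 fun x => (hd x).continuousAt
  have ho : IsOpenMap f := isOpenMap_of hd hi
  set B : Set W := {x | ¬ ∃ U ∈ 𝓝 x, InjOn f U} with hB
  have hBc : IsClosed B := by
    rw [← isOpen_compl_iff, isOpen_iff_mem_nhds]
    intro x hx
    simp only [hB, mem_compl_iff, mem_ofPred_eq, not_not] at hx
    obtain ⟨U, hU, hinj⟩ := hx
    filter_upwards [eventually_mem_nhds_iff.2 hU] with y hy
    simp only [hB, mem_compl_iff, mem_ofPred_eq, not_not]
    exact ⟨U, hy, hinj⟩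
  intro x00 _
  by_contra hx00
  have hx00 : x00 ∈ B := hx00
  have : CompleteSpace B := hBc.completeSpace_coe
  have : Nonempty B := ⟨⟨x00, hx00⟩⟩
  -- Baire
  obtain ⟨κ, hκ, x0, hx0, r, hr, hEr⟩ : ∃ κ > 0, ∃ x0 ∈ B, ∃ r > 0, ∀ x ∈ B, dist x x0 < r →
      ∀ x', ‖x' - x‖ < κ → κ * ‖x' - x‖ ≤ ‖f x' - f x‖ := by
    set Es : ℕ → Set B := fun n => {x | ∀ x' : W, ‖x' - x‖ < 1/((n:ℝ)+1) →
      1/((n:ℝ)+1) * ‖x' - x‖ ≤ ‖f x' - f x‖}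
    have hcl : ∀ n, IsClosed (Es n) := by
      intro n
      have : Es n = ⋂ x' : W, ({x : B | 1/((n:ℝ)+1) ≤ ‖x' - x‖} ∪
          {x : B | 1/((n:ℝ)+1) * ‖x' - x‖ ≤ ‖f x' - f x‖}) := by
        ext x
        simp only [Es, mem_iInter, mem_union, mem_ofPred_eq]
        refine forall_congr' fun x' => ?_
        rw [imp_iff_not_or, not_lt]
      rw [this]
      refine isClosed_iInter fun x' => IsClosed.union ?_ ?_
      · exact isClosed_le (by fun_prop) (by fun_prop)
      · exact isClosed_le (by fun_prop) (by fun_prop)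
    have hun : ⋃ n, Es n = univ := by
      refine eq_univ_of_forall fun x => ?_
      obtain ⟨c, hcp, ρ, hρ, hb⟩ := lower_bound (hd x) (hi x)
      obtain ⟨n, hn⟩ := exists_nat_one_div_lt (lt_min hcp hρ)
      refine mem_iUnion.2 ⟨n, fun x' hx' => ?_⟩
      refine le_trans ?_ (hb x' (hx'.trans (hn.trans_le (min_le_right _ _))))
      gcongr
      exact hn.le.trans (min_le_left _ _)
    obtain ⟨n, x0, hx0⟩ := nonempty_interior_of_iUnion_of_closed hcl hun
    obtain ⟨r, hr, hb⟩ := Metric.mem_nhds_iff.1 (mem_interior_iff_mem_nhds.1 hx0)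
    refine ⟨1/((n:ℝ)+1), by positivity, x0, x0.2, r, hr, fun x hx hxr => ?_⟩
    exact hb (show (⟨x, hx⟩ : B) ∈ ball x0 r from hxr)
  set r1 := min (r/2) (κ/4)
  have hr1 : 0 < r1 := by positivity
  have hr1r : r1 < r := (min_le_left _ _).trans_lt (by linarith)
  have hr1κ : r1 ≤ κ/4 := min_le_right _ _
  -- points in the closed ball
  have hcb : ∀ x ∈ B, x ∈ closedBall x0 r1 → ∀ x' ∈ closedBall x0 r1,
      κ * ‖x' - x‖ ≤ ‖f x' - f x‖ := by
    intro x hxB hx x' hx'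
    rw [mem_closedBall] at hx hx'
    refine hEr x hxB (by linarith) x' ?_
    rw [← dist_eq_norm]
    have := dist_triangle_right x' x x0
    linarith
  have hx0b : x0 ∈ closedBall x0 r1 := mem_closedBall_self hr1.le
  have hsph : ∀ x ∈ sphere x0 r1, κ * r1 ≤ ‖f x - f x0‖ := by
    intro x hx
    have := hcb x0 hx0 hx0b x (sphere_subset_closedBall hx)
    rwa [← dist_eq_norm x, mem_sphere.1 hx] at this
  set η := κ * r1 / 8 with hη
  have hηp : 0 < η := by positivity
  obtain ⟨a1, ha1, a2, ha2, hfa, hne⟩ : ∃ a1 ∈ ball x0 r1 ∩ f ⁻¹' ball (f x0) η,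
      ∃ a2 ∈ ball x0 r1 ∩ f ⁻¹' ball (f x0) η, f a1 = f a2 ∧ a1 ≠ a2 := by
    by_contra! hcon
    exact hx0 ⟨_, inter_mem (ball_mem_nhds x0 hr1) (hc.continuousAt (ball_mem_nhds (f x0) hηp)),
      fun a ha b hb hab => hcon a ha b hb hab⟩
  have hzero : ∀ x ∈ B, x ∈ closedBall x0 r1 → ∀ x' ∈ closedBall x0 r1, f x' = f x → x' = x := by
    intro x hxB hx x' hx' hff
    have := hcb x hxB hx x' hx'
    rw [hff, sub_self, norm_zero] at this
    have h2 : ‖x' - x‖ ≤ 0 := by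
      by_contra! h; nlinarith
    exact sub_eq_zero.1 (norm_le_zero_iff.1 h2)
  have hb1 := ball_subset_closedBall ha1.1
  have hb2 := ball_subset_closedBall ha2.1
  have ha1B : a1 ∉ B := fun h => hne (hzero a1 h hb1 a2 hb2 hfa.symm).symm
  have ha2B : a2 ∉ B := fun h => hne (hzero a2 h hb2 a1 hb1 hfa)
  set y := f a1 with hy
  set Bc := B ∩ closedBall x0 r1
  have hBcc : IsCompact (f '' Bc) := ((isCompact_closedBall x0 r1).inter_left hBc).image hc
  obtain ⟨y', ⟨x', hx', hfx'⟩, hyy'⟩ := hBcc.exists_infDist_eq_dist ⟨f x0, x0, ⟨hx0, hx0b⟩, rfl⟩ y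
  set R := dist y y' with hR
  have hRle : ∀ b ∈ Bc, R ≤ dist y (f b) := fun b hb =>
    hyy' ▸ infDist_le_dist_of_mem (mem_image_of_mem f hb)
  have hRpos : 0 < R := by
    rw [hR, dist_pos]
    intro h
    rw [← hfx'] at h
    exact ha1B (hzero x' hx'.1 hx'.2 a1 hb1 h ▸ hx'.1)
  have hRη : R < η := (hRle x0 ⟨hx0, hx0b⟩).trans_lt ha1.2
  set E := Bᶜ ∩ ball x0 r1
  have hEo : IsOpen E := hBc.isOpen_compl.inter isOpen_ball
  have hE : LI f E := fun q hq => not_not.1 hq.1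
  have hlift : ∀ a ∈ E, f a = y → ball y R ⊆ Om f E a := by
    intro a haE hay
    have hbase := Om_base ho hEo hE haE
    apply subset_Om hbase (convex_ball y R) (by rw [hay]; exact mem_ball_self hRpos)
    intro zs hzs hseg
    obtain ⟨q, hqK, hqz, hqE⟩ := ext_compact hc ho hEo hE (isCompact_closedBall x0 r1) hseg
      (seg_frequently fun t h0 h1 => ⟨hseg t h0 h1,
        ball_subset_closedBall (Gs_mem hE (hseg t h0 h1)).2⟩)
    apply hqE
    constructor
    · intro hqB
      have := hRle q ⟨hqB, hqK⟩
      rw [hqz, dist_comm] at this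
      exact absurd hzs (not_lt.2 this)
    · rcases (mem_closedBall.1 hqK).lt_or_eq with h | h
      · exact h
      · exfalso
        have h1 := hsph q h
        rw [hqz, ← dist_eq_norm] at h1
        have h2 := dist_triangle zs y (f x0)
        have h3 : dist y (f x0) < η := ha1.2
        rw [mem_ball] at hzs
        linarith
  have hE1 : a1 ∈ E := ⟨ha1B, ha1.1⟩
  have hE2 : a2 ∈ E := ⟨ha2B, ha2.1⟩
  have hl1 := hlift a1 hE1 rfl
  have hl2 := hlift a2 hE2 hfa.symm
  have hbase1 : Gs f E a1 y = a1 := Gs_base ho hEo hE hE1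
  have hbase2 : Gs f E a2 y = a2 := by rw [hfa]; exact Gs_base ho hEo hE hE2
  -- near y'
  obtain ⟨cL, hcL, hL⟩ := antilip (hi x')
  set L := f' x'
  set c := min (κ/4) (cL/4)
  have hcp : 0 < c := by positivity
  have hcκ : c ≤ κ/4 := min_le_left _ _
  have hccL : c ≤ cL/4 := min_le_right _ _
  obtain ⟨ρ, hρ, hder⟩ := Metric.eventually_nhds_iff.1
    ((hasFDerivAt_iff_isLittleO.1 (hd x')).def hcp)
  obtain ⟨τ, hτ0, hτR, hτ1, hτ2⟩ : ∃ τ, 0 < τ ∧ τ < R ∧ τ < κ * ρ ∧ 3 * τ < cL * ρ := by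
    have : 0 < min R (min (κ * ρ) (cL * ρ / 3)) := by positivity
    obtain ⟨τ, h1, h2⟩ := exists_between this
    rw [lt_min_iff, lt_min_iff] at h2
    exact ⟨τ, h1, h2.1, h2.2.1, by linarith [h2.2.2]⟩
  set z := AffineMap.lineMap y' y (τ/R) with hz
  have hzy' : dist z y' = τ := by
    rw [hz, dist_lineMap_left, dist_comm y' y, ← hR, Real.norm_of_nonneg (by positivity)]
    field_simp
  have hzy : dist z y = R - τ := by
    rw [hz, dist_lineMap_right, dist_comm y' y, ← hR, Real.norm_of_nonneg]
    · field_simp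
    · rw [sub_nonneg]; exact div_le_one_of_le₀ hτR.le hRpos.le
  have hzR : z ∈ ball y R := by rw [mem_ball, hzy]; linarith
  have hDsub : ball z τ ⊆ ball y R := by
    intro w hw
    rw [mem_ball] at *
    have := dist_triangle w z y
    linarith
  set D' : Set W := L ⁻¹' ball (z - y' + L x') (τ/2)
  have hD'c : Convex ℝ D' := (convex_ball _ _).is_linear_preimage L.isLinear
  have hD'mem : ∀ x, x ∈ D' ↔ ‖L (x - x') - (z - y')‖ < τ/2 := by
    intro x
    simp only [D', mem_preimage, mem_ball, dist_eq_norm, map_sub]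
    rw [show L x - (z - y' + L x') = L x - L x' - (z - y') by abel]
  have hgD : ∀ a ∈ E, f a = y → Gs f E a z ∈ D' := by
    intro a haE hay
    have hzO := hlift a haE hay hzR
    have hgE := Gs_mem hE hzO
    have hfg := f_Gs hE hzO
    have h1 := hcb x' hx'.1 hx'.2 _ (ball_subset_closedBall hgE.2)
    rw [hfg, hfx', ← dist_eq_norm z, hzy'] at h1
    have h2 : ‖Gs f E a z - x'‖ < ρ := by
      by_contra! h; nlinarith
    have h3 := hder (by rwa [dist_eq_norm] : dist (Gs f E a z) x' < ρ)
    rw [hfg, hfx', norm_sub_rev] at h3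
    rw [hD'mem]
    have h4 : c * ‖Gs f E a z - x'‖ ≤ κ/4 * ‖Gs f E a z - x'‖ := by gcongr
    linarith
  have hfD : ∀ x ∈ D', f x ∈ ball z τ := by
    intro x hx
    rw [hD'mem] at hx
    have h1 := hL (x - x')
    have h2 : ‖L (x - x')‖ ≤ ‖L (x - x') - (z - y')‖ + ‖z - y'‖ := by
      simpa using norm_add_le (L (x - x') - (z - y')) (z - y')
    rw [← dist_eq_norm z, hzy'] at h2
    have h3 : ‖x - x'‖ < ρ := by
      by_contra! h; nlinarith
    have h4 := hder (by rwa [dist_eq_norm] : dist x x' < ρ)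
    have h5 : c * ‖x - x'‖ ≤ cL/4 * ‖x - x'‖ := by gcongr
    rw [hfx'] at h4
    rw [mem_ball, dist_eq_norm]
    have h6 : ‖f x - z‖ ≤ ‖f x - y' - L (x - x')‖ + ‖L (x - x') - (z - y')‖ := by
      have := norm_add_le (f x - y' - L (x - x')) (L (x - x') - (z - y'))
      rwa [show f x - y' - L (x - x') + (L (x - x') - (z - y')) = f x - z by abel] at this
    linarith
  have hfDO : ∀ x ∈ D', f x ∈ Om f E a1 := fun x hx => hl1 (hDsub (hfD x hx))
  have hg1 := hgD a1 hE1 rfl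
  have hg2 := hgD a2 hE2 hfa.symm
  have hEq : EqOn (fun x => Gs f E a1 (f x)) id D' :=
    lift_unique hE hD'c.isPreconnected
      ((Gs_cont hE).comp hc.continuousOn hfDO) continuousOn_id
      (fun x hx => Gs_mem hE (hfDO x hx)) (fun x hx => f_Gs hE (hfDO x hx)) hg1
      (by simp only [id]; rw [f_Gs hE (hl1 hzR)])
  have h12 : Gs f E a1 z = Gs f E a2 z := by
    have := hEq hg2
    simp only [id] at this
    rwa [f_Gs hE (hl2 hzR)] at this
  have hEq2 := lift_unique hE (convex_ball y R).isPreconnected ((Gs_cont hE).mono hl1)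
    ((Gs_cont hE).mono hl2) (fun x hx => Gs_mem hE (hl1 hx))
    (fun x hx => (f_Gs hE (hl1 hx)).trans (f_Gs hE (hl2 hx)).symm) hzR h12
  have := hEq2 (mem_ball_self hRpos)
  rw [hbase1, hbase2] at this
  exact hne this
end Emb

namespace Emb

lemma Gs_isSec {f : W → W} (ho : IsOpenMap f) (hE : LI f univ) {p q : W}
    (hconv : Convex ℝ (Om f univ p)) (hq : f q ∈ Om f univ p) (hg : Gs f univ p (f q) = q) :
    IsSec f univ q (Om f univ p) (Gs f univ p) :=
  ⟨Om_open, hconv, hq, Gs_cont hE, fun _ hz => f_Gs hE hz, fun _ _ => trivial, hg⟩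

lemma inj_of_convex {f : W → W} (hc : Continuous f) (ho : IsOpenMap f) (hE : LI f univ)
    (hconv : ∀ p, Convex ℝ (Om f univ p)) : Injective f := by
  set R : W → W → Prop := fun p q => f q ∈ Om f univ p ∧ Gs f univ p (f q) = q
  have base : ∀ p, f p ∈ Om f univ p := fun p => Om_base ho isOpen_univ hE trivial
  have gbase : ∀ p, Gs f univ p (f p) = p := fun p => Gs_base ho isOpen_univ hE trivial
  have symm : ∀ p q, R p q → R q p := by
    rintro p q ⟨h1, h2⟩
    have hs := Gs_isSec ho hE (hconv p) h1 h2
    exact ⟨⟨_, _, hs, base p⟩, (Gs_eq hE hs (base p)).trans (gbase p)⟩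
  have trans : ∀ p q r, R p q → R q r → R p r := by
    intro p q r h1 h2
    have h3 := symm p q h1
    have hs := Gs_isSec ho hE (hconv q) h3.1 h3.2
    exact ⟨⟨_, _, hs, h2.1⟩, (Gs_eq hE hs h2.1).trans h2.2⟩
  have op : ∀ p q, R p q → ∀ᶠ r in 𝓝 q, R p r := by
    rintro p q ⟨h1, h2⟩
    obtain ⟨U, hU, hinj⟩ := hE q trivial
    have c1 : ContinuousAt (fun r => Gs f univ p (f r)) q :=
      (Gs_contAt hE h1).comp hc.continuousAt
    filter_upwards [hU, c1 (show U ∈ 𝓝 (Gs f univ p (f q)) by rw [h2]; exact hU), hc.continuousAt (Om_open.mem_nhds h1)]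
      with r r1 r2 r3
    exact ⟨r3, hinj r2 r1 (f_Gs hE r3)⟩
  intro a b hab
  have hclopen : IsClopen {r | R a r} := by
    constructor
    · rw [← isOpen_compl_iff, isOpen_iff_mem_nhds]
      intro r hr
      filter_upwards [op r r ⟨base r, gbase r⟩] with r' hr' har'
      exact hr (trans a r' r har' (symm _ _ hr'))
    · rw [isOpen_iff_mem_nhds]
      exact fun r hr => op a r hr
  have := hclopen.eq_univ ⟨a, base a, gbase a⟩
  have hb : R a b := by
    have : b ∈ {r | R a r} := by rw [this]; trivial
    exact this
  rw [← hb.2, ← hab, gbase]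

def det2 (u v : W) : ℝ := u.1 * v.2 - u.2 * v.1

def Sm (u v : W) (h : det2 u v ≠ 0) : W ≃ₗ[ℝ] W where
  toFun z := ((det2 u z - det2 z v) / det2 u v, (det2 u z + det2 z v) / det2 u v)
  invFun z := ((z.2 - z.1)/2) • u + ((z.2 + z.1)/2) • v
  map_add' a b := by ext <;> simp [det2] <;> ring
  map_smul' a b := by ext <;> simp [det2] <;> ring
  left_inv z := by
    have h' := h
    unfold det2 at h'
    ext <;> simp [det2] <;> field_simp <;> ring
  right_inv z := by
    have h' := h
    unfold det2 at h'
    ext <;> simp [det2] <;> field_simp <;> ring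

lemma transport {f : W → W} {p0 : W} (S : W ≃L[ℝ] W) {z : W}
    (hz : S (z - f p0) ∈ Om (fun p => S (f (p0 + S.symm p) - f p0)) univ 0) :
    z ∈ Om f univ p0 := by
  obtain ⟨Q, g, ⟨o, c, m, k, fg, -, b⟩, hzQ⟩ := hz
  have h1 : Continuous (fun z => S (z - f p0)) := by fun_prop
  simp only [map_zero, add_zero, sub_self] at m b
  refine ⟨(fun z => S (z - f p0)) ⁻¹' Q, fun z => p0 + S.symm (g (S (z - f p0))),
    ⟨o.preimage h1, ?_, ?_, ?_, ?_, fun _ _ => trivial, ?_⟩, hzQ⟩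
  · intro x hx y hy a b ha hb hab
    have := c hx hy ha hb hab
    simp only [mem_preimage]
    convert this using 1
    rw [← map_smul, ← map_smul, ← map_add]
    congr 1
    rw [smul_sub, smul_sub, sub_add_sub_comm, ← add_smul, hab, one_smul]
  · simpa using m
  · exact continuousOn_const.add (S.symm.continuous.comp_continuousOn
      (k.comp h1.continuousOn fun z hz => hz))
  · intro z hz
    have := fg _ hz
    simp only at this
    exact sub_left_injective (S.injective this)
  · simp [b]

lemma transport' {f : W → W} {p0 : W} (S : W ≃L[ℝ] W) {z : W} (hz : z ∈ Om f univ p0) :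
    S (z - f p0) ∈ Om (fun p => S (f (p0 + S.symm p) - f p0)) univ 0 := by
  obtain ⟨Q, g, ⟨o, c, m, k, fg, -, b⟩, hzQ⟩ := hz
  have h1 : Continuous (fun z => f p0 + S.symm z) := by fun_prop
  refine ⟨(fun z => f p0 + S.symm z) ⁻¹' Q, fun z => S (g (f p0 + S.symm z) - p0),
    ⟨o.preimage h1, ?_, ?_, ?_, ?_, fun _ _ => trivial, ?_⟩, by simpa using hzQ⟩
  · intro x hx y hy a b ha hb hab
    have := c hx hy ha hb hab
    simp only [mem_preimage]
    convert this using 1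
    rw [smul_add, smul_add, add_add_add_comm, ← add_smul, hab, one_smul, map_add, map_smul,
      map_smul]
  · simpa using m
  · exact S.continuous.comp_continuousOn
      ((k.comp h1.continuousOn fun z hz => hz).sub continuousOn_const)
  · intro z hz
    have := fg _ hz
    simp [this]
  · simp [b]

lemma star_det {Om : Set W} {O z1 z2 z3 : W} (hst : StarConvex ℝ O Om) (h1 : z1 ∈ Om)
    (h2 : z2 ∈ Om) {a b : ℝ} (ha : 0 ≤ a) (hb : 0 ≤ b) (hab : a + b = 1)
    (h3 : z3 = a • z1 + b • z2) (h3n : z3 ∉ Om) : det2 (z1 - O) (z2 - O) ≠ 0 := by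
  intro hdet
  have key : ∀ w ∈ Om, ∀ k : ℝ, 0 ≤ k → k ≤ 1 → z3 - O ≠ k • (w - O) := by
    intro w hw k h0 h1 h
    apply h3n
    have := hst hw (a := 1 - k) (b := k) (by linarith) h0 (by ring)
    convert this using 1
    rw [← sub_add_cancel z3 O, h, smul_sub, sub_smul, one_smul]; abel
  have hz3 : z3 - O = a • (z1 - O) + b • (z2 - O) := by
    rw [h3, smul_sub, smul_sub, sub_add_sub_comm, ← add_smul, hab, one_smul]
  set u := z1 - O
  set v := z2 - O
  by_cases hu : u = 0
  · exact key z2 h2 b hb (by linarith) (by rw [hz3, hu]; simp; rfl)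
  obtain ⟨c, hcv⟩ : ∃ c : ℝ, v = c • u := by
    unfold det2 at hdet
    by_cases hu1 : u.1 = 0
    · have hu2 : u.2 ≠ 0 := fun h => hu (Prod.ext hu1 h)
      refine ⟨v.2 / u.2, ?_⟩
      have : v.1 = 0 := by
        rw [hu1] at hdet
        simpa [hu2] using hdet
      ext <;> simp
      · rw [this, hu1]; simp
      · field_simp
    · refine ⟨v.1 / u.1, ?_⟩
      ext <;> simp
      · field_simp
      · field_simp; linarith
  have hz3' : z3 - O = (a + b * c) • u := by rw [hz3, hcv, smul_smul, add_smul]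
  have hz3v : ∀ k : ℝ, a + b * c = k * c → z3 - O = k • v := by
    intro k hk; rw [hz3', hk, hcv, smul_smul]
  rcases le_or_gt 0 (a + b * c) with h | h
  · rcases le_or_gt c 1 with hc1 | hc1
    · exact key z1 h1 _ h (by nlinarith) hz3'
    · refine key z2 h2 ((a + b * c) / c) (by positivity) ?_ (hz3v _ (by field_simp))
      rw [div_le_one (by linarith)]; nlinarith
  · have hc0 : c < 0 := by
      by_contra! hc0; nlinarith [mul_nonneg hb hc0]
    refine key z2 h2 ((a + b * c) / c) (div_nonneg_of_nonpos h.le hc0.le) ?_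
      (hz3v _ (by field_simp [hc0.ne]))
    rw [div_le_one_of_neg hc0]
    nlinarith

theorem inj_of_core (hcore : ∀ (f : W → W) (f' : W → W →L[ℝ] W) (ε x3 : ℝ), 0 < ε →
      (∀ x, HasFDerivAt f (f' x) x) →
      (∀ p v t, |t| < ε → f' p v = t • v → v = 0) → f 0 = 0 → |x3| ≤ 1 →
      (-1, 1) ∈ Om f univ 0 → (1, 1) ∈ Om f univ 0 → (x3, 1) ∉ Om f univ 0 → False)
    {f : W → W} {f' : W → W →L[ℝ] W} {ε : ℝ} (hε : 0 < ε) (hd : ∀ x, HasFDerivAt f (f' x) x)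
    (hs : ∀ p v t, |t| < ε → f' p v = t • v → v = 0) : Injective f := by
  have hi : ∀ x, Injective (f' x) := fun x => by
    refine (injective_iff_map_eq_zero (f' x)).2 fun v hv => hs x v 0 (by simpa) (by simpa)
  have hc : Continuous f := continuous_iff_continuousAt.2 fun x => (hd x).continuousAt
  have ho : IsOpenMap f := isOpenMap_of hd hi
  have hE := locInj hd hi
  apply inj_of_convex hc ho hE
  intro p0
  by_contra hcv
  simp only [Convex, StarConvex, not_forall] at hcv
  obtain ⟨z1, h1, z2, h2, a, b, ha, hb, hab, h3⟩ := hcv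
  have hdet := star_det Om_star h1 h2 ha hb hab rfl h3
  set S := (Sm (z1 - f p0) (z2 - f p0) hdet).toContinuousLinearEquiv
  have hS : ∀ z, S z = Sm (z1 - f p0) (z2 - f p0) hdet z := fun z => rfl
  have hS1 : S (z1 - f p0) = (-1, 1) := by
    rw [hS, Sm]; simp only [LinearEquiv.coe_mk, LinearMap.coe_mk, AddHom.coe_mk]
    have : det2 (z1 - f p0) (z1 - f p0) = 0 := by simp [det2]; ring
    rw [this]; ext <;> simp [neg_div, div_self hdet]
  have hS2 : S (z2 - f p0) = (1, 1) := by
    rw [hS, Sm]; simp only [LinearEquiv.coe_mk, LinearMap.coe_mk, AddHom.coe_mk]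
    have : det2 (z2 - f p0) (z2 - f p0) = 0 := by simp [det2]; ring
    rw [this]; ext <;> simp [neg_div, div_self hdet]
  refine hcore (fun p => S (f (p0 + S.symm p) - f p0))
    (fun p => (S : W →L[ℝ] W).comp ((f' (p0 + S.symm p)).comp (S.symm : W →L[ℝ] W)))
    ε (b - a) hε ?_ ?_ (by simp) (by rw [abs_le]; constructor <;> linarith) ?_ ?_ ?_
  · intro p
    have hA : HasFDerivAt (fun p => p0 + S.symm p) (S.symm : W →L[ℝ] W) p :=
      (S.symm : W →L[ℝ] W).hasFDerivAt.const_add p0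
    exact (S : W →L[ℝ] W).hasFDerivAt.comp p (((hd _).comp p hA).sub_const (f p0))
  · intro p v t ht hv
    have h4 := hs (p0 + S.symm p) (S.symm v) t ht (by
      apply S.injective
      rw [map_smul]
      simpa using hv)
    simpa using h4
  · rw [← hS1]; exact transport' S h1
  · rw [← hS2]; exact transport' S h2
  · intro h
    apply h3
    apply transport S
    convert h using 1
    have : a • z1 + b • z2 - f p0 = a • (z1 - f p0) + b • (z2 - f p0) := by
      rw [smul_sub, smul_sub, sub_add_sub_comm, ← add_smul, hab, one_smul]
    rw [this, map_add, map_smul, map_smul, hS1, hS2]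
    ext <;> simp
    · ring
    · exact hab
end Emb

namespace Emb

structure Core (f : W → W) (f' : W → W →L[ℝ] W) (ε : ℝ) (Ω : Set W) (G : W → W) : Prop where
  εpos : 0 < ε
  hd : ∀ x, HasFDerivAt f (f' x) x
  hs : ∀ p v t, |t| < ε → f' p v = t • v → v = 0
  f0 : f 0 = 0
  op : IsOpen Ω
  h0 : (0 : W) ∈ Ω
  star : ∀ z ∈ Ω, ∀ t : ℝ, 0 ≤ t → t ≤ 1 → t • z ∈ Ω
  cont : ContinuousOn G Ω
  fG : ∀ z ∈ Ω, f (G z) = z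
  G0 : G 0 = 0
  li : LI f univ
  blow : ∀ zs, zs ∉ Ω → (∀ t : ℝ, 0 ≤ t → t < 1 → t • zs ∈ Ω) → ∀ M : ℝ,
    ∃ r > 0, ∀ z ∈ Ω, dist z zs < r → M < ‖G z‖

def nn (s : ℝ) : W →L[ℝ] ℝ := ContinuousLinearMap.snd ℝ ℝ ℝ + s • ContinuousLinearMap.fst ℝ ℝ ℝ

@[simp] lemma nn_apply (s : ℝ) (z : W) : nn s z = z.2 + s * z.1 := by simp [nn]

def cone (l r : W) : Set W := {z | 0 ≤ det2 r z ∧ 0 ≤ det2 z l}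

lemma cone_repr {l r z : W} (h : 0 < det2 r l) :
    z = (det2 r z / det2 r l) • l + (det2 z l / det2 r l) • r := by
  have h' := h.ne'
  unfold det2 at h'
  ext <;> simp [det2] <;> field_simp <;> ring

lemma det2_cont {X : Type*} [TopologicalSpace X] {u v : X → W} (hu : Continuous u)
    (hv : Continuous v) : Continuous fun x => det2 (u x) (v x) := by
  unfold det2; fun_prop

lemma cone_closed (l r : W) : IsClosed (cone l r) :=
  (isClosed_le continuous_const (det2_cont continuous_const continuous_id)).inter
    (isClosed_le continuous_const (det2_cont continuous_id continuous_const))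

lemma cone_compact {l r : W} {s c : ℝ} (h : 0 < det2 r l) (hl : 0 < nn s l) (hr : 0 < nn s r) :
    IsCompact (cone l r ∩ {z | nn s z ≤ c}) := by
  apply Metric.isCompact_of_isClosed_isBounded
  · exact (cone_closed l r).inter (isClosed_le (by fun_prop) (by fun_prop))
  · rw [isBounded_iff_forall_norm_le]
    refine ⟨c / nn s l * ‖l‖ + c / nn s r * ‖r‖, ?_⟩
    rintro z ⟨⟨h1, h2⟩, h3⟩
    have h3 : nn s z ≤ c := h3
    have e1 := cone_repr (z := z) h
    set α := det2 r z / det2 r l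
    set β := det2 z l / det2 r l
    have hα : 0 ≤ α := by positivity
    have hβ : 0 ≤ β := by positivity
    have e2 : nn s z = α * nn s l + β * nn s r := by
      conv_lhs => rw [e1]
      rw [map_add, map_smul, map_smul]; rfl
    have hα' : α ≤ c / nn s l := by rw [le_div_iff₀ hl]; nlinarith
    have hβ' : β ≤ c / nn s r := by rw [le_div_iff₀ hr]; nlinarith
    calc ‖z‖ ≤ ‖α • l‖ + ‖β • r‖ := by conv_lhs => rw [e1]
                                       exact norm_add_le _ _
      _ = α * ‖l‖ + β * ‖r‖ := by
        rw [norm_smul, norm_smul, Real.norm_of_nonneg hα, Real.norm_of_nonneg hβ]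
      _ ≤ _ := by gcongr

lemma cone_nn_nonneg {l r z : W} {s : ℝ} (h : 0 < det2 r l) (hl : 0 < nn s l) (hr : 0 < nn s r)
    (hz : z ∈ cone l r) : 0 ≤ nn s z := by
  have e1 := cone_repr (z := z) h
  have h1 := hz.1
  have h2 := hz.2
  set α := det2 r z / det2 r l
  set β := det2 z l / det2 r l
  have hα : 0 ≤ α := by positivity
  have hβ : 0 ≤ β := by positivity
  rw [e1, map_add, map_smul, map_smul, smul_eq_mul, smul_eq_mul]
  positivity

namespace Core
variable {f : W → W} {f' : W → W →L[ℝ] W} {ε : ℝ} {Ω : Set W} {G : W → W}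

lemma fcont (C : Core f f' ε Ω G) : Continuous f :=
  continuous_iff_continuousAt.2 fun x => (C.hd x).continuousAt

lemma hi (C : Core f f' ε Ω G) (x : W) : Injective (f' x) :=
  (injective_iff_map_eq_zero (f' x)).2 fun v hv => C.hs x v 0 (by simpa using C.εpos) (by simpa)

lemma contAt (C : Core f f' ε Ω G) {z : W} (hz : z ∈ Ω) : ContinuousAt G z :=
  C.cont.continuousAt (C.op.mem_nhds hz)

lemma left_inv (C : Core f f' ε Ω G) {z : W} (hz : z ∈ Ω) :
    ∀ᶠ p in 𝓝 (G z), f p ∈ Ω ∧ G (f p) = p := by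
  obtain ⟨U, hU, hinj⟩ := C.li (G z) trivial
  have hfz := C.fG z hz
  have h1 : ContinuousAt f (G z) := C.fcont.continuousAt
  have h2 : ∀ᶠ p in 𝓝 (G z), f p ∈ Ω := h1 (by rw [hfz]; exact C.op.mem_nhds hz)
  have h3 : ContinuousAt (fun p => G (f p)) (G z) :=
    ContinuousAt.comp (by rw [hfz]; exact C.contAt hz) h1
  have h4 : ∀ᶠ p in 𝓝 (G z), G (f p) ∈ U :=
    h3 (show U ∈ 𝓝 (G (f (G z))) by rw [hfz]; exact hU)
  filter_upwards [hU, h2, h4] with p p1 p2 p3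
  exact ⟨p2, hinj p3 p1 (C.fG _ p2)⟩

lemma inj (C : Core f f' ε Ω G) : InjOn G Ω := fun a ha b hb h => by
  rw [← C.fG a ha, h, C.fG b hb]

lemma Mlemma (C : Core f f' ε Ω G) {l r : W} {s h R0 : ℝ} (hdet : 0 < det2 r l)
    (hl : 0 < nn s l) (hr : 0 < nn s r) (hh : 0 < h)
    (hQ : ∀ z ∈ cone l r, nn s z < h → z ∈ Ω)
    (hsl : ∀ τ : ℝ, 0 ≤ τ → nn s (τ • l) < h → |nn s (G (τ • l))| ≤ R0)
    (hsr : ∀ τ : ℝ, 0 ≤ τ → nn s (τ • r) < h → |nn s (G (τ • r))| ≤ R0) :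
    ∀ z ∈ cone l r, nn s z < h → |nn s (G z)| ≤ max (2 * R0) (2 * Real.pi * h / ε) := by
  intro z1 hz1 hz1h
  by_contra! hN
  set N := |nn s (G z1)|
  have hε := C.εpos
  have hpi := Real.pi_pos
  rw [max_lt_iff] at hN
  have hNpos : 0 < N := lt_trans (by positivity) hN.2
  set ℓ := N / Real.pi with hℓ
  have hℓpos : 0 < ℓ := by positivity
  set Φ : W → ℝ := fun z => nn s z + 2 * h * Real.cos (nn s (G z) / ℓ)
  have hK := cone_compact (c := nn s z1) hdet hl hr
  set K := cone l r ∩ {z | nn s z ≤ nn s z1}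
  have hKΩ : K ⊆ Ω := fun z hz => hQ z hz.1 (lt_of_le_of_lt hz.2 hz1h)
  have hΦc : ContinuousOn Φ K := by
    refine ContinuousOn.add (by fun_prop) (continuousOn_const.mul ?_)
    refine Real.continuous_cos.comp_continuousOn (ContinuousOn.div_const ?_ _)
    exact (nn s).continuous.comp_continuousOn (C.cont.mono hKΩ)
  obtain ⟨zh, hzh, hmin⟩ := hK.exists_isMinOn ⟨z1, hz1, le_refl (nn s z1)⟩ hΦc
  have hΦ1 : Φ z1 = nn s z1 - 2 * h := by
    have : Real.cos (nn s (G z1) / ℓ) = -1 := by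
      rw [← Real.cos_abs, abs_div, abs_of_pos hℓpos]
      have : |nn s (G z1)| / ℓ = Real.pi := by
        rw [hℓ]; change N / (N / Real.pi) = Real.pi
        field_simp
      rw [this, Real.cos_pi]
    simp only [Φ, this]; ring
  have hΦh : Φ zh ≤ Φ z1 := hmin ⟨hz1, le_refl (nn s z1)⟩
  have hglob : ∀ z ∈ cone l r, nn s z < h → Φ zh ≤ Φ z := by
    intro z hz hzh'
    rcases le_or_gt (nn s z) (nn s z1) with h1 | h1
    · exact hmin ⟨hz, h1⟩
    · have : -1 ≤ Real.cos (nn s (G z) / ℓ) := Real.neg_one_le_cos _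
      have h2 : nn s z - 2 * h ≤ Φ z := by
        change nn s z - 2 * h ≤ nn s z + 2 * h * Real.cos (nn s (G z) / ℓ)
        nlinarith
      linarith
  have hzhh : nn s zh < h := lt_of_le_of_lt hzh.2 hz1h
  have hside : |nn s (G zh)| ≤ R0 → False := by
    intro hb
    have h1 : 0 ≤ nn s zh := cone_nn_nonneg hdet hl hr hzh.1
    have h2 : 0 ≤ Real.cos (nn s (G zh) / ℓ) := by
      rw [← Real.cos_abs]
      apply Real.cos_nonneg_of_neg_pi_div_two_le_of_le
      · linarith [abs_nonneg (nn s (G zh) / ℓ)]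
      · rw [abs_div, abs_of_pos hℓpos, div_le_iff₀ hℓpos, hℓ]
        have : Real.pi / 2 * (N / Real.pi) = N / 2 := by field_simp
        rw [this]; linarith
    have h3 : 0 ≤ Φ zh := by
      change 0 ≤ nn s zh + 2 * h * Real.cos (nn s (G zh) / ℓ)
      positivity
    linarith
  have e1 := cone_repr (z := zh) hdet
  have i1 : 0 < det2 r zh := by
    rcases hzh.1.1.lt_or_eq with h1 | h1
    · exact h1
    · exfalso
      rw [← h1, zero_div, zero_smul, zero_add] at e1
      apply hside
      rw [e1]
      exact hsr _ (div_nonneg hzh.1.2 hdet.le) (by rw [← e1]; exact hzhh)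
  have i2 : 0 < det2 zh l := by
    rcases hzh.1.2.lt_or_eq with h1 | h1
    · exact h1
    · exfalso
      rw [← h1, zero_div, zero_smul, add_zero] at e1
      apply hside
      rw [e1]
      exact hsl _ (div_nonneg hzh.1.1 hdet.le) (by rw [← e1]; exact hzhh)
  have hloc : ∀ᶠ z in 𝓝 zh, Φ zh ≤ Φ z := by
    have o1 : ∀ᶠ z in 𝓝 zh, 0 < det2 r z :=
      (isOpen_lt continuous_const (det2_cont continuous_const continuous_id)).mem_nhds i1
    have o2 : ∀ᶠ z in 𝓝 zh, 0 < det2 z l :=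
      (isOpen_lt continuous_const (det2_cont continuous_id continuous_const)).mem_nhds i2
    have o3 : ∀ᶠ z in 𝓝 zh, nn s z < h :=
      (isOpen_lt (nn s).continuous continuous_const).mem_nhds hzhh
    filter_upwards [o1, o2, o3] with z z1 z2 z3
    exact hglob z ⟨z1.le, z2.le⟩ z3
  have hzhΩ := hKΩ hzh
  set ph := G zh
  have hfph : f ph = zh := C.fG zh hzhΩ
  have hlocΨ : IsLocalMin (fun p => nn s (f p) + 2 * h * Real.cos (nn s p / ℓ)) ph := by
    have h1 : ∀ᶠ p in 𝓝 ph, Φ zh ≤ Φ (f p) := by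
      have : ContinuousAt f ph := C.fcont.continuousAt
      rw [ContinuousAt, hfph] at this
      exact this.eventually hloc
    filter_upwards [h1, C.left_inv hzhΩ] with p p1 p2
    simp only [Φ, p2.2] at p1
    rw [hfph]; exact p1
  have hder : HasFDerivAt (fun p => nn s (f p) + 2 * h * Real.cos (nn s p / ℓ)) _ ph :=
    ((nn s).hasFDerivAt.comp ph (C.hd ph)).add
      ((((nn s).hasFDerivAt (x := ph)).mul_const (ℓ⁻¹)).cos.const_mul (2 * h))
  have hz0 := hlocΨ.hasFDerivAt_eq_zero hder
  set t := 2 * h / ℓ * Real.sin (nn s ph * ℓ⁻¹) with ht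
  have htε : |t| < ε := by
    have h1 : |Real.sin (nn s ph * ℓ⁻¹)| ≤ 1 := Real.abs_sin_le_one _
    have h2 : 2 * h / ℓ < ε := by
      rw [hℓ, div_lt_iff₀ (by positivity)]
      have := hN.2
      rw [div_lt_iff₀ hε] at this
      rw [mul_div_assoc', lt_div_iff₀ hpi]; linarith
    rw [ht, abs_mul, abs_of_pos (show 0 < 2 * h / ℓ by positivity)]
    calc _ ≤ 2 * h / ℓ * 1 := by gcongr
      _ < ε := by linarith
  have hinj : Injective (f' ph - t • ContinuousLinearMap.id ℝ W) :=
    (injective_iff_map_eq_zero _).2 fun v hv => C.hs ph v t htε (by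
      simpa [sub_eq_zero] using hv)
  obtain ⟨v, hv⟩ := surj_of_inj hinj (0, 1)
  have h1 := congrArg (fun L : W →L[ℝ] ℝ => L v) hz0
  have h2 : nn s (f' ph v - t • v) = 1 := by
    have : f' ph v - t • v = (0, 1) := by simpa using hv
    rw [this]; simp
  rw [map_sub, map_smul, smul_eq_mul] at h2
  have h3 : nn s (f' ph v) - t * nn s v = 0 := by
    simp only [ContinuousLinearMap.add_apply, ContinuousLinearMap.comp_apply,
      ContinuousLinearMap.smul_apply, ContinuousLinearMap.zero_apply, smul_eq_mul] at h1
    rw [ht]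
    linear_combination h1
  linarith
end Core
end Emb

namespace Emb

lemma HL {H : ℝ × ℝ → W} (hH : Continuous H) (hne : ∀ x, H x ≠ 0)
    (hanti : ∀ a, H (a, 1) = - H (a, 0))
    (h0 : ∀ θ ∈ Icc (0:ℝ) 1, 0 ≤ det2 (H (0, 0)) (H (0, θ)))
    (h1 : ∀ θ ∈ Icc (0:ℝ) 1, det2 (H (1, 0)) (H (1, θ)) ≤ 0) : False := by
  set Z : ℝ × ℝ → ℂ := fun x => Complex.equivRealProdCLM.symm (H x)
  have hZc : Continuous Z := Complex.equivRealProdCLM.symm.continuous.comp hH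
  have hZne : ∀ x, Z x ≠ 0 := fun x h => hne x (by simpa [Z] using h)
  obtain ⟨Θ, hΘ⟩ : ∃ Θ : C(ℝ × ℝ, ℂ), ∀ x, Complex.exp (Θ x) = Z x := by
    set F : C(ℝ × ℝ, {z : ℂ // z ≠ 0}) := ⟨fun x => ⟨Z x, hZne x⟩, by fun_prop⟩
    obtain ⟨Θ, ⟨-, h⟩, -⟩ := Complex.isCoveringMap_exp.existsUnique_continuousMap_lifts F
      (0, 0) (Complex.log (Z (0, 0))) (by ext; simp [F, Complex.exp_log (hZne _)])
    exact ⟨Θ, fun x => congrArg Subtype.val (congrFun h x)⟩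
  set φ : ℝ → ℝ → ℝ := fun a θ => (Θ (a, θ)).im - (Θ (a, 0)).im
  have hdet : ∀ a θ, ∃ ρ > 0, det2 (H (a, 0)) (H (a, θ)) = ρ * Real.sin (φ a θ) := by
    intro a θ
    have e1 := hΘ (a, 0)
    have e2 := hΘ (a, θ)
    have r1 : ∀ x, (Z x).re = (H x).1 := fun x => rfl
    have r2 : ∀ x, (Z x).im = (H x).2 := fun x => rfl
    refine ⟨Real.exp (Θ (a, 0)).re * Real.exp (Θ (a, θ)).re, by positivity, ?_⟩
    rw [det2, ← r1, ← r1, ← r2, ← r2, ← e1, ← e2, Complex.exp_re, Complex.exp_re, Complex.exp_im,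
      Complex.exp_im, Real.sin_sub]
    ring
  have hcos : ∀ a, Real.cos (φ a 1) < 0 := by
    intro a
    have e1 := hΘ (a, 0)
    have e2 := hΘ (a, 1)
    have e3 : Z (a, 1) = - Z (a, 0) := by simp only [Z, hanti, map_neg]
    rw [e3, ← e1] at e2
    have c1 := congrArg Complex.re e2
    have c2 := congrArg Complex.im e2
    rw [Complex.neg_re, Complex.exp_re, Complex.exp_re] at c1
    rw [Complex.neg_im, Complex.exp_im, Complex.exp_im] at c2
    have p1 := Real.exp_pos (Θ (a, 0)).re
    have p2 := Real.exp_pos (Θ (a, 1)).re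
    have sc := Real.sin_sq_add_cos_sq (Θ (a, 0)).im
    change Real.cos ((Θ (a, 1)).im - (Θ (a, 0)).im) < 0
    rw [Real.cos_sub]
    set x := Real.cos (Θ (a, 1)).im
    set y := Real.sin (Θ (a, 1)).im
    set x0 := Real.cos (Θ (a, 0)).im
    set y0 := Real.sin (Θ (a, 0)).im
    have : Real.exp (Θ (a, 1)).re * (x * x0 + y * y0) = - Real.exp (Θ (a, 0)).re := by
      linear_combination x0 * c1 + y0 * c2 - Real.exp (Θ (a, 0)).re * sc
    by_contra! h
    nlinarith [mul_nonneg p2.le h]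
  have hφc : ∀ a, Continuous (φ a) := by intro a; simp only [φ]; fun_prop
  have hφ1 : Continuous fun a => φ a 1 := by simp only [φ]; fun_prop
  have hφ0 : ∀ a, φ a 0 = 0 := fun a => sub_self _
  have hpi := Real.pi_pos
  have hge : ∀ a, Real.pi / 2 < |φ a 1| := by
    intro a
    by_contra! h
    have := Real.cos_nonneg_of_neg_pi_div_two_le_of_le (x := φ a 1) (by linarith [(abs_le.1 h).1])
      (abs_le.1 h).2
    linarith [hcos a]
  have p0 : 0 < φ 0 1 := by
    by_contra! h
    have := hge 0
    rw [abs_of_nonpos h] at this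
    obtain ⟨θ, hθ, hv⟩ := intermediate_value_Icc' (zero_le_one' ℝ) (hφc 0).continuousOn
      (show -(Real.pi / 2) ∈ Icc (φ 0 1) (φ 0 0) by rw [hφ0]; constructor <;> linarith)
    obtain ⟨ρ, hρ, e⟩ := hdet 0 θ
    have h2 := h0 θ hθ
    rw [e, hv, Real.sin_neg, Real.sin_pi_div_two] at h2
    linarith
  have p1 : φ 1 1 < 0 := by
    by_contra! h
    have := hge 1
    rw [abs_of_nonneg h] at this
    obtain ⟨θ, hθ, hv⟩ := intermediate_value_Icc (zero_le_one' ℝ) (hφc 1).continuousOn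
      (show (Real.pi / 2) ∈ Icc (φ 1 0) (φ 1 1) by rw [hφ0]; constructor <;> linarith)
    obtain ⟨ρ, hρ, e⟩ := hdet 1 θ
    have h2 := h1 θ hθ
    rw [e, hv, Real.sin_pi_div_two] at h2
    linarith
  obtain ⟨a, -, ha⟩ := intermediate_value_Icc' (zero_le_one' ℝ) hφ1.continuousOn
    (show (0:ℝ) ∈ Icc (φ 1 1) (φ 0 1) from ⟨p1.le, p0.le⟩)
  have := hcos a
  simp only at ha
  rw [ha, Real.cos_zero] at this
  linarith

/-- version on the square, with a sign. -/
lemma HL_sq {H : ℝ → ℝ → W}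
    (hH : ContinuousOn (fun x : ℝ × ℝ => H x.1 x.2) (Icc (0:ℝ) 1 ×ˢ Icc (0:ℝ) 1))
    (hne : ∀ a ∈ Icc (0:ℝ) 1, ∀ θ ∈ Icc (0:ℝ) 1, H a θ ≠ 0)
    (hanti : ∀ a ∈ Icc (0:ℝ) 1, H a 1 = - H a 0) {σ : ℝ} (hσ : σ ≠ 0)
    (h0 : ∀ θ ∈ Icc (0:ℝ) 1, 0 ≤ σ * det2 (H 0 0) (H 0 θ))
    (h1 : ∀ θ ∈ Icc (0:ℝ) 1, σ * det2 (H 1 0) (H 1 θ) ≤ 0) : False := by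
  set P : ℝ → ℝ := fun x => (projIcc (0:ℝ) 1 zero_le_one x : ℝ)
  have hP : Continuous P := continuous_subtype_val.comp continuous_projIcc
  have hPm : ∀ x, P x ∈ Icc (0:ℝ) 1 := fun x => (projIcc (0:ℝ) 1 zero_le_one x).2
  have hPe : ∀ x ∈ Icc (0:ℝ) 1, P x = x := fun x hx => by
    simp only [P]; rw [projIcc_of_mem _ hx]
  have hP0 : P 0 = 0 := hPe 0 (by simp)
  have hP1 : P 1 = 1 := hPe 1 (by simp)
  rcases lt_or_gt_of_ne hσ with h | h
  · refine HL (H := fun x => H (1 - P x.1) (P x.2)) ?_ ?_ ?_ ?_ ?_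
    · refine hH.comp_continuous (f := fun x : ℝ × ℝ => (1 - P x.1, P x.2)) (by fun_prop) ?_
      exact fun x => ⟨⟨by linarith [(hPm x.1).2], by linarith [(hPm x.1).1]⟩, hPm _⟩
    · exact fun x => hne _ ⟨by linarith [(hPm x.1).2], by linarith [(hPm x.1).1]⟩ _ (hPm _)
    · intro a
      simp only [hP1, hP0]
      exact hanti _ ⟨by linarith [(hPm a).2], by linarith [(hPm a).1]⟩
    · intro θ hθ
      simp only [hP0, hPe θ hθ, sub_zero]
      by_contra! h2
      nlinarith [h1 θ hθ]
    · intro θ hθ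
      simp only [hP0, hP1, hPe θ hθ, sub_self]
      by_contra! h2
      nlinarith [h0 θ hθ]
  · refine HL (H := fun x => H (P x.1) (P x.2)) ?_ ?_ ?_ ?_ ?_
    · exact hH.comp_continuous (f := fun x : ℝ × ℝ => (P x.1, P x.2)) (by fun_prop)
        fun x => ⟨hPm _, hPm _⟩
    · exact fun x => hne _ (hPm _) _ (hPm _)
    · intro a
      simp only [hP1, hP0]
      exact hanti _ (hPm _)
    · intro θ hθ
      simp only [hP0, hPe θ hθ]
      by_contra! h2
      nlinarith [h0 θ hθ]
    · intro θ hθ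
      simp only [hP0, hP1, hPe θ hθ]
      by_contra! h2
      nlinarith [h1 θ hθ]
end Emb

namespace Emb

def phi (g : W → W) (L : W →L[ℝ] W) (c v : W) : W := ‖v‖⁻¹ • (g (c + v) - g c - L v)
def qq (g : W → W) (L : W →L[ℝ] W) (c : W) (a : ℝ) (u : W) : W := L u + ‖u‖ • phi g L c (a • u)

lemma phi_zero (g : W → W) (L : W →L[ℝ] W) (c : W) : phi g L c 0 = 0 := by simp [phi]

lemma qq_zero (g : W → W) (L : W →L[ℝ] W) (c u : W) : qq g L c 0 u = L u := by
  simp [qq, phi_zero]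

lemma qq_smul (g : W → W) (L : W →L[ℝ] W) (c u : W) {a : ℝ} (ha : 0 ≤ a) :
    a • qq g L c a u = g (c + a • u) - g c := by
  by_cases h : a • u = 0
  · rw [h]
    rcases smul_eq_zero.1 h with h1 | h1
    · simp [h1]
    · simp [qq, h1]
  · have h1 : ‖a • u‖ = a * ‖u‖ := by rw [norm_smul, Real.norm_of_nonneg ha]
    rw [qq, smul_add, smul_smul, ← h1, phi, smul_smul, mul_inv_cancel₀ (norm_ne_zero_iff.2 h),
      one_smul, map_smul]
    abel

lemma qq_cont {g : W → W} {L : W →L[ℝ] W} {c : W} (hg : HasFDerivAt g L c) {a : ℝ} {u : W}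
    (h : ContinuousAt g (c + a • u)) : ContinuousAt (fun x : ℝ × W => qq g L c x.1 x.2) (a, u) := by
  have hphi : ContinuousAt (phi g L c) (a • u) := by
    by_cases h0 : a • u = 0
    · rw [h0, ContinuousAt, phi_zero]
      have := hasFDerivAt_iff_tendsto.1 hg
      rw [tendsto_zero_iff_norm_tendsto_zero]
      have h2 : Tendsto (fun v : W => c + v) (𝓝 0) (𝓝 c) := by
        have : Continuous (fun v : W => c + v) := by fun_prop
        simpa using this.tendsto 0
      refine (this.comp h2).congr fun v => ?_
      simp [phi, norm_smul]
    · change ContinuousAt (fun v : W => ‖v‖⁻¹ • (g (c + v) - g c - L v)) (a • u)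
      refine ContinuousAt.smul (f := fun v : W => ‖v‖⁻¹) ?_ ?_
      · exact continuousAt_id.norm.inv₀ (norm_ne_zero_iff.2 h0)
      · refine ((ContinuousAt.comp (f := fun v => c + v) h (by fun_prop)).sub
          continuousAt_const).sub (by fun_prop)
  change ContinuousAt (fun x : ℝ × W => L x.2 + ‖x.2‖ • phi g L c (x.1 • x.2)) (a, u)
  refine ContinuousAt.add (by fun_prop) (ContinuousAt.smul (f := fun x : ℝ × W => ‖x.2‖)
    (by fun_prop) ?_)
  exact ContinuousAt.comp (f := fun x : ℝ × W => x.1 • x.2) (x := (a, u)) hphi (by fun_prop)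

def detL (L : W →L[ℝ] W) : ℝ := det2 (L (1, 0)) (L (0, 1))

lemma detL_mul (L : W →L[ℝ] W) (u v : W) : det2 (L u) (L v) = detL L * det2 u v := by
  have h : ∀ u : W, L u = u.1 • L (1, 0) + u.2 • L (0, 1) := fun u => by
    rw [← map_smul, ← map_smul, ← map_add]; congr 1; ext <;> simp
  rw [h u, h v]; simp only [det2, detL, Prod.fst_add, Prod.snd_add, Prod.smul_fst, Prod.smul_snd,
    smul_eq_mul]; ring

lemma detL_ne {L : W →L[ℝ] W} (h : Injective L) : detL L ≠ 0 := by
  intro h0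
  obtain ⟨u, hu⟩ := surj_of_inj h (1, 0)
  obtain ⟨v, hv⟩ := surj_of_inj h (0, 1)
  have := detL_mul L u v
  rw [hu, hv, h0] at this
  simp [det2] at this

lemma det2_smul_smul (a b : ℝ) (u v : W) : det2 (a • u) (b • v) = a * b * det2 u v := by
  simp [det2]; ring
lemma det2_self (u : W) : det2 u u = 0 := by simp [det2]; ring
lemma det2_add_right (u v w : W) : det2 u (v + w) = det2 u v + det2 u w := by simp [det2]; ring
lemma det2_sub_right (u v w : W) : det2 u (v - w) = det2 u v - det2 u w := by simp [det2]; ring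
lemma det2_sub_left (u v w : W) : det2 (u - v) w = det2 u w - det2 v w := by simp [det2]; ring
lemma det2_swap (u v : W) : det2 u v = - det2 v u := by simp [det2]; ring

lemma sign_local {f : W → W} {f' : W → W →L[ℝ] W} (hd : ∀ x, HasFDerivAt f (f' x) x)
    (hi : ∀ x, Injective (f' x)) {x : W} {r : ℝ} (hinj : InjOn f (ball x r)) {p q : W}
    (hp : p ∈ ball x r) (hq : q ∈ ball x r) (hp0 : 0 < detL (f' p)) : 0 < detL (f' q) := by
  by_contra! hq0
  have hc : Continuous f := continuous_iff_continuousAt.2 fun x => (hd x).continuousAt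
  obtain ⟨κ, hκ, hκp, hκq⟩ : ∃ κ > 0, dist p x + κ < r ∧ dist q x + κ < r := by
    rw [mem_ball] at hp hq
    have : 0 < min (r - dist p x) (r - dist q x) := lt_min (by linarith) (by linarith)
    obtain ⟨κ, h1, h2⟩ := exists_between this
    rw [lt_min_iff] at h2
    exact ⟨κ, h1, by linarith, by linarith⟩
  set v : ℝ → W := fun θ => (κ * Real.cos (Real.pi * θ), κ * Real.sin (Real.pi * θ))
  have hvn : ∀ θ, ‖v θ‖ ≤ κ := by
    intro θ
    rw [Prod.norm_def, max_le_iff]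
    simp only [v, norm_mul, Real.norm_of_nonneg hκ.le]
    exact ⟨mul_le_of_le_one_right hκ.le (Real.abs_cos_le_one _),
      mul_le_of_le_one_right hκ.le (Real.abs_sin_le_one _)⟩
  have hvc : Continuous v := by simp only [v]; fun_prop
  have hv0 : ∀ θ, v θ ≠ 0 := by
    intro θ h
    have h1 := congrArg Prod.fst h
    have h2 := congrArg Prod.snd h
    simp only [v, Prod.fst_zero, Prod.snd_zero] at h1 h2
    have := Real.sin_sq_add_cos_sq (Real.pi * θ)
    have e1 : Real.cos (Real.pi * θ) = 0 := by simpa [hκ.ne'] using h1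
    have e2 : Real.sin (Real.pi * θ) = 0 := by simpa [hκ.ne'] using h2
    rw [e1, e2] at this
    norm_num at this
  have hv1 : v 1 = - v 0 := by ext <;> simp [v]
  -- the two points
  set H : ℝ → ℝ → W := fun a θ =>
    (qq f (f' p) p a ((q - p) + (1 - a) • v θ) - qq f (f' p) p a ((q - p) - (1 - a) • v θ)) +
    (qq f (f' q) q (1 - a) ((p - q) + a • v θ) - qq f (f' q) q (1 - a) ((p - q) - a • v θ))
  set Df : ℝ → ℝ → W := fun a θ => f (p + a • (q - p) + (a * (1 - a)) • v θ) -
    f (p + a • (q - p) - (a * (1 - a)) • v θ)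
  have hA : ∀ a θ, 0 ≤ a → a • (qq f (f' p) p a ((q - p) + (1 - a) • v θ) -
      qq f (f' p) p a ((q - p) - (1 - a) • v θ)) = Df a θ := by
    intro a θ ha
    rw [smul_sub, qq_smul _ _ _ _ ha, qq_smul _ _ _ _ ha, sub_sub_sub_cancel_right]
    simp only [Df, smul_add, smul_sub, smul_smul]
    congr 2 <;> abel
  have hB : ∀ a θ, a ≤ 1 → (1 - a) • (qq f (f' q) q (1 - a) ((p - q) + a • v θ) -
      qq f (f' q) q (1 - a) ((p - q) - a • v θ)) = Df a θ := by
    intro a θ ha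
    have ha' : 0 ≤ 1 - a := by linarith
    rw [smul_sub, qq_smul _ _ _ _ ha', qq_smul _ _ _ _ ha', sub_sub_sub_cancel_right]
    simp only [Df, smul_add, smul_sub, smul_smul]
    congr 2 <;> ext <;> simp <;> ring
  have hH0 : ∀ θ, H 0 θ = f' p ((2:ℝ) • v θ) := by
    intro θ
    simp only [H, qq_zero, zero_smul, sub_zero, one_smul, add_zero, sub_self]
    rw [← map_sub]; congr 1; rw [two_smul]; abel
  have hH1 : ∀ θ, H 1 θ = f' q ((2:ℝ) • v θ) := by
    intro θ
    simp only [H, qq_zero, zero_smul, sub_zero, one_smul, add_zero, sub_self, zero_add]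
    rw [← map_sub]; congr 1; rw [two_smul]; abel
  have hdv : ∀ θ, det2 ((2:ℝ) • v 0) ((2:ℝ) • v θ) = 4 * κ^2 * Real.sin (Real.pi * θ) := by
    intro θ
    simp [det2, v]; ring
  have hsin : ∀ θ ∈ Icc (0:ℝ) 1, 0 ≤ Real.sin (Real.pi * θ) := fun θ hθ =>
    Real.sin_nonneg_of_nonneg_of_le_pi (mul_nonneg Real.pi_pos.le hθ.1)
      (by nlinarith [Real.pi_pos, hθ.2])
  refine HL_sq (H := H) (σ := 1) ?_ ?_ ?_ one_ne_zero ?_ ?_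
  · apply Continuous.continuousOn
    have cp : Continuous (fun x : ℝ × W => qq f (f' p) p x.1 x.2) :=
      continuous_iff_continuousAt.2 fun x => qq_cont (hd p) hc.continuousAt
    have cq : Continuous (fun x : ℝ × W => qq f (f' q) q x.1 x.2) :=
      continuous_iff_continuousAt.2 fun x => qq_cont (hd q) hc.continuousAt
    refine ((cp.comp (g := fun x : ℝ × W => qq f (f' p) p x.1 x.2)
      (f := fun x : ℝ × ℝ => (x.1, (q - p) + (1 - x.1) • v x.2)) (by fun_prop)).sub
      (cp.comp (f := fun x : ℝ × ℝ => (x.1, (q - p) - (1 - x.1) • v x.2)) (by fun_prop))).add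
      ((cq.comp (f := fun x : ℝ × ℝ => (1 - x.1, (p - q) + x.1 • v x.2)) (by fun_prop)).sub
      (cq.comp (f := fun x : ℝ × ℝ => (1 - x.1, (p - q) - x.1 • v x.2)) (by fun_prop)))
  · intro a ha θ hθ h
    rcases ha.1.eq_or_lt with h1 | h1
    · rw [← h1, hH0] at h
      have := hi p (h.trans (map_zero _).symm)
      exact hv0 θ (by simpa using this)
    rcases ha.2.eq_or_lt with h2 | h2
    · rw [h2, hH1] at h
      have := hi q (h.trans (map_zero _).symm)
      exact hv0 θ (by simpa using this)
    have h3 : (a * (1 - a)) • H a θ = Df a θ := by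
      have e1 := hA a θ ha.1
      have e2 := hB a θ ha.2
      simp only [H, smul_add]
      rw [mul_comm, mul_smul, e1, mul_comm, mul_smul, e2, ← add_smul]
      simp
    rw [h, smul_zero] at h3
    have h4 := sub_eq_zero.1 h3.symm
    have hb : ∀ w : W, ‖w‖ ≤ κ → p + a • (q - p) + (a * (1 - a)) • w ∈ ball x r := by
      intro w hw
      have e1 : p + a • (q - p) + (a * (1 - a)) • w - x =
          (1 - a) • (p - x) + a • (q - x) + (a * (1 - a)) • w := by
        ext <;> simp <;> ring
      rw [mem_ball, dist_eq_norm, e1]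
      rw [dist_eq_norm] at hκp hκq
      have n1 : 0 < 1 - a := by linarith
      calc _ ≤ ‖(1 - a) • (p - x)‖ + ‖a • (q - x)‖ + ‖(a * (1 - a)) • w‖ := norm_add₃_le
        _ = (1 - a) * ‖p - x‖ + a * ‖q - x‖ + a * (1 - a) * ‖w‖ := by
          rw [norm_smul, norm_smul, norm_smul, Real.norm_of_nonneg n1.le,
            Real.norm_of_nonneg h1.le, Real.norm_of_nonneg (by positivity)]
        _ ≤ (1 - a) * ‖p - x‖ + a * ‖q - x‖ + 1 * κ := by
          have : a * (1 - a) ≤ 1 := by nlinarith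
          gcongr
        _ < r := by nlinarith
    have h5 := hinj (hb (v θ) (hvn θ)) (by
      have := hb (- v θ) (by rw [norm_neg]; exact hvn θ)
      rwa [smul_neg, ← sub_eq_add_neg] at this) h4
    have h6 : (2 * (a * (1 - a))) • v θ = 0 := by
      have := sub_eq_zero.2 h5
      rw [← this, two_mul, add_smul]; abel
    rcases smul_eq_zero.1 h6 with h7 | h7
    · have : 0 < 1 - a := by linarith
      have : 0 < 2 * (a * (1 - a)) := by positivity
      linarith
    · exact hv0 θ h7
  · intro a ha
    simp only [H, hv1, smul_neg, sub_neg_eq_add, ← sub_eq_add_neg]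
    abel
  · intro θ hθ
    rw [hH0, hH0, detL_mul, hdv, one_mul]
    have := hsin θ hθ
    positivity
  · intro θ hθ
    rw [hH1, hH1, detL_mul, hdv, one_mul]
    have := hsin θ hθ
    exact mul_nonpos_of_nonpos_of_nonneg hq0 (by positivity)

lemma sign_const {f : W → W} {f' : W → W →L[ℝ] W} (hd : ∀ x, HasFDerivAt f (f' x) x)
    (hi : ∀ x, Injective (f' x)) (hE : LI f univ) {p : W} (hp : detL (f' p) < 0) (q : W) :
    detL (f' q) < 0 := by
  have hcl : IsClopen {x | 0 < detL (f' x)} := by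
    have : ∀ x, ∃ r > 0, ∀ y ∈ ball x r, ∀ z ∈ ball x r, 0 < detL (f' y) → 0 < detL (f' z) := by
      intro x
      obtain ⟨U, hU, hinj⟩ := hE x trivial
      obtain ⟨r, hr, hb⟩ := Metric.mem_nhds_iff.1 hU
      exact ⟨r, hr, fun y hy z hz h => sign_local hd hi (hinj.mono hb) hy hz h⟩
    constructor
    · rw [← isOpen_compl_iff, isOpen_iff_mem_nhds]
      intro x hx
      obtain ⟨r, hr, hb⟩ := this x
      filter_upwards [ball_mem_nhds x hr] with y hy h
      exact hx (hb y hy x (mem_ball_self hr) h)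
    · rw [isOpen_iff_mem_nhds]
      intro x hx
      obtain ⟨r, hr, hb⟩ := this x
      filter_upwards [ball_mem_nhds x hr] with y hy
      exact hb x (mem_ball_self hr) y hy hx
  rcases isClopen_iff.1 hcl with h | h
  · have h1 : q ∉ {x | 0 < detL (f' x)} := by rw [h]; simp
    exact lt_of_le_of_ne (not_lt.1 h1) (detL_ne (hi q))
  · have h1 : p ∈ {x | 0 < detL (f' x)} := by rw [h]; trivial
    exact absurd h1 (not_lt.2 hp.le)
end Emb

namespace Emb

lemma sign_on {X : Type*} [TopologicalSpace X] {S : Set X} (hS : IsPreconnected S) {g : X → ℝ}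
    (hg : ContinuousOn g S) (hne : ∀ x ∈ S, g x ≠ 0) {a b : X} (ha : a ∈ S) (hb : b ∈ S)
    {c : ℝ} (h : 0 < c * g a) : 0 < c * g b := by
  by_contra! h2
  have hc : c ≠ 0 := fun h0 => by simp [h0] at h
  obtain ⟨x, hx, hx0⟩ := hS.intermediate_value hb ha (continuousOn_const.mul hg)
    (show (0:ℝ) ∈ Icc (c * g b) (c * g a) from ⟨h2, h.le⟩)
  exact hne x hx (by simpa [hc] using hx0)

lemma first_hit {φ : ℝ → ℝ} {T Y : ℝ} (hT : 0 ≤ T) (hφ : ContinuousOn φ (Icc 0 T)) (h0 : φ 0 < Y)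
    (hY : Y ≤ φ T) : ∃ τ, 0 < τ ∧ τ ≤ T ∧ φ τ = Y ∧ ∀ σ, 0 ≤ σ → σ ≤ τ → φ σ ≤ Y := by
  have hcl : IsCompact (Icc 0 T ∩ φ ⁻¹' {Y}) :=
    isCompact_Icc.of_isClosed_subset (hφ.preimage_isClosed_of_isClosed isClosed_Icc
      isClosed_singleton) inter_subset_left
  obtain ⟨τ1, h1, h2⟩ := intermediate_value_Icc hT hφ (show Y ∈ Icc (φ 0) (φ T) from ⟨h0.le, hY⟩)
  obtain ⟨τ, hτ, hmin⟩ := hcl.exists_isLeast ⟨τ1, h1, h2⟩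
  have hτY : φ τ = Y := hτ.2
  refine ⟨τ, ?_, hτ.1.2, hτY, fun σ hσ hστ => ?_⟩
  · rcases hτ.1.1.lt_or_eq with h | h
    · exact h
    · rw [← h] at hτY; linarith
  · by_contra! h
    obtain ⟨σ', h3, h4⟩ := intermediate_value_Icc hσ
      (hφ.mono (Icc_subset_Icc le_rfl (hστ.trans hτ.1.2)))
      (show Y ∈ Icc (φ 0) (φ σ) from ⟨h0.le, h.le⟩)
    have h5 := hmin ⟨⟨h3.1, h3.2.trans (hστ.trans hτ.1.2)⟩, h4⟩
    have : σ = τ := by linarith [h3.2]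
    rw [this] at h; linarith

lemma fst_large {s M Y : ℝ} {x : W} (hM : |nn s x| ≤ M) (hY : 0 ≤ Y)
    (h : M + (|s| + 1) * Y < ‖x‖) : Y < |x.1| := by
  by_contra! hx
  rw [nn_apply] at hM
  have h1 : |x.2| ≤ M + |s| * Y := by
    have : |x.2| ≤ |x.2 + s * x.1| + |s * x.1| := by
      have := abs_sub (x.2 + s * x.1) (s * x.1)
      simpa using this
    rw [abs_mul] at this
    nlinarith [mul_le_mul_of_nonneg_left hx (abs_nonneg s)]
  have h2 : ‖x‖ ≤ M + (|s| + 1) * Y := by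
    rw [Prod.norm_def, max_le_iff, Real.norm_eq_abs, Real.norm_eq_abs]
    have hM0 : 0 ≤ M := (abs_nonneg _).trans hM
    constructor
    · nlinarith [abs_nonneg s, mul_nonneg (abs_nonneg s) hY]
    · nlinarith
  linarith

namespace Core
variable {f : W → W} {f' : W → W →L[ℝ] W} {ε : ℝ} {Ω : Set W} {G : W → W}

lemma Gderiv (C : Core f f' ε Ω G) : ∃ L : W →L[ℝ] W, HasFDerivAt G L 0 ∧ Injective L ∧
    detL (f' 0) * detL L = 1 := by
  set A := (LinearEquiv.ofBijective (f' 0 : W →ₗ[ℝ] W)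
    ⟨C.hi 0, surj_of_inj (C.hi 0)⟩).toContinuousLinearEquiv
  have hA : (A : W →L[ℝ] W) = f' 0 := by ext <;> rfl
  have hd : HasFDerivAt f (A : W →L[ℝ] W) (G 0) := by rw [hA, C.G0]; exact C.hd 0
  refine ⟨(A.symm : W →L[ℝ] W), HasFDerivAt.of_local_left_inverse (C.contAt C.h0) hd ?_,
    A.symm.injective, ?_⟩
  · filter_upwards [C.op.mem_nhds C.h0] with z hz using C.fG z hz
  · have h1 : ∀ v, f' 0 ((A.symm : W →L[ℝ] W) v) = v := fun v => by
      rw [← hA]; exact A.apply_symm_apply v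
    rw [detL.eq_1 (A.symm : W →L[ℝ] W), ← detL_mul, h1, h1]; simp [det2]

/-- loop part of the pair lemma -/
lemma pair_loop (C : Core f f' ε Ω G) {z0 w0 : W} {ς : ℝ} (hς : ς ≠ 0) (S : Set (W × W))
    (hS : ∀ x ∈ S, x.1 ∈ Ω ∧ x.2 ∈ Ω ∧ x.1 ≠ x.2 ∧ 0 ≤ det2 (w0 - z0) (x.2 - x.1) ∧
      0 ≤ ς * ((G x.2).1 - (G x.1).1))
    (hJ : JoinedIn S (z0, w0) (w0, z0)) (hG : (G z0).1 = (G w0).1) :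
    detL (f' 0) * (ς * ((G w0).2 - (G z0).2)) < 0 := by
  obtain ⟨L, hL, hLi, hLd⟩ := C.Gderiv
  have hLne := detL_ne hLi
  have hfne := detL_ne (C.hi 0)
  by_contra! hcon
  set γ := hJ.somePath
  have hγ : ∀ t ∈ Icc (0:ℝ) 1, γ.extend t ∈ S := fun t ht => by
    rw [Path.extend_apply _ ht]; exact hJ.somePath_mem _
  set a : ℝ → W := fun t => (γ.extend t).1
  set b : ℝ → W := fun t => (γ.extend t).2
  have ha : Continuous a := by simp only [a]; fun_prop
  have hb : Continuous b := by simp only [b]; fun_prop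
  have e0 : γ.extend 0 = (z0, w0) := γ.extend_zero
  have e1 : γ.extend 1 = (w0, z0) := γ.extend_one
  have a0 : a 0 = z0 := congrArg Prod.fst e0
  have b0 : b 0 = w0 := congrArg Prod.snd e0
  have a1 : a 1 = w0 := congrArg Prod.fst e1
  have b1 : b 1 = z0 := congrArg Prod.snd e1
  have hq : ∀ c θ, 0 ≤ c → c • (qq G L 0 c (b θ) - qq G L 0 c (a θ)) =
      G (c • b θ) - G (c • a θ) := by
    intro c θ hc
    rw [smul_sub, qq_smul _ _ _ _ hc, qq_smul _ _ _ _ hc]; simp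
  refine HL_sq (H := fun c θ => qq G L 0 c (b θ) - qq G L 0 c (a θ)) (σ := detL L) ?_ ?_ ?_ hLne
    ?_ ?_
  · intro x hx
    refine ContinuousAt.continuousWithinAt ?_
    have hm := hS _ (hγ x.2 hx.2)
    refine ContinuousAt.sub ?_ ?_
    · refine ContinuousAt.comp (g := fun x : ℝ × W => qq G L 0 x.1 x.2)
        (f := fun x : ℝ × ℝ => (x.1, b x.2)) (x := x) (qq_cont hL ?_) (by fun_prop)
      rw [zero_add]
      exact C.contAt (C.star _ hm.2.1 _ hx.1.1 hx.1.2)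
    · refine ContinuousAt.comp (g := fun x : ℝ × W => qq G L 0 x.1 x.2)
        (f := fun x : ℝ × ℝ => (x.1, a x.2)) (x := x) (qq_cont hL ?_) (by fun_prop)
      rw [zero_add]
      exact C.contAt (C.star _ hm.1 _ hx.1.1 hx.1.2)
  · intro c hc θ hθ h
    have hm := hS _ (hγ θ hθ)
    rcases hc.1.eq_or_lt with h1 | h1
    · rw [← h1, qq_zero, qq_zero] at h
      exact hm.2.2.1 (hLi (sub_eq_zero.1 h)).symm
    · have h2 := hq c θ hc.1
      rw [h, smul_zero] at h2
      have h3 := C.inj (C.star _ hm.2.1 _ hc.1 hc.2) (C.star _ hm.1 _ hc.1 hc.2)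
        (sub_eq_zero.1 h2.symm)
      exact hm.2.2.1 (smul_right_injective W h1.ne' h3).symm
  · intro c hc
    simp only [a0, a1, b0, b1]; abel
  · intro θ hθ
    have hm := hS _ (hγ θ hθ)
    simp only [qq_zero, ← map_sub]
    rw [detL_mul, a0, b0, ← mul_assoc]
    exact mul_nonneg (mul_self_nonneg _) hm.2.2.2.1
  · intro θ hθ
    have hm := hS _ (hγ θ hθ)
    have h1 : ∀ θ, qq G L 0 1 (b θ) - qq G L 0 1 (a θ) = G (b θ) - G (a θ) := fun θ => by
      simpa using hq 1 θ zero_le_one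
    simp only [h1]
    rw [a0, b0]
    simp only [det2, Prod.fst_sub, Prod.snd_sub, hG, sub_self, zero_mul, zero_sub]
    have hx : 0 ≤ ς * ((G (b θ)).1 - (G (a θ)).1) := hm.2.2.2.2
    set x := (G (b θ)).1 - (G (a θ)).1
    set Δ := (G w0).2 - (G z0).2
    -- detL L * (ς Δ) ≥ 0, ς x ≥ 0
    have h3 : 0 ≤ detL L * (ς * Δ) := by
      by_contra! h4
      have h5 : detL (f' 0) * (ς * Δ) * (detL L)^2 = detL L * (ς * Δ) := by
        linear_combination (detL L * (ς * Δ)) * hLd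
      have : 0 ≤ detL (f' 0) * (ς * Δ) * (detL L)^2 := mul_nonneg hcon (sq_nonneg _)
      linarith
    have h4 : 0 ≤ ς^2 * (detL L * (Δ * x)) := by
      have := mul_nonneg h3 hx
      nlinarith
    have : 0 ≤ detL L * (Δ * x) := nonneg_of_mul_nonneg_right h4 (by positivity)
    linarith
end Core
end Emb

namespace Emb
namespace Core
variable {f : W → W} {f' : W → W →L[ℝ] W} {ε : ℝ} {Ω : Set W} {G : W → W}

lemma ray_large (C : Core f f' ε Ω G) {P : W} {s M τ0 ς : ℝ} (hς : ς = 1 ∨ ς = -1) (hP : P ∉ Ω)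
    (hr : ∀ τ : ℝ, 0 ≤ τ → τ < 1 → τ • P ∈ Ω ∧ |nn s (G (τ • P))| ≤ M) (h0 : 0 < τ0) (h1 : τ0 < 1)
    (ht : ∀ τ : ℝ, τ0 ≤ τ → τ < 1 → 0 < ς * (G (τ • P)).1) :
    ∃ Y0 : ℝ, ∀ Y, Y0 < Y → ∃ τ, τ0 < τ ∧ τ < 1 ∧ ς * (G (τ • P)).1 = Y ∧
      ∀ σ, 0 ≤ σ → σ ≤ τ → ς * (G (σ • P)).1 ≤ Y := by
  have hc : ∀ T : ℝ, T < 1 → ContinuousOn (fun τ : ℝ => ς * (G (τ • P)).1) (Icc 0 T) := by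
    intro T hT
    refine continuousOn_const.mul (continuous_fst.comp_continuousOn ?_)
    refine C.cont.comp (by fun_prop) ?_
    intro τ hτ
    exact (hr τ hτ.1 (hτ.2.trans_lt hT)).1
  obtain ⟨B, hB⟩ := (isCompact_Icc (a := (0:ℝ)) (b := τ0)).bddAbove_image (hc τ0 h1)
  refine ⟨max B 0, fun Y hY => ?_⟩
  have hY0 : 0 < Y := (le_max_right _ _).trans_lt hY
  have hYB : B < Y := (le_max_left _ _).trans_lt hY
  obtain ⟨r, hr0, hrb⟩ := C.blow P hP (fun t h h' => (hr t h h').1) (M + (|s| + 1) * Y)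
  have hcont : Tendsto (fun τ : ℝ => τ • P) (𝓝[<] 1) (𝓝 P) := by
    have : Continuous fun τ : ℝ => τ • P := by fun_prop
    have h := this.tendsto 1
    rw [one_smul] at h
    exact h.mono_left nhdsWithin_le_nhds
  have e1 : ∀ᶠ τ : ℝ in 𝓝[<] 1, dist (τ • P) P < r := hcont (Metric.ball_mem_nhds P hr0)
  have e2 : ∀ᶠ τ : ℝ in 𝓝[<] 1, τ ∈ Ioo τ0 1 := Ioo_mem_nhdsLT h1
  obtain ⟨T, hT1, hT2, hT3⟩ := (e1.and e2).exists
  have hT0 : 0 < T := h0.trans hT2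
  have hlarge : Y < ς * (G (T • P)).1 := by
    have h3 := fst_large (hr T hT0.le hT3).2 hY0.le (hrb _ (hr T hT0.le hT3).1 hT1)
    have h4 := ht T hT2.le hT3
    rcases hς with rfl | rfl
    · rw [one_mul] at h4 ⊢; rwa [abs_of_pos h4] at h3
    · have : (G (T • P)).1 < 0 := by linarith
      rw [abs_of_neg this] at h3; linarith
  obtain ⟨τ, k1, k2, k3, k4⟩ := first_hit hT0.le (hc T hT3) (by simpa [C.G0] using hY0) hlarge.le
  refine ⟨τ, ?_, k2.trans_lt hT3, k3, k4⟩
  by_contra! h5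
  have h6 : ς * (G (τ • P)).1 ≤ B := hB ⟨τ, ⟨k1.le, h5⟩, rfl⟩
  linarith

lemma pair (C : Core f f' ε Ω G) {P1 P2 : W} {s1 s2 M1 M2 τ1 τ2 : ℝ}
    (hdet : 0 < det2 P2 P1) (hs : s1 ≠ s2) (hP1 : P1 ∉ Ω) (hP2 : P2 ∉ Ω)
    (hr1 : ∀ τ : ℝ, 0 ≤ τ → τ < 1 → τ • P1 ∈ Ω ∧ |nn s1 (G (τ • P1))| ≤ M1)
    (hr2 : ∀ τ : ℝ, 0 ≤ τ → τ < 1 → τ • P2 ∈ Ω ∧ |nn s2 (G (τ • P2))| ≤ M2)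
    (h10 : 0 < τ1) (h11 : τ1 < 1) (h20 : 0 < τ2) (h21 : τ2 < 1)
    (ht1 : ∀ τ : ℝ, τ1 ≤ τ → τ < 1 → (G (τ • P1)).1 ≠ 0)
    (ht2 : ∀ τ : ℝ, τ2 ≤ τ → τ < 1 → (G (τ • P2)).1 ≠ 0)
    (hseg : ∀ z ∈ segment ℝ (τ2 • P2) (τ1 • P1), z ∈ Ω ∧ (G z).1 ≠ 0) :
    detL (f' 0) * (s1 - s2) < 0 := by
  obtain ⟨ς, hς, hςpos⟩ : ∃ ς : ℝ, (ς = 1 ∨ ς = -1) ∧ 0 < ς * (G (τ1 • P1)).1 := by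
    rcases lt_or_gt_of_ne (ht1 τ1 le_rfl h11) with h | h
    · exact ⟨-1, Or.inr rfl, by linarith⟩
    · exact ⟨1, Or.inl rfl, by linarith⟩
  have hς0 : ς ≠ 0 := by rcases hς with rfl | rfl <;> norm_num
  have hς2 : ς * ς = 1 := by rcases hς with rfl | rfl <;> norm_num
  have hpos3 : ∀ z ∈ segment ℝ (τ2 • P2) (τ1 • P1), 0 < ς * (G z).1 := by
    intro z hz
    exact sign_on (convex_segment _ _).isPreconnected (g := fun z => (G z).1)
      (continuous_fst.comp_continuousOn (C.cont.mono fun z hz => (hseg z hz).1))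
      (fun z hz => (hseg z hz).2) (right_mem_segment ℝ _ _) hz hςpos
  have tail : ∀ {P : W} {τ0 : ℝ}, 0 < τ0 → τ0 < 1 → (∀ τ : ℝ, 0 ≤ τ → τ < 1 → τ • P ∈ Ω) →
      (∀ τ : ℝ, τ0 ≤ τ → τ < 1 → (G (τ • P)).1 ≠ 0) → 0 < ς * (G (τ0 • P)).1 →
      ∀ τ : ℝ, τ0 ≤ τ → τ < 1 → 0 < ς * (G (τ • P)).1 := by
    intro P τ0 h0 h1 hΩ hne hp τ h2 h3
    refine sign_on (S := Ico τ0 1) isPreconnected_Ico (g := fun τ : ℝ => (G (τ • P)).1) ?_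
      (fun τ hτ => hne τ hτ.1 hτ.2) (a := τ0) (b := τ) ⟨le_rfl, h1⟩ ⟨h2, h3⟩ hp
    refine continuous_fst.comp_continuousOn (C.cont.comp (by fun_prop) ?_)
    intro τ hτ; exact hΩ τ (h0.le.trans hτ.1) hτ.2
  have hpos1 := tail h10 h11 (fun τ h h' => (hr1 τ h h').1) ht1 hςpos
  have hpos2 := tail h20 h21 (fun τ h h' => (hr2 τ h h').1) ht2 (hpos3 _ (left_mem_segment ℝ _ _))
  obtain ⟨Y1, hY1⟩ := C.ray_large hς hP1 hr1 h10 h11 hpos1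
  obtain ⟨Y2, hY2⟩ := C.ray_large hς hP2 hr2 h20 h21 hpos2
  have hds : 0 < |s1 - s2| := abs_pos.2 (sub_ne_zero.2 hs)
  set Y := max (max Y1 Y2) ((M1 + M2) / |s1 - s2|) + 1
  have hYa : Y1 < Y := by
    have := (le_max_left Y1 Y2).trans (le_max_left (max Y1 Y2) ((M1 + M2) / |s1 - s2|)); linarith
  have hYb : Y2 < Y := by
    have := (le_max_right Y1 Y2).trans (le_max_left (max Y1 Y2) ((M1 + M2) / |s1 - s2|)); linarith
  have hYc : M1 + M2 < Y * |s1 - s2| := by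
    rw [← div_lt_iff₀ hds]
    have := (le_max_right (max Y1 Y2) ((M1 + M2) / |s1 - s2|)); linarith
  obtain ⟨t1, a1, a2, a3, a4⟩ := hY1 Y hYa
  obtain ⟨t2, b1, b2, b3, b4⟩ := hY2 Y hYb
  have ht10 : 0 < t1 := h10.trans a1
  have ht20 : 0 < t2 := h20.trans b1
  set z0 := t1 • P1 with hz0
  set w0 := t2 • P2 with hw0
  have hd0 : 0 < det2 w0 z0 := by
    rw [hz0, hw0, det2_smul_smul]; positivity
  set S : Set (W × W) := {x | x.1 ∈ Ω ∧ x.2 ∈ Ω ∧ x.1 ≠ x.2 ∧ 0 ≤ det2 (w0 - z0) (x.2 - x.1) ∧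
      0 ≤ ς * ((G x.2).1 - (G x.1).1)} with hSdef
  have hA : ∀ σ : ℝ, 0 ≤ σ → σ ≤ 1 → (σ • z0, w0) ∈ S := by
    intro σ h h'
    have e1 : σ • z0 = (σ * t1) • P1 := by rw [hz0, smul_smul]
    have e2 : σ * t1 ≤ t1 := by nlinarith
    refine ⟨?_, (hr2 _ ht20.le b2).1, ?_, ?_, ?_⟩
    · rw [e1]; exact (hr1 _ (by positivity) (e2.trans_lt a2)).1
    · intro h2
      have h2 : σ • z0 = w0 := h2
      rw [← h2] at hd0; simp [det2] at hd0; nlinarith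
    · have : det2 (w0 - z0) (w0 - σ • z0) = (1 - σ) * det2 w0 z0 := by simp [det2]; ring
      change 0 ≤ det2 (w0 - z0) (w0 - σ • z0)
      rw [this]; exact mul_nonneg (by linarith) hd0.le
    · change 0 ≤ ς * ((G w0).1 - (G (σ • z0)).1)
      rw [mul_sub, b3, e1]
      have := a4 (σ * t1) (by positivity) e2
      linarith
  have hB : ∀ σ : ℝ, 0 ≤ σ → σ ≤ 1 → (σ • w0, z0) ∈ S := by
    intro σ h h'
    have e1 : σ • w0 = (σ * t2) • P2 := by rw [hw0, smul_smul]
    have e2 : σ * t2 ≤ t2 := by nlinarith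
    refine ⟨?_, (hr1 _ ht10.le a2).1, ?_, ?_, ?_⟩
    · rw [e1]; exact (hr2 _ (by positivity) (e2.trans_lt b2)).1
    · intro h2
      have h2 : σ • w0 = z0 := h2
      rw [← h2] at hd0; simp [det2] at hd0; nlinarith
    · have : det2 (w0 - z0) (z0 - σ • w0) = (1 - σ) * det2 w0 z0 := by simp [det2]; ring
      change 0 ≤ det2 (w0 - z0) (z0 - σ • w0)
      rw [this]; exact mul_nonneg (by linarith) hd0.le
    · change 0 ≤ ς * ((G z0).1 - (G (σ • w0)).1)
      rw [mul_sub, a3, e1]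
      have := b4 (σ * t2) (by positivity) e2
      linarith
  have hC : ∀ w ∈ Ω, 0 < ς * (G w).1 → (∃ a b : ℝ, 0 ≤ a ∧ 0 ≤ b ∧ w = a • P1 + b • P2) →
      ((0 : W), w) ∈ S := by
    rintro w hw hpos ⟨a, b, ha, hb, rfl⟩
    refine ⟨C.h0, hw, ?_, ?_, ?_⟩
    · intro h
      have h : (0 : W) = a • P1 + b • P2 := h
      rw [← h, C.G0] at hpos; simp at hpos
    · have : det2 (w0 - z0) ((a • P1 + b • P2) - 0) = (t2 * a + t1 * b) * det2 P2 P1 := by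
        simp [det2, hz0, hw0]; ring
      change 0 ≤ det2 (w0 - z0) ((a • P1 + b • P2) - 0)
      rw [this]; positivity
    · change 0 ≤ ς * ((G _).1 - (G 0).1)
      rw [C.G0]; simpa using hpos.le
  have J1 : JoinedIn S (z0, w0) (0, w0) := by
    apply JoinedIn.of_segment_subset
    rintro _ ⟨a, b, ha, hb, hab, rfl⟩
    have : a • (z0, w0) + b • ((0 : W), w0) = (a • z0, w0) := by
      ext1
      · simp
      · simp [← add_smul, hab]
    rw [this]; exact hA a ha (by linarith)
  have J5 : JoinedIn S (0, z0) (w0, z0) := by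
    apply JoinedIn.of_segment_subset
    rintro _ ⟨a, b, ha, hb, hab, rfl⟩
    have : a • ((0 : W), z0) + b • (w0, z0) = (b • w0, z0) := by
      ext1
      · simp
      · simp [← add_smul, hab]
    rw [this]; exact hB b hb (by linarith)
  have J2 : JoinedIn S ((0 : W), w0) (0, τ2 • P2) := by
    apply JoinedIn.of_segment_subset
    rintro _ ⟨a, b, ha, hb, hab, rfl⟩
    have : a • ((0 : W), w0) + b • ((0 : W), τ2 • P2) = (0, (a * t2 + b * τ2) • P2) := by
      ext1
      · simp
      · simp [hw0, add_smul, smul_smul]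
    rw [this]
    have k1 : τ2 ≤ a * t2 + b * τ2 := by nlinarith
    have k2 : a * t2 + b * τ2 < 1 := by nlinarith
    exact hC _ (hr2 _ (h20.le.trans k1) k2).1 (hpos2 _ k1 k2) ⟨0, _, le_rfl, h20.le.trans k1, by simp⟩
  have J4 : JoinedIn S ((0 : W), τ1 • P1) (0, z0) := by
    apply JoinedIn.of_segment_subset
    rintro _ ⟨a, b, ha, hb, hab, rfl⟩
    have : a • ((0 : W), τ1 • P1) + b • ((0 : W), z0) = (0, (a * τ1 + b * t1) • P1) := by
      ext1
      · simp
      · simp [hz0, add_smul, smul_smul]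
    rw [this]
    have k1 : τ1 ≤ a * τ1 + b * t1 := by nlinarith
    have k2 : a * τ1 + b * t1 < 1 := by nlinarith
    exact hC _ (hr1 _ (h10.le.trans k1) k2).1 (hpos1 _ k1 k2) ⟨_, 0, h10.le.trans k1, le_rfl, by simp⟩
  have J3 : JoinedIn S ((0 : W), τ2 • P2) (0, τ1 • P1) := by
    apply JoinedIn.of_segment_subset
    rintro _ ⟨a, b, ha, hb, hab, rfl⟩
    have : a • ((0 : W), τ2 • P2) + b • ((0 : W), τ1 • P1) =
        (0, a • τ2 • P2 + b • τ1 • P1) := by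
      ext1
      · simp
      · simp
    rw [this]
    have hm : a • τ2 • P2 + b • τ1 • P1 ∈ segment ℝ (τ2 • P2) (τ1 • P1) := ⟨a, b, ha, hb, hab, rfl⟩
    exact hC _ (hseg _ hm).1 (hpos3 _ hm) ⟨b * τ1, a * τ2, by positivity, by positivity, by
      rw [smul_smul, smul_smul, add_comm]⟩
  have hJ : JoinedIn S (z0, w0) (w0, z0) := (((J1.trans J2).trans J3).trans J4).trans J5
  have key := C.pair_loop hς0 S (fun x hx => hx) hJ
    (mul_left_cancel₀ hς0 (by rw [a3, b3]))
  have q1 := (hr1 t1 ht10.le a2).2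
  have q2 := (hr2 t2 ht20.le b2).2
  rw [← hz0, nn_apply] at q1
  rw [← hw0, nn_apply] at q2
  have x1 : (G z0).1 = ς * Y := by rw [← a3, ← mul_assoc, hς2, one_mul]
  have x2 : (G w0).1 = ς * Y := by rw [← b3, ← mul_assoc, hς2, one_mul]
  rw [x1] at q1; rw [x2] at q2
  set u := (G z0).2
  set v := (G w0).2
  have hval : |ς * (v - u) - (s1 - s2) * Y| ≤ M1 + M2 := by
    have : ς * (v - u) - (s1 - s2) * Y = ς * ((v + s2 * (ς * Y)) - (u + s1 * (ς * Y))) := by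
      linear_combination (-(s2 - s1) * Y) * hς2
    rw [this, abs_mul]
    have h1 : |ς| = 1 := by rcases hς with rfl | rfl <;> norm_num
    rw [h1, one_mul]
    have := abs_sub (v + s2 * (ς * Y)) (u + s1 * (ς * Y))
    linarith
  rw [abs_le] at hval
  rcases lt_or_gt_of_ne hs with h | h
  · rw [abs_of_neg (by linarith)] at hYc
    have h1 : ς * (v - u) < 0 := by nlinarith
    nlinarith
  · rw [abs_of_pos (by linarith)] at hYc
    have h1 : 0 < ς * (v - u) := by nlinarith
    nlinarith
end Core
end Emb

namespace Emb

def Good (l r z0 : W) (s : ℝ) : Prop :=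
  |s| < 1 ∧ 0 < nn s l ∧ 0 < nn s r ∧ nn s z0 < nn s l ∧ nn s z0 < nn s r

structure Sett (Ω : Set W) (l r z0 : W) : Prop where
  det : 0 < det2 r l
  hl : l ∈ Ω
  hr : r ∈ Ω
  h0 : z0 ∈ cone l r
  h0' : z0 ∉ Ω

structure IsC (Ω : Set W) (l r : W) (s : ℝ) (P : W) : Prop where
  mem : P ∈ cone l r
  nmem : P ∉ Ω
  min : ∀ z ∈ cone l r, z ∉ Ω → nn s P ≤ nn s z

lemma nn_cont : Continuous fun x : ℝ × W => nn x.1 x.2 := by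
  simp only [nn_apply]; fun_prop

lemma nn_cont_s (z : W) : Continuous fun s : ℝ => nn s z := by
  simp only [nn_apply]; fun_prop

lemma good_nhds {l r z0 : W} {s : ℝ} (h : Good l r z0 s) : ∀ᶠ s' in 𝓝 s, Good l r z0 s' := by
  obtain ⟨h1, h2, h3, h4, h5⟩ := h
  have c := fun z => (nn_cont_s z).tendsto s
  filter_upwards [(continuous_abs.tendsto s).eventually_lt_const h1,
    (c l).eventually_const_lt h2, (c r).eventually_const_lt h3,
    (c z0).eventually_lt (c l) h4, (c z0).eventually_lt (c r) h5] with s' a b c d e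
  exact ⟨a, b, c, d, e⟩

lemma nn_abs_le {s : ℝ} (hs : |s| < 1) (x : W) : |nn s x| ≤ 2 * ‖x‖ := by
  rw [nn_apply]
  have h1 : |x.1| ≤ ‖x‖ := norm_fst_le x
  have h2 : |x.2| ≤ ‖x‖ := norm_snd_le x
  have h3 := abs_add_le x.2 (s * x.1)
  rw [abs_mul] at h3
  nlinarith [abs_nonneg x.1, abs_nonneg s]

lemma cone_add {l r u v : W} {a b : ℝ} (ha : 0 ≤ a) (hb : 0 ≤ b) (hu : u ∈ cone l r)
    (hv : v ∈ cone l r) : a • u + b • v ∈ cone l r := by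
  constructor
  · have : det2 r (a • u + b • v) = a * det2 r u + b * det2 r v := by simp [det2]; ring
    rw [this]; exact add_nonneg (mul_nonneg ha hu.1) (mul_nonneg hb hv.1)
  · have : det2 (a • u + b • v) l = a * det2 u l + b * det2 v l := by simp [det2]; ring
    rw [this]; exact add_nonneg (mul_nonneg ha hu.2) (mul_nonneg hb hv.2)

lemma cone_smul {l r u : W} {a : ℝ} (ha : 0 ≤ a) (hu : u ∈ cone l r) : a • u ∈ cone l r := by
  simpa using cone_add ha le_rfl hu hu

lemma cone_nn_pos {l r z : W} {s : ℝ} (h : 0 < det2 r l) (hl : 0 < nn s l) (hr : 0 < nn s r)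
    (hz : z ∈ cone l r) (hz0 : z ≠ 0) : 0 < nn s z := by
  have e1 := cone_repr (z := z) h
  have h1 := hz.1
  have h2 := hz.2
  set α := det2 r z / det2 r l
  set β := det2 z l / det2 r l
  have hα : 0 ≤ α := by positivity
  have hβ : 0 ≤ β := by positivity
  rw [e1, map_add, map_smul, map_smul, smul_eq_mul, smul_eq_mul]
  rcases hα.eq_or_lt with h3 | h3
  · rcases hβ.eq_or_lt with h4 | h4
    · rw [← h3, ← h4] at e1; simp at e1; exact absurd e1 hz0
    · positivity
  · positivity

namespace Core
variable {f : W → W} {f' : W → W →L[ℝ] W} {ε : ℝ} {Ω : Set W} {G : W → W} {l r z0 : W}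

lemma exC (C : Core f f' ε Ω G) (S : Sett Ω l r z0) {s : ℝ} (g : Good l r z0 s) :
    ∃ P, IsC Ω l r s P := by
  have hK : IsCompact ((cone l r ∩ {z | nn s z ≤ nn s z0}) ∩ Ωᶜ) :=
    (cone_compact S.det g.2.1 g.2.2.1).inter_right C.op.isClosed_compl
  obtain ⟨P, hP, hmin⟩ := hK.exists_isMinOn ⟨z0, ⟨S.h0, le_refl (nn s z0)⟩, S.h0'⟩
    (nn s).continuous.continuousOn
  refine ⟨P, hP.1.1, hP.2, fun z hz hz' => ?_⟩
  rcases le_total (nn s z) (nn s z0) with h | h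
  · exact hmin ⟨⟨hz, h⟩, hz'⟩
  · exact le_trans hP.1.2 h

lemma Cle (_ : Core f f' ε Ω G) (S : Sett Ω l r z0) {s : ℝ} {P : W} (p : IsC Ω l r s P) :
    nn s P ≤ nn s z0 := p.min _ S.h0 S.h0'

lemma Cpos (C : Core f f' ε Ω G) (S : Sett Ω l r z0) {s : ℝ} (g : Good l r z0 s) {P : W}
    (p : IsC Ω l r s P) : 0 < nn s P :=
  cone_nn_pos S.det g.2.1 g.2.2.1 p.mem (fun h => p.nmem (h ▸ C.h0))

lemma Cray (C : Core f f' ε Ω G) (S : Sett Ω l r z0) {s : ℝ} (g : Good l r z0 s) {P : W}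
    (p : IsC Ω l r s P) {τ : ℝ} (h : 0 ≤ τ) (h' : τ < 1) : nn s (τ • P) < nn s P ∧ τ • P ∈ Ω := by
  have h1 : nn s (τ • P) < nn s P := by
    rw [map_smul, smul_eq_mul]; nlinarith [C.Cpos S g p]
  refine ⟨h1, ?_⟩
  by_contra h2
  have := p.min _ (cone_smul h p.mem) h2
  linarith

lemma Cside (C : Core f f' ε Ω G) (S : Sett Ω l r z0) {s : ℝ} (g : Good l r z0 s) {z : W}
    (hz : z ∈ cone l r) (hle : nn s z ≤ nn s z0) (h : det2 r z = 0 ∨ det2 z l = 0) :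
    ∃ τ : ℝ, 0 ≤ τ ∧ τ ≤ 1 ∧ (z = τ • l ∨ z = τ • r) := by
  have e1 := cone_repr (z := z) S.det
  have h1 := hz.1
  have h2 := hz.2
  have hd := S.det
  obtain ⟨g1, g2, g3, g4, g5⟩ := g
  set α := det2 r z / det2 r l with hα'
  set β := det2 z l / det2 r l with hβ'
  have hα : 0 ≤ α := by positivity
  have hβ : 0 ≤ β := by positivity
  rcases h with h | h
  · have : α = 0 := by rw [hα', h]; simp
    rw [this, zero_smul, zero_add] at e1
    refine ⟨β, hβ, ?_, Or.inr e1⟩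
    rw [e1, map_smul, smul_eq_mul] at hle
    nlinarith
  · have : β = 0 := by rw [hβ', h]; simp
    rw [this, zero_smul, add_zero] at e1
    refine ⟨α, hα, ?_, Or.inl e1⟩
    rw [e1, map_smul, smul_eq_mul] at hle
    nlinarith

lemma Cint (C : Core f f' ε Ω G) (S : Sett Ω l r z0) {s : ℝ} (g : Good l r z0 s) {P : W}
    (p : IsC Ω l r s P) : 0 < det2 r P ∧ 0 < det2 P l := by
  by_contra! h
  have : det2 r P = 0 ∨ det2 P l = 0 := by
    rcases p.mem.1.lt_or_eq with h1 | h1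
    · exact Or.inr (le_antisymm (h h1) p.mem.2)
    · exact Or.inl h1.symm
  obtain ⟨τ, t0, t1, h | h⟩ := C.Cside S g p.mem (C.Cle S p) this
  · exact p.nmem (h ▸ C.star _ S.hl _ t0 t1)
  · exact p.nmem (h ▸ C.star _ S.hr _ t0 t1)

lemma Cbd (S : Sett Ω l r z0) {s : ℝ} (g : Good l r z0 s) {z : W} (hz : z ∈ cone l r)
    (hle : nn s z ≤ nn s z0) : ‖z‖ ≤ ‖l‖ + ‖r‖ := by
  have e1 := cone_repr (z := z) S.det
  have h1 := hz.1
  have h2 := hz.2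
  have hd := S.det
  obtain ⟨g1, g2, g3, g4, g5⟩ := g
  set α := det2 r z / det2 r l with hα'
  set β := det2 z l / det2 r l with hβ'
  have hα : 0 ≤ α := by positivity
  have hβ : 0 ≤ β := by positivity
  have e2 : nn s z = α * nn s l + β * nn s r := by
    conv_lhs => rw [e1]
    rw [map_add, map_smul, map_smul]; rfl
  have hα1 : α ≤ 1 := by nlinarith
  have hβ1 : β ≤ 1 := by nlinarith
  calc ‖z‖ ≤ ‖α • l‖ + ‖β • r‖ := by conv_lhs => rw [e1]
                                     exact norm_add_le _ _
    _ = α * ‖l‖ + β * ‖r‖ := by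
        rw [norm_smul, norm_smul, Real.norm_of_nonneg hα, Real.norm_of_nonneg hβ]
    _ ≤ _ := by nlinarith [norm_nonneg l, norm_nonneg r]

lemma Cblow (C : Core f f' ε Ω G) (S : Sett Ω l r z0) {s : ℝ} (g : Good l r z0 s) {P : W}
    (p : IsC Ω l r s P) (M : ℝ) : ∃ ρ > 0, ∀ z ∈ Ω, dist z P < ρ → M < ‖G z‖ :=
  C.blow P p.nmem (fun _ h h' => (C.Cray S g p h h').2) M

/-- bound on the sides -/
lemma sides (C : Core f f' ε Ω G) (S : Sett Ω l r z0) : ∃ R : ℝ, 0 ≤ R ∧ ∀ τ : ℝ, 0 ≤ τ → τ ≤ 1 →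
    ‖G (τ • l)‖ ≤ R ∧ ‖G (τ • r)‖ ≤ R := by
  have key : ∀ u ∈ Ω, ∃ R, ∀ τ : ℝ, 0 ≤ τ → τ ≤ 1 → ‖G (τ • u)‖ ≤ R := by
    intro u hu
    have : ContinuousOn (fun τ : ℝ => G (τ • u)) (Icc 0 1) :=
      C.cont.comp (by fun_prop) (fun τ hτ => C.star u hu τ hτ.1 hτ.2)
    obtain ⟨R, hR⟩ := isCompact_Icc.exists_bound_of_continuousOn this
    exact ⟨R, fun τ h h' => hR τ ⟨h, h'⟩⟩
  obtain ⟨R1, h1⟩ := key l S.hl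
  obtain ⟨R2, h2⟩ := key r S.hr
  refine ⟨max R1 R2, le_max_of_le_left ((norm_nonneg _).trans (h1 0 le_rfl zero_le_one)),
    fun τ h h' => ⟨(h1 τ h h').trans (le_max_left _ _), (h2 τ h h').trans (le_max_right _ _)⟩⟩

lemma unifM (C : Core f f' ε Ω G) (S : Sett Ω l r z0) : ∃ M : ℝ, 0 ≤ M ∧ ∀ s, Good l r z0 s →
    ∀ P, IsC Ω l r s P → ∀ z ∈ cone l r, nn s z < nn s P → z ∈ Ω ∧ |nn s (G z)| ≤ M := by
  obtain ⟨R, hR0, hR⟩ := C.sides S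
  have hε := C.εpos
  refine ⟨max (2 * (2 * R)) (2 * Real.pi * (2 * ‖z0‖) / ε), le_max_of_le_left (by positivity), ?_⟩
  intro s g P p z hz hzP
  have hQ : ∀ z ∈ cone l r, nn s z < nn s P → z ∈ Ω := by
    intro z hz h
    by_contra h2
    have := p.min z hz h2
    linarith
  refine ⟨hQ z hz hzP, ?_⟩
  have hle := C.Cle S p
  have hz0 := (le_abs_self _).trans (nn_abs_le g.1 z0)
  have hpi := Real.pi_pos
  have g' := g
  obtain ⟨g1, g2, g3, g4, g5⟩ := g'
  refine (C.Mlemma (R0 := 2 * R) S.det g.2.1 g.2.2.1 (C.Cpos S g p) hQ ?_ ?_ z hz hzP).trans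
    (max_le_max le_rfl ?_)
  · intro τ h h'
    have : τ ≤ 1 := by
      rw [map_smul, smul_eq_mul] at h'; nlinarith
    exact (nn_abs_le g.1 _).trans (by linarith [(hR τ h this).1])
  · intro τ h h'
    have : τ ≤ 1 := by
      rw [map_smul, smul_eq_mul] at h'; nlinarith
    exact (nn_abs_le g.1 _).trans (by linarith [(hR τ h this).2])
  · have : nn s P ≤ 2 * ‖z0‖ := hle.trans hz0
    gcongr

lemma Cdisj (C : Core f f' ε Ω G) (S : Sett Ω l r z0) {s s' : ℝ} (g : Good l r z0 s)
    (g' : Good l r z0 s') {P : W} (p : IsC Ω l r s P) (p' : IsC Ω l r s' P) : s = s' := by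
  by_contra hne
  obtain ⟨M, hM0, hM⟩ := C.unifM S
  have hd : 0 < |s - s'| := abs_pos.2 (sub_ne_zero.2 hne)
  set Y := 2 * M / |s - s'|
  have hY : 0 ≤ Y := by positivity
  obtain ⟨ρ, hρ, hb⟩ := C.Cblow S g p (M + (|s| + 1) * Y)
  have hcont : Tendsto (fun τ : ℝ => τ • P) (𝓝[<] 1) (𝓝 P) := by
    have : Continuous fun τ : ℝ => τ • P := by fun_prop
    have h := this.tendsto 1
    rw [one_smul] at h
    exact h.mono_left nhdsWithin_le_nhds
  have e1 : ∀ᶠ τ : ℝ in 𝓝[<] 1, dist (τ • P) P < ρ := hcont (Metric.ball_mem_nhds P hρ)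
  have e2 : ∀ᶠ τ : ℝ in 𝓝[<] 1, τ ∈ Ioo (0:ℝ) 1 := Ioo_mem_nhdsLT one_pos
  obtain ⟨T, hT1, hT2, hT3⟩ := (e1.and e2).exists
  have r1 := C.Cray S g p hT2.le hT3
  have r2 := C.Cray S g' p' hT2.le hT3
  have m1 := (hM s g P p _ (cone_smul hT2.le p.mem) r1.1).2
  have m2 := (hM s' g' P p' _ (cone_smul hT2.le p.mem) r2.1).2
  have h3 := fst_large m1 hY (hb _ r1.2 hT1)
  rw [nn_apply] at m1 m2
  set x := G (T • P)
  have : |(s - s') * x.1| ≤ 2 * M := by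
    have h4 := abs_sub (x.2 + s * x.1) (x.2 + s' * x.1)
    have h5 : (x.2 + s * x.1) - (x.2 + s' * x.1) = (s - s') * x.1 := by ring
    rw [h5] at h4; linarith
  rw [abs_mul] at this
  have h6 : Y * |s - s'| = 2 * M := by simp only [Y]; field_simp
  nlinarith

lemma Corder (C : Core f f' ε Ω G) (S : Sett Ω l r z0) {s s' : ℝ} (g : Good l r z0 s)
    (g' : Good l r z0 s') {P P' : W} (p : IsC Ω l r s P) (p' : IsC Ω l r s' P') (h : s < s') :
    P'.1 < P.1 := by
  have h1 := p.min _ p'.mem p'.nmem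
  have h2 := p'.min _ p.mem p.nmem
  rw [nn_apply, nn_apply] at h1 h2
  have h3 : P'.1 ≤ P.1 := by nlinarith
  rcases h3.lt_or_eq with h4 | h4
  · exact h4
  · have h5 : P'.2 = P.2 := by rw [h4] at h1 h2; linarith
    have h6 : P' = P := Prod.ext h4 h5
    subst h6
    exact absurd (C.Cdisj S g g' p p') h.ne

lemma Cdet (C : Core f f' ε Ω G) (S : Sett Ω l r z0) {s s' : ℝ} (g : Good l r z0 s)
    (g' : Good l r z0 s') {P P' : W} (p : IsC Ω l r s P) (p' : IsC Ω l r s' P') (h : s < s') :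
    0 < det2 P P' := by
  have h0 := C.Corder S g g' p p' h
  have h1 := p.min _ p'.mem p'.nmem
  have h2 := p'.min _ p.mem p.nmem
  have h3 := C.Cpos S g p
  have h4 := C.Cpos S g' p'
  have e1 : det2 P P' = P.1 * nn s P' - nn s P * P'.1 := by simp [det2]; ring
  have e2 : det2 P P' = P.1 * nn s' P' - nn s' P * P'.1 := by simp [det2]; ring
  rcases le_total 0 P.1 with h5 | h5
  · rw [e1]; nlinarith
  · rw [e2]; nlinarith

lemma Cupper (C : Core f f' ε Ω G) (S : Sett Ω l r z0) {s0 : ℝ} (g : Good l r z0 s0) {U : Set W}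
    (hU : IsOpen U) (hK : ∀ P, IsC Ω l r s0 P → P ∈ U) :
    ∀ᶠ s in 𝓝 s0, ∀ P, IsC Ω l r s P → P ∈ U := by
  by_contra hcon
  have hfr : ∃ᶠ s in 𝓝 s0, Good l r z0 s ∧ ∃ P, IsC Ω l r s P ∧ P ∉ U := by
    rw [Filter.not_eventually] at hcon
    refine (hcon.and_eventually (good_nhds g)).mono ?_
    rintro s ⟨h1, h2⟩
    push Not at h1
    exact ⟨h2, h1⟩
  obtain ⟨u, hu, hu2⟩ := exists_seq_forall_of_frequently hfr
  choose hg P hP hPU using hu2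
  have hB : ∀ n, P n ∈ closedBall (0:W) (‖l‖ + ‖r‖) := fun n => by
    rw [mem_closedBall_zero_iff]; exact Cbd S (hg n) (hP n).mem (C.Cle S (hP n))
  obtain ⟨Q, -, φ, hφ, hQ⟩ := (isCompact_closedBall (0:W) (‖l‖ + ‖r‖)).tendsto_subseq hB
  have hu' := hu.comp hφ.tendsto_atTop
  have q : IsC Ω l r s0 Q := by
    refine ⟨(cone_closed l r).mem_of_tendsto hQ (Eventually.of_forall fun n => (hP _).mem),
      C.op.isClosed_compl.mem_of_tendsto hQ (Eventually.of_forall fun n => (hP _).nmem), ?_⟩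
    intro z hz hz'
    have t1 : Tendsto (fun n => nn (u (φ n)) (P (φ n))) atTop (𝓝 (nn s0 Q)) :=
      Tendsto.comp (g := fun x : ℝ × W => nn x.1 x.2) (f := fun n => (u (φ n), P (φ n)))
        (nn_cont.tendsto (s0, Q)) (Tendsto.prodMk_nhds hu' hQ)
    have t2 : Tendsto (fun n => nn (u (φ n)) z) atTop (𝓝 (nn s0 z)) :=
      Tendsto.comp (g := fun s : ℝ => nn s z) (f := fun n => u (φ n)) ((nn_cont_s z).tendsto s0) hu'
    exact le_of_tendsto_of_tendsto' t1 t2 fun n => (hP _).min z hz hz'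
  have := hU.isClosed_compl.mem_of_tendsto hQ (Eventually.of_forall fun n => hPU _)
  exact this (hK Q q)

lemma Ccompact (C : Core f f' ε Ω G) (S : Sett Ω l r z0) {s : ℝ} (g : Good l r z0 s) :
    IsCompact {P | IsC Ω l r s P} := by
  obtain ⟨P0, p0⟩ := C.exC S g
  have : {P | IsC Ω l r s P} = (cone l r ∩ {z | nn s z ≤ nn s P0}) ∩ Ωᶜ := by
    ext P
    constructor
    · intro p; exact ⟨⟨p.mem, p.min _ p0.mem p0.nmem⟩, p.nmem⟩
    · rintro ⟨⟨h1, h2⟩, h3⟩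
      exact ⟨h1, h3, fun z hz hz' => le_trans h2 (p0.min z hz hz')⟩
  rw [this]
  exact (cone_compact S.det g.2.1 g.2.2.1).inter_right C.op.isClosed_compl

lemma Ceq {s : ℝ} {P P' : W} (p : IsC Ω l r s P) (p' : IsC Ω l r s P') : nn s P = nn s P' :=
  le_antisymm (p.min _ p'.mem p'.nmem) (p'.min _ p.mem p.nmem)

lemma eq_of_nn {s : ℝ} {P P' : W} (h : nn s P = nn s P') (h1 : P.1 = P'.1) : P = P' := by
  rw [nn_apply, nn_apply, h1] at h
  exact Prod.ext h1 (by linarith)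

lemma Cmin (C : Core f f' ε Ω G) (S : Sett Ω l r z0) {s : ℝ} (g : Good l r z0 s) :
    ∃ P, IsC Ω l r s P ∧ ∀ P', IsC Ω l r s P' → P.1 ≤ P'.1 := by
  obtain ⟨P, hP, h⟩ := (C.Ccompact S g).exists_isMinOn (C.exC S g) continuous_fst.continuousOn
  exact ⟨P, hP, fun P' hP' => h hP'⟩

lemma Cmax (C : Core f f' ε Ω G) (S : Sett Ω l r z0) {s : ℝ} (g : Good l r z0 s) :
    ∃ P, IsC Ω l r s P ∧ ∀ P', IsC Ω l r s P' → P'.1 ≤ P.1 := by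
  obtain ⟨P, hP, h⟩ := (C.Ccompact S g).exists_isMaxOn (C.exC S g) continuous_fst.continuousOn
  exact ⟨P, hP, fun P' hP' => h hP'⟩

lemma Cright (C : Core f f' ε Ω G) (S : Sett Ω l r z0) {s0 : ℝ} (g : Good l r z0 s0) {P0 : W}
    (p0 : IsC Ω l r s0 P0) (hmin : ∀ P', IsC Ω l r s0 P' → P0.1 ≤ P'.1) {U : Set W}
    (hU : IsOpen U) (hP : P0 ∈ U) :
    ∀ᶠ s in 𝓝[>] s0, ∀ P, IsC Ω l r s P → P ∈ U := by
  have h1 := C.Cupper S g (U := U ∪ {z | P0.1 < z.1})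
    (hU.union (isOpen_lt continuous_const continuous_fst)) (fun P p => by
      rcases (hmin P p).lt_or_eq with h | h
      · exact Or.inr h
      · exact Or.inl (eq_of_nn (Ceq p0 p) h ▸ hP))
  filter_upwards [h1.filter_mono nhdsWithin_le_nhds,
    (good_nhds g).filter_mono nhdsWithin_le_nhds, self_mem_nhdsWithin] with s a b c P p
  rcases a P p with h | h
  · exact h
  · exact absurd (C.Corder S g b p0 p c) (not_lt.2 (le_of_lt h))

lemma Cleft (C : Core f f' ε Ω G) (S : Sett Ω l r z0) {s0 : ℝ} (g : Good l r z0 s0) {P0 : W}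
    (p0 : IsC Ω l r s0 P0) (hmin : ∀ P', IsC Ω l r s0 P' → P'.1 ≤ P0.1) {U : Set W}
    (hU : IsOpen U) (hP : P0 ∈ U) :
    ∀ᶠ s in 𝓝[<] s0, ∀ P, IsC Ω l r s P → P ∈ U := by
  have h1 := C.Cupper S g (U := U ∪ {z | z.1 < P0.1})
    (hU.union (isOpen_lt continuous_fst continuous_const)) (fun P p => by
      rcases (hmin P p).lt_or_eq with h | h
      · exact Or.inr h
      · exact Or.inl (eq_of_nn (Ceq p p0) h ▸ hP))
  filter_upwards [h1.filter_mono nhdsWithin_le_nhds,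
    (good_nhds g).filter_mono nhdsWithin_le_nhds, self_mem_nhdsWithin] with s a b c P p
  rcases a P p with h | h
  · exact h
  · exact absurd (C.Corder S b g p p0 c) (not_lt.2 (le_of_lt h))

end Core
end Emb

namespace Emb

lemma proj_near {s h : ℝ} {k : W} (hk : nn s k = h) (hh : 0 < h) {U : Set W} (hU : IsOpen U)
    (hkU : k ∈ U) : ∀ᶠ z in 𝓝 k, z ∈ U ∧ (h / nn s z) • z ∈ U := by
  have h1 : ContinuousAt (fun z => (h / nn s z) • z) k := by
    have h0 : ContinuousAt (fun z => h / nn s z) k :=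
      ContinuousAt.div continuousAt_const (nn s).continuous.continuousAt (by rw [hk]; exact hh.ne')
    exact h0.smul continuousAt_id
  have h2 : (h / nn s k) • k = k := by rw [hk, div_self hh.ne', one_smul]
  have a1 : ∀ᶠ z in 𝓝 k, z ∈ U := hU.mem_nhds hkU
  have a2 : ∀ᶠ z in 𝓝 k, (h / nn s z) • z ∈ U := h1 (hU.mem_nhds (by beta_reduce; rwa [h2]))
  exact a1.and a2

namespace Core
variable {f : W → W} {f' : W → W →L[ℝ] W} {ε : ℝ} {Ω : Set W} {G : W → W} {l r z0 : W}

lemma ne_of_large {s M : ℝ} {x : W} (h : |nn s x| ≤ M) (h' : M < ‖x‖) : x.1 ≠ 0 := by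
  have := fst_large (Y := 0) h le_rfl (by simpa using h')
  exact abs_pos.1 this

lemma pair2 (C : Core f f' ε Ω G) {P1 P2 c1 c2 : W} {s1 s2 M1 M2 ss h M r1 r2 : ℝ}
    (hdet : 0 < det2 P2 P1) (hs : s1 ≠ s2) (hP1 : P1 ∉ Ω) (hP2 : P2 ∉ Ω)
    (hr1 : ∀ τ : ℝ, 0 ≤ τ → τ < 1 → τ • P1 ∈ Ω ∧ |nn s1 (G (τ • P1))| ≤ M1)
    (hr2 : ∀ τ : ℝ, 0 ≤ τ → τ < 1 → τ • P2 ∈ Ω ∧ |nn s2 (G (τ • P2))| ≤ M2)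
    (hh : 0 < h) (k1 : h ≤ nn ss P1) (k2 : h ≤ nn ss P2)
    (hT : ∀ a b : ℝ, 0 ≤ a → 0 ≤ b → nn ss (a • P1 + b • P2) < h →
      a • P1 + b • P2 ∈ Ω ∧ |nn ss (G (a • P1 + b • P2))| ≤ M)
    (B1 : ∀ z ∈ Ω, dist z c1 < r1 → M1 < ‖G z‖)
    (B2 : ∀ z ∈ Ω, dist z c2 < r2 → M2 < ‖G z‖ ∧ M < ‖G z‖)
    (d1 : P1 ∈ ball c1 r1) (d2 : (h / nn ss P1) • P1 ∈ ball c1 r1 ∩ ball c2 r2)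
    (d3 : P2 ∈ ball c2 r2) (d4 : (h / nn ss P2) • P2 ∈ ball c2 r2) :
    detL (f' 0) * (s1 - s2) < 0 := by
  have hn1 : 0 < nn ss P1 := hh.trans_le k1
  have hn2 : 0 < nn ss P2 := hh.trans_le k2
  have ev : ∀ P : W, ∀ U : Set W, IsOpen U → (h / nn ss P) • P ∈ U →
      ∀ᶠ c : ℝ in 𝓝[<] 1, (c * (h / nn ss P)) • P ∈ U := by
    intro P U hU hP
    have hc : Continuous fun c : ℝ => (c * (h / nn ss P)) • P := by fun_prop
    have := hc.tendsto 1
    rw [one_mul] at this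
    exact Eventually.filter_mono nhdsWithin_le_nhds (this (hU.mem_nhds hP))
  have e3 : ∀ᶠ τ : ℝ in 𝓝[<] 1, τ ∈ Ioo (0:ℝ) 1 := Ioo_mem_nhdsLT one_pos
  obtain ⟨c, hc1, hc2, hc0, hc3⟩ := ((ev P1 _ (isOpen_ball.inter isOpen_ball) d2).and
    ((ev P2 _ isOpen_ball d4).and e3)).exists
  set τ1 := c * (h / nn ss P1) with hτ1
  set τ2 := c * (h / nn ss P2) with hτ2
  have q1 : h / nn ss P1 ≤ 1 := (div_le_one hn1).2 k1
  have q2 : h / nn ss P2 ≤ 1 := (div_le_one hn2).2 k2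
  have t1 : 0 < τ1 := by positivity
  have t2 : 0 < τ2 := by positivity
  have t1' : τ1 < 1 := by nlinarith [div_pos hh hn1]
  have t2' : τ2 < 1 := by nlinarith [div_pos hh hn2]
  have tailmem : ∀ (P c : W) (ρ τ0 : ℝ), τ0 < 1 → τ0 • P ∈ ball c ρ → P ∈ ball c ρ →
      ∀ τ : ℝ, τ0 ≤ τ → τ < 1 → τ • P ∈ ball c ρ := by
    intro P c ρ τ0 h0 h1 h2 τ h3 h4
    have := (convex_ball c ρ) h1 h2 (a := (1 - τ) / (1 - τ0)) (b := (τ - τ0) / (1 - τ0))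
      (div_nonneg (by linarith) (by linarith)) (div_nonneg (by linarith) (by linarith))
      (by have : 1 - τ0 ≠ 0 := by linarith
          field_simp; ring)
    convert this using 1
    rw [smul_smul, ← add_smul]
    congr 1
    have : 1 - τ0 ≠ 0 := by linarith
    field_simp; ring
  refine C.pair hdet hs hP1 hP2 hr1 hr2 t1 t1' t2 t2' ?_ ?_ ?_
  · intro τ h3 h4
    have := hr1 τ (t1.le.trans h3) h4
    exact ne_of_large this.2 (B1 _ this.1 (tailmem _ _ _ _ t1' hc1.1 d1 τ h3 h4))
  · intro τ h3 h4
    have := hr2 τ (t2.le.trans h3) h4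
    exact ne_of_large this.2 (B2 _ this.1 (tailmem _ _ _ _ t2' hc2 d3 τ h3 h4)).1
  · intro z hz
    have hzb := (convex_ball c2 r2).segment_subset hc2 hc1.2 hz
    obtain ⟨a, b, ha, hb, hab, rfl⟩ := hz
    have hlt : nn ss ((b * τ1) • P1 + (a * τ2) • P2) < h := by
      rw [map_add, map_smul, map_smul, smul_eq_mul, smul_eq_mul]
      have i1 : τ1 * nn ss P1 = c * h := by rw [hτ1]; field_simp
      have i2 : τ2 * nn ss P2 = c * h := by rw [hτ2]; field_simp
      have : b * τ1 * nn ss P1 + a * τ2 * nn ss P2 = (a + b) * (c * h) := by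
        rw [mul_assoc, i1, mul_assoc, i2]; ring
      rw [this, hab]; nlinarith
    have hTT := hT (b * τ1) (a * τ2) (by positivity) (by positivity) hlt
    have e : (b * τ1) • P1 + (a * τ2) • P2 = a • τ2 • P2 + b • τ1 • P1 := by
      rw [smul_smul, smul_smul, add_comm]
    rw [e] at hTT
    exact ⟨hTT.1, ne_of_large hTT.2 (B2 _ hTT.1 hzb).2⟩

lemma reg (C : Core f f' ε Ω G) (S : Sett Ω l r z0) {s0 : ℝ} (g : Good l r z0 s0) :
    detL (f' 0) < 0 := by
  obtain ⟨M, hM0, hM⟩ := C.unifM S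
  obtain ⟨P0, p0, hmin⟩ := C.Cmin S g
  obtain ⟨ρ, hρ, hb⟩ := C.Cblow S g p0 M
  have hpos := C.Cpos S g p0
  obtain ⟨V, hV, hVo, hPV⟩ := _root_.mem_nhds_iff.1
    (proj_near (s := s0) rfl hpos isOpen_ball (mem_ball_self hρ))
  obtain ⟨s, hs1, hs2, hs3⟩ := ((C.Cright S g p0 hmin hVo hPV).and
    (((good_nhds g).filter_mono nhdsWithin_le_nhds).and self_mem_nhdsWithin)).exists
  have hs3 : s0 < s := hs3
  obtain ⟨P1, p1⟩ := C.exC S hs2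
  obtain ⟨v1, v2⟩ := hV (hs1 P1 p1)
  have key := C.pair2 (M1 := M) (M2 := M) (M := M) (ss := s0) (c1 := P0) (c2 := P0)
    (r1 := ρ) (r2 := ρ) (C.Cdet S g hs2 p0 p1 hs3) hs3.ne'
    p1.nmem p0.nmem
    (fun τ h h' => hM s hs2 _ p1 _ (cone_smul h p1.mem) (C.Cray S hs2 p1 h h').1)
    (fun τ h h' => hM s0 g _ p0 _ (cone_smul h p0.mem) (C.Cray S g p0 h h').1)
    hpos (p0.min _ p1.mem p1.nmem) le_rfl
    (fun a b ha hb hlt => hM s0 g _ p0 _ (cone_add ha hb p1.mem p0.mem) hlt)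
    hb (fun z hz hd => ⟨hb z hz hd, hb z hz hd⟩) v1 ⟨v2, v2⟩ (mem_ball_self hρ)
    (by rw [div_self hpos.ne', one_smul]; exact mem_ball_self hρ)
  nlinarith

lemma nogap (C : Core f f' ε Ω G) (S : Sett Ω l r z0) {M : ℝ}
    (hM : ∀ s, Good l r z0 s →
      ∀ P, IsC Ω l r s P → ∀ z ∈ cone l r, nn s z < nn s P → z ∈ Ω ∧ |nn s (G z)| ≤ M)
    {P0 : W} {r0 ss : ℝ} (hb : ∀ z ∈ Ω, dist z P0 < r0 → M < ‖G z‖)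
    (g : Good l r z0 ss) (hball : ∀ P, IsC Ω l r ss P → P ∈ ball P0 r0)
    {P P' z : W} (p : IsC Ω l r ss P) (p' : IsC Ω l r ss P') (hz : z ∈ Ω) (hzl : nn ss z = nn ss P)
    (h1 : P.1 < z.1) (h2 : z.1 < P'.1) : False := by
  have hneg := C.reg S g
  have hh := C.Cpos S g p
  set h := nn ss P with hdef
  -- k1 the rightmost contact to the left of z
  obtain ⟨k, ⟨hk, hkz⟩, hkmax⟩ := ((C.Ccompact S g).inter_right
    (isClosed_le continuous_fst (continuous_const (y := z.1)))).exists_isMaxOn ⟨P, p, h1.le⟩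
    continuous_fst.continuousOn
  have hk : IsC Ω l r ss k := hk
  have hkz : k.1 ≤ z.1 := hkz
  have hkl : nn ss k = h := Ceq hk p
  have hkz' : k.1 < z.1 := by
    refine hkz.lt_of_ne fun e => hk.nmem ?_
    rw [eq_of_nn (hkl.trans hzl.symm) e]; exact hz
  have hdzk : 0 < det2 z k := by
    have : det2 z k = z.1 * nn ss k - nn ss z * k.1 := by simp [det2]; ring
    rw [this, hkl, hzl]; nlinarith
  have hdp'z : 0 < det2 P' z := by
    have : det2 P' z = P'.1 * nn ss z - nn ss P' * z.1 := by simp [det2]; ring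
    rw [this, hzl, Ceq p' p]; nlinarith
  obtain ⟨Pm, pm, hmax⟩ := C.Cmax S g
  have hPm : P'.1 ≤ Pm.1 := hmax P' p'
  have hdPmk : 0 < det2 Pm k := by
    have : det2 Pm k = Pm.1 * nn ss k - nn ss Pm * k.1 := by simp [det2]; ring
    rw [this, hkl, Ceq pm p]; nlinarith
  -- z in the interior of the cone
  set lam := (z.1 - k.1) / (P'.1 - k.1) with hlam
  have hlam0 : 0 < lam := div_pos (by linarith) (by linarith)
  have hlam1 : lam < 1 := (div_lt_one (by linarith)).2 (by linarith)
  have hzc : z = (1 - lam) • k + lam • P' := by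
    have e1 : z.1 = (1 - lam) * k.1 + lam * P'.1 := by
      have : P'.1 - k.1 ≠ 0 := by linarith
      rw [hlam]; field_simp; ring
    refine eq_of_nn (s := ss) ?_ (by simpa using e1)
    rw [map_add, map_smul, map_smul, smul_eq_mul, smul_eq_mul, hkl, Ceq p' p, hzl, ← hdef]; ring
  have hzcone : z ∈ cone l r := by
    rw [hzc]; exact cone_add (by linarith) hlam0.le hk.mem p'.mem
  have hdzl : 0 < det2 z l := by
    have : det2 z l = (1 - lam) * det2 k l + lam * det2 P' l := by
      rw [hzc]; simp [det2]; ring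
    rw [this]
    have a1 := (C.Cint S g hk).2
    have a2 := (C.Cint S g p').2
    have : 0 < 1 - lam := by linarith
    positivity
  -- enlarge z
  obtain ⟨η, hη, hηΩ⟩ : ∃ η : ℝ, 0 < η ∧ (1 + η) • z ∈ Ω := by
    have hc : Continuous fun η : ℝ => (1 + η) • z := by fun_prop
    have := hc.tendsto 0
    rw [add_zero, one_smul] at this
    obtain ⟨η, a, b⟩ := ((Eventually.filter_mono nhdsWithin_le_nhds (this (C.op.mem_nhds hz))).and
      (self_mem_nhdsWithin (s := Ioi (0:ℝ)))).exists
    exact ⟨η, b, a⟩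
  set r' := (1 + η) • z with hr'
  have hdr'l : 0 < det2 r' l := by
    have : det2 r' l = (1 + η) * det2 z l := by rw [hr']; simp [det2]; ring
    rw [this]; positivity
  have hdr'k : 0 < det2 r' k := by
    have : det2 r' k = (1 + η) * det2 z k := by rw [hr']; simp [det2]; ring
    rw [this]; positivity
  have S' : Sett Ω l r' k := ⟨hdr'l, S.hl, hηΩ, ⟨hdr'k.le, hk.mem.2⟩, hk.nmem⟩
  have hnr' : nn ss r' = (1 + η) * h := by rw [hr', map_smul, smul_eq_mul, hzl]
  have hhz0 : h ≤ nn ss z0 := C.Cle S p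
  have g' : Good l r' k ss := by
    refine ⟨g.1, g.2.1, ?_, ?_, ?_⟩
    · rw [hnr']; positivity
    · rw [hkl]; exact hhz0.trans_lt g.2.2.2.1
    · rw [hkl, hnr']; nlinarith
  have hsub : ∀ u ∈ cone l r', u ∈ cone l r := by
    intro u hu
    have e := cone_repr (z := u) hdr'l
    rw [e]
    have hlc : l ∈ cone l r := ⟨S.det.le, by simp [det2]; linarith⟩
    have hrc : r' ∈ cone l r := cone_smul (by linarith) hzcone
    exact cone_add (div_nonneg hu.1 hdr'l.le) (div_nonneg hu.2 hdr'l.le) hlc hrc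
  have k' : IsC Ω l r' ss k := ⟨S'.h0, hk.nmem, fun u hu hu' => hk.min u (hsub u hu) hu'⟩
  have hkmax' : ∀ Q, IsC Ω l r' ss Q → Q.1 ≤ k.1 := by
    intro Q q
    have hQ : IsC Ω l r ss Q := ⟨hsub Q q.mem, q.nmem, fun u hu hu' => by
      rw [Ceq q k']; exact hk.min u hu hu'⟩
    refine hkmax ⟨hQ, ?_⟩
    have hq := q.mem.1
    have : det2 r' Q = (1 + η) * (z.1 * nn ss Q - nn ss z * Q.1) := by
      rw [hr']; simp [det2]; ring
    rw [this, Ceq q k', hkl, hzl] at hq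
    have : 0 ≤ z.1 * h - h * Q.1 := nonneg_of_mul_nonneg_right hq (by linarith)
    change Q.1 ≤ z.1
    nlinarith
  obtain ⟨M', hM'0, hM'⟩ := C.unifM S'
  obtain ⟨r1, hr1, hb1⟩ := C.Cblow S' g' k' M'
  obtain ⟨V1, hV1, hV1o, hkV1⟩ := _root_.mem_nhds_iff.1 (proj_near (s := ss) hkl hh
    (isOpen_ball.inter isOpen_ball) ⟨mem_ball_self hr1, hball k hk⟩)
  obtain ⟨V2, hV2, hV2o, hPV2⟩ := _root_.mem_nhds_iff.1 (proj_near (s := ss) (Ceq pm p) hh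
    isOpen_ball (hball Pm pm))
  have hdn : ∀ᶠ x : W × W in 𝓝 (Pm, k), 0 < det2 x.1 x.2 :=
    ((det2_cont continuous_fst continuous_snd).tendsto (Pm, k)).eventually_const_lt hdPmk
  rw [nhds_prod_eq, eventually_prod_iff] at hdn
  obtain ⟨p2, hp2, p1, hp1, hdd⟩ := hdn
  obtain ⟨V3, hV3, hV3o, hPV3⟩ := _root_.mem_nhds_iff.1 hp2
  obtain ⟨V4, hV4, hV4o, hkV4⟩ := _root_.mem_nhds_iff.1 hp1
  have ev1 := (C.Cleft S' g' k' hkmax' (hV1o.inter hV4o) ⟨hkV1, hkV4⟩).and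
    ((good_nhds g').filter_mono nhdsWithin_le_nhds)
  have ev2 := (C.Cleft S g pm hmax (hV2o.inter hV3o) ⟨hPV2, hPV3⟩).and
    ((good_nhds g).filter_mono nhdsWithin_le_nhds)
  obtain ⟨s1, ⟨⟨a1, a2⟩, a3⟩⟩ := (ev1.and self_mem_nhdsWithin).exists
  have a3 : s1 < ss := a3
  obtain ⟨s2, ⟨⟨b1, b2⟩, b3, b4⟩⟩ := (ev2.and (Ioo_mem_nhdsLT a3)).exists
  obtain ⟨P1, q1⟩ := C.exC S' a2
  obtain ⟨P2, q2⟩ := C.exC S b2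
  obtain ⟨u1, u2⟩ := a1 P1 q1
  obtain ⟨w1, w2⟩ := b1 P2 q2
  have hP1c := hsub _ q1.mem
  have key := C.pair2 (M1 := M') (M2 := M) (M := M) (ss := ss) (h := h) (c1 := k) (c2 := P0)
    (r1 := r1) (r2 := r0) (hdd (hV3 w2) (hV4 u2)) b3.ne q1.nmem q2.nmem
    (fun τ h h' => hM' s1 a2 _ q1 _ (cone_smul h q1.mem) (C.Cray S' a2 q1 h h').1)
    (fun τ h h' => hM s2 b2 _ q2 _ (cone_smul h q2.mem) (C.Cray S b2 q2 h h').1)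
    hh (p.min _ hP1c q1.nmem) (p.min _ q2.mem q2.nmem)
    (fun a b ha hb hlt => hM ss g _ p _ (cone_add ha hb hP1c q2.mem) hlt)
    hb1 (fun z hz hd => ⟨hb z hz hd, hb z hz hd⟩) (hV1 u1).1.1 (hV1 u1).2 (hV2 w1).1 (hV2 w1).2
  nlinarith

end Core
end Emb

namespace Emb
open MeasureTheory Pointwise in
lemma area {f : W → W} {f' : W → W →L[ℝ] W} (hd : ∀ x, HasFDerivAt f (f' x) x) {D : Set W}
    {c R : ℝ} (hc : 0 < c) (hDo : IsOpen D) (hDn : D.Nonempty) (h2 : ∀ p ∈ D, (2:ℝ) • p ∈ D)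
    (hinj : InjOn f D) (hb : ∀ p ∈ D, ‖f p‖ ≤ R) (hdet : ∀ p, c ≤ |detL (f' p)|) : False := by
  have e : ∀ L : W →L[ℝ] W, L.det = detL L := by
    intro L
    rw [ContinuousLinearMap.det, ← LinearMap.det_toMatrix (Module.Basis.finTwoProd ℝ),
      Matrix.det_fin_two]
    simp only [LinearMap.toMatrix_apply, detL, det2]
    simp
    ring
  have k := lintegral_abs_det_fderiv_eq_addHaar_image (volume : Measure W) hDo.measurableSet
    (fun x _ => (hd x).hasFDerivWithinAt) hinj
  have k1 : ENNReal.ofReal c * volume D ≤ volume (f '' D) := by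
    rw [← k, ← setLIntegral_const]
    refine lintegral_mono fun x => ENNReal.ofReal_le_ofReal ?_
    rw [e]; exact hdet x
  have k2 : volume (f '' D) < ⊤ := by
    refine lt_of_le_of_lt (measure_mono (t := closedBall (0:W) R) ?_)
      (isCompact_closedBall _ _).measure_lt_top
    rintro _ ⟨p, hp, rfl⟩
    rw [mem_closedBall_zero_iff]; exact hb p hp
  have k3 : volume D ≠ ⊤ := by
    intro h
    rw [h, ENNReal.mul_top (by simpa using hc)] at k1
    exact absurd k2 (not_lt.2 k1)
  have k4 : volume D ≠ 0 := (hDo.measure_pos volume hDn).ne'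
  have k5 : (2:ℝ) • D ⊆ D := by
    rintro _ ⟨p, hp, rfl⟩; exact h2 p hp
  have k6 := measure_mono (μ := (volume : Measure W)) k5
  rw [Measure.addHaar_smul] at k6
  have k7 : ENNReal.ofReal |(2:ℝ) ^ Module.finrank ℝ W| = 4 := by
    have : Module.finrank ℝ W = 2 := by simp [W]
    rw [this]; norm_num
  rw [k7] at k6
  have k8 := ENNReal.toReal_mono k3 k6
  rw [ENNReal.toReal_mul] at k8
  have := ENNReal.toReal_pos k4 k3
  norm_num at k8
  linarith

namespace Core
variable {f : W → W} {f' : W → W →L[ℝ] W} {ε : ℝ} {Ω : Set W} {G : W → W} {l r z0 : W}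

lemma det_bound (C : Core f f' ε Ω G) (h : detL (f' 0) < 0) (p : W) :
    ε ^ 2 / 4 ≤ |detL (f' p)| := by
  have hp := sign_const C.hd C.hi C.li h p
  have hε := C.εpos
  rw [abs_of_neg hp]
  set L := f' p
  set a := (L (1,0)).1 with ha
  set b := (L (1,0)).2 with hb
  set c := (L (0,1)).1 with hc
  set d := (L (0,1)).2 with hd
  have hD : detL L = a * d - b * c := rfl
  set q : ℝ → ℝ := fun t => (a - t) * (d - t) - b * c with hq
  have hLv : ∀ v : W, L v = (v.1 * a + v.2 * c, v.1 * b + v.2 * d) := by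
    intro v
    have : v = v.1 • ((1:ℝ),(0:ℝ)) + v.2 • ((0:ℝ),(1:ℝ)) := by ext <;> simp
    conv_lhs => rw [this]
    rw [map_add, map_smul, map_smul]
    ext <;> simp [ha, hb, hc, hd]
  have hne : ∀ t, |t| < ε → q t ≠ 0 := by
    intro t ht h0
    have h0 : (a - t) * (d - t) - b * c = 0 := h0
    have key : ∀ v : W, (a - t) * v.1 + c * v.2 = 0 → b * v.1 + (d - t) * v.2 = 0 → v = 0 := by
      intro v h1 h2
      refine C.hs p v t ht ?_
      change L v = t • v
      rw [hLv]
      ext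
      · simp; linarith
      · simp; linarith
    have v1 := key (c, -(a - t)) (by simp; ring) (by simp; linarith)
    have v2 := key (d - t, -b) (by simp; linarith) (by simp; ring)
    simp only [Prod.ext_iff, Prod.fst_zero, Prod.snd_zero] at v1 v2
    have v3 := key (1, 0) (by simp; linarith [v1.2]) (by simp; linarith [v2.2])
    simp [Prod.ext_iff] at v3
  have hqc : Continuous q := by fun_prop
  have hneg : ∀ t, |t| < ε → q t < 0 := by
    intro t ht
    have h1 := sign_on (S := ball (0:ℝ) ε) (convex_ball _ _).isPreconnected (g := q)
      hqc.continuousOn (fun x hx => hne x (by simpa using hx)) (a := 0) (b := t)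
      (mem_ball_self hε) (by simpa using ht) (c := -1)
      (by have : q 0 = detL L := by rw [hD]; simp [hq]
          rw [this]; linarith)
    linarith
  have t1 := hneg (ε / 2) (by rw [abs_of_pos (by linarith)]; linarith)
  have t2 := hneg (-(ε / 2)) (by rw [abs_neg, abs_of_pos (by linarith)]; linarith)
  simp only [hq] at t1 t2
  rw [hD]; nlinarith

set_option maxHeartbeats 1000000 in
lemma sector (C : Core f f' ε Ω G) (S : Sett Ω l r z0) {sa sb : ℝ} (hab : sa < sb)
    (hg : ∀ s, sa ≤ s → s ≤ sb → Good l r z0 s)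
    (hNG : ∀ s, sa ≤ s → s ≤ sb → ∀ P P' z, IsC Ω l r s P → IsC Ω l r s P' → z ∈ Ω →
      nn s z = nn s P → P.1 < z.1 → z.1 < P'.1 → False)
    (hneg : detL (f' 0) < 0) : False := by
  obtain ⟨M, hM0, hM⟩ := C.unifM S
  obtain ⟨R, hR0, hR⟩ := C.sides S
  set κ := (sb - sa) / 4 with hκ
  have hκ0 : 0 < κ := by rw [hκ]; linarith
  set R' := R + M / κ + 1
  have hR'R : R < R' := by have : 0 ≤ M / κ := by positivity
                           simp only [R']; linarith
  have hR'0 : 0 < R' := hR0.trans_lt hR'R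
  have hMR : M ≤ κ * R' := by
    have : κ * R' = κ * R + M + κ := by simp only [R']; field_simp
    rw [this]; nlinarith
  set N : Set W := {z | (0 < det2 r z ∧ 0 < det2 z l) ∧ ∃ s, sa < s ∧ s < sb ∧
    ∀ P, IsC Ω l r s P → nn s z < nn s P} with hN
  have hNcone : ∀ z ∈ N, z ∈ cone l r := fun z hz => ⟨hz.1.1.le, hz.1.2.le⟩
  have hNΩ : ∀ z ∈ N, z ∈ Ω := by
    rintro z ⟨h1, s, h2, h3, h4⟩
    obtain ⟨P, p⟩ := C.exC S (hg s h2.le h3.le)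
    exact (hM s (hg s h2.le h3.le) P p z ⟨h1.1.le, h1.2.le⟩ (h4 P p)).1
  have hNb : ∀ z ∈ N, ‖z‖ ≤ ‖l‖ + ‖r‖ := by
    rintro z ⟨h1, s, h2, h3, h4⟩
    obtain ⟨P, p⟩ := C.exC S (hg s h2.le h3.le)
    exact Cbd S (hg s h2.le h3.le) ⟨h1.1.le, h1.2.le⟩ ((h4 P p).le.trans (C.Cle S p))
  have hNo : IsOpen N := by
    rw [isOpen_iff_mem_nhds]
    rintro z ⟨h1, s, h2, h3, h4⟩
    obtain ⟨P, p⟩ := C.exC S (hg s h2.le h3.le)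
    have o1 : IsOpen {z | 0 < det2 r z} :=
      isOpen_lt continuous_const (det2_cont continuous_const continuous_id)
    have o2 : IsOpen {z | 0 < det2 z l} :=
      isOpen_lt continuous_const (det2_cont continuous_id continuous_const)
    have o3 : IsOpen {z | nn s z < nn s P} := isOpen_lt (nn s).continuous continuous_const
    filter_upwards [o1.mem_nhds h1.1, o2.mem_nhds h1.2, o3.mem_nhds (h4 P p)] with z' a b c
    exact ⟨⟨a, b⟩, s, h2, h3, fun P' p' => by rw [Ceq p' p]; exact c⟩
  have hAo : IsOpen (G '' N) := by
    rw [isOpen_iff_mem_nhds]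
    rintro _ ⟨z, hz, rfl⟩
    have h1 : ∀ᶠ p in 𝓝 (G z), f p ∈ N :=
      C.fcont.continuousAt (by rw [C.fG z (hNΩ z hz)]; exact hNo.mem_nhds hz)
    filter_upwards [h1, C.left_inv (hNΩ z hz)] with p a b
    exact ⟨f p, a, b.2⟩
  -- a first point
  set sc := sa + 2 * κ with hsc
  have hsc1 : sa < sc := by linarith
  have hsc2 : sc < sb := by linarith
  have gc := hg sc hsc1.le hsc2.le
  obtain ⟨P, p⟩ := C.exC S gc
  obtain ⟨ρ, hρ, hb⟩ := C.Cblow S gc p (M + (|sc| + 1) * R')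
  have hcont : Tendsto (fun τ : ℝ => τ • P) (𝓝[<] 1) (𝓝 P) := by
    have : Continuous fun τ : ℝ => τ • P := by fun_prop
    have h := this.tendsto 1
    rw [one_smul] at h
    exact h.mono_left nhdsWithin_le_nhds
  have e1 : ∀ᶠ τ : ℝ in 𝓝[<] 1, dist (τ • P) P < ρ := hcont (Metric.ball_mem_nhds P hρ)
  have e2 : ∀ᶠ τ : ℝ in 𝓝[<] 1, τ ∈ Ioo (0:ℝ) 1 := Ioo_mem_nhdsLT one_pos
  obtain ⟨T, hT1, hT2, hT3⟩ := (e1.and e2).exists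
  have rr := C.Cray S gc p hT2.le hT3
  have mm := (hM sc gc P p _ (cone_smul hT2.le p.mem) rr.1).2
  have hlarge := fst_large mm hR'0.le (hb _ rr.2 hT1)
  have hTN : T • P ∈ N := by
    refine ⟨?_, sc, hsc1, hsc2, fun P' p' => by rw [Ceq p' p]; exact rr.1⟩
    have i1 : det2 r (T • P) = T * det2 r P := by simp [det2]; ring
    have i2 : det2 (T • P) l = T * det2 P l := by simp [det2]; ring
    rw [i1, i2]
    have := C.Cint S gc p
    exact ⟨mul_pos hT2 this.1, mul_pos hT2 this.2⟩
  set p1 := G (T • P)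
  obtain ⟨ς, hς, hςp⟩ : ∃ ς : ℝ, (ς = 1 ∨ ς = -1) ∧ ς * p1.1 = |p1.1| := by
    rcases le_total 0 p1.1 with h | h
    · exact ⟨1, Or.inl rfl, by rw [abs_of_nonneg h, one_mul]⟩
    · exact ⟨-1, Or.inr rfl, by rw [abs_of_nonpos h]; ring⟩
  set D : Set W := {p | R' < ς * p.1 ∧ (sa + κ) * (ς * p.1) < -(ς * p.2) ∧
    -(ς * p.2) < (sb - κ) * (ς * p.1)} with hDdef
  have hς1 : |ς| = 1 := by rcases hς with rfl | rfl <;> norm_num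
  have nnς : ∀ (s : ℝ) (x : W), |nn s x| ≤ M → -M ≤ ς * x.2 + s * (ς * x.1) ∧
      ς * x.2 + s * (ς * x.1) ≤ M := by
    intro s x hx
    have : |ς * x.2 + s * (ς * x.1)| ≤ M := by
      have e : ς * x.2 + s * (ς * x.1) = ς * nn s x := by rw [nn_apply]; ring
      rw [e, abs_mul, hς1, one_mul]; exact hx
    exact abs_le.1 this
  have hDo : IsOpen D := by
    rw [hDdef]
    simp only [ofPred_and]
    refine IsOpen.inter (isOpen_lt ?_ ?_) (IsOpen.inter (isOpen_lt ?_ ?_) (isOpen_lt ?_ ?_)) <;>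
      fun_prop
  have hDc : Convex ℝ D := by
    rintro x ⟨x1, x2, x3⟩ y ⟨y1, y2, y3⟩ a b ha hb hab
    simp only [hDdef, Prod.fst_add, Prod.snd_add, Prod.smul_fst, Prod.smul_snd, smul_eq_mul,
      mem_ofPred_eq]
    have hconv : ∀ u v w t : ℝ, u < v → w < t → a * u + b * w < a * v + b * t := by
      intro u v w t huv hwt
      rcases ha.eq_or_lt with h | h
      · have : b = 1 := by linarith
        rw [← h, this]; linarith
      · nlinarith
    refine ⟨?_, ?_, ?_⟩
    · have := hconv _ _ _ _ x1 y1
      have e : a * R' + b * R' = R' := by rw [← add_mul, hab, one_mul]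
      linarith
    · have := hconv _ _ _ _ x2 y2; linarith
    · have := hconv _ _ _ _ x3 y3; linarith
  have hp1D : p1 ∈ D := by
    have h1 : R' < ς * p1.1 := by rw [hςp]; exact hlarge
    obtain ⟨m1, m2⟩ := nnς sc p1 mm
    have : κ * R' < κ * (ς * p1.1) := by nlinarith
    have e3 : sb = sa + 4 * κ := by rw [hκ]; ring
    refine ⟨h1, ?_, ?_⟩
    · rw [hsc] at m1 m2; nlinarith
    · rw [hsc] at m1 m2; rw [e3]; nlinarith
  have hsub : D ⊆ G '' N := by
    refine hDc.isPreconnected.subset_of_closure_inter_subset hAo ⟨p1, hp1D, _, hTN, rfl⟩ ?_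
    rintro q ⟨hq, hqD⟩
    obtain ⟨x, hx, hxq⟩ := mem_closure_iff_seq_limit.1 hq
    choose z hz hzx using hx
    have hzf : ∀ n, z n = f (x n) := fun n => by rw [← hzx n, C.fG _ (hNΩ _ (hz n))]
    have hzt : Tendsto z atTop (𝓝 (f q)) := by
      have : z = fun n => f (x n) := funext hzf
      rw [this]; exact (C.fcont.tendsto q).comp hxq
    have hz2 : ∀ n, ∃ s, sa < s ∧ s < sb ∧ ∀ P, IsC Ω l r s P → nn s (z n) < nn s P :=
      fun n => (hz n).2
    choose u hu1 hu2 hu3 using hz2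
    obtain ⟨ss, hss, φ, hφ, hus⟩ := (isCompact_Icc (a := sa) (b := sb)).tendsto_subseq
      (fun n => ⟨(hu1 n).le, (hu2 n).le⟩)
    have gs := hg ss hss.1 hss.2
    have hzt' := hzt.comp hφ.tendsto_atTop
    have hxq' := hxq.comp hφ.tendsto_atTop
    have hnn : ∀ (y : ℕ → W) (y0 : W), Tendsto (y ∘ φ) atTop (𝓝 y0) →
        Tendsto (fun n => nn (u (φ n)) (y (φ n))) atTop (𝓝 (nn ss y0)) := fun y y0 hy =>
      Tendsto.comp (g := fun x : ℝ × W => nn x.1 x.2) (f := fun n => (u (φ n), y (φ n)))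
        (nn_cont.tendsto (ss, y0)) (Tendsto.prodMk_nhds hus hy)
    -- bound for q
    have hqM : |nn ss q| ≤ M := by
      refine le_of_tendsto (hnn x q hxq').abs (Eventually.of_forall fun n => ?_)
      obtain ⟨P, p⟩ := C.exC S (hg _ (hu1 (φ n)).le (hu2 (φ n)).le)
      have := (hM _ (hg _ (hu1 (φ n)).le (hu2 (φ n)).le) P p _ (hNcone _ (hz (φ n)))
        (hu3 (φ n) P p)).2
      rwa [hzx] at this
    obtain ⟨m1, m2⟩ := nnς ss q hqM
    obtain ⟨d1, d2, d3⟩ := hqD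
    have hκq : κ * R' < κ * (ς * q.1) := by nlinarith
    have hς0 : 0 < ς * q.1 := hR'0.trans d1
    have hss1 : sa < ss := by
      by_contra! hcon
      nlinarith
    have hss2 : ss < sb := by
      by_contra! hcon
      nlinarith
    set zs := f q with hzs
    have hzsc : zs ∈ cone l r :=
      (cone_closed l r).mem_of_tendsto hzt (Eventually.of_forall fun n => hNcone _ (hz n))
    have hzsP : ∀ P, IsC Ω l r ss P → nn ss zs ≤ nn ss P := by
      intro P p
      refine le_of_tendsto_of_tendsto' (hnn z zs hzt') (hnn (fun _ => P) P tendsto_const_nhds) ?_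
      intro n
      obtain ⟨Q, hQ⟩ := C.exC S (hg _ (hu1 (φ n)).le (hu2 (φ n)).le)
      exact (hu3 (φ n) Q hQ).le.trans (hQ.min _ p.mem p.nmem)
    obtain ⟨P2, p2⟩ := C.exC S gs
    have hzsΩ : zs ∈ Ω := by
      by_contra hn
      have pz : IsC Ω l r ss zs :=
        ⟨hzsc, hn, fun y hy hy' => (hzsP P2 p2).trans (p2.min y hy hy')⟩
      obtain ⟨ρ2, hρ2, hb2⟩ := C.Cblow S gs pz (‖q‖ + 1)
      have ev1 : ∀ᶠ n in atTop, dist (z n) zs < ρ2 := hzt (Metric.ball_mem_nhds _ hρ2)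
      have ev2 : ∀ᶠ n in atTop, ‖x n‖ < ‖q‖ + 1 := hxq.norm.eventually_lt_const (by linarith)
      obtain ⟨n, n1, n2⟩ := (ev1.and ev2).exists
      have := hb2 _ (hNΩ _ (hz n)) n1
      rw [hzx n] at this
      linarith
    have hGzs : G zs = q := by
      refine tendsto_nhds_unique ((C.contAt hzsΩ).tendsto.comp hzt) ?_
      have : G ∘ z = x := funext hzx
      rw [this]; exact hxq
    refine ⟨zs, ?_, hGzs⟩
    have hlev : nn ss zs ≤ nn ss z0 := (hzsP P2 p2).trans (C.Cle S p2)
    have hint : 0 < det2 r zs ∧ 0 < det2 zs l := by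
      by_contra! h
      have hor : det2 r zs = 0 ∨ det2 zs l = 0 := by
        rcases hzsc.1.lt_or_eq with h1 | h1
        · exact Or.inr (le_antisymm (h h1) hzsc.2)
        · exact Or.inl h1.symm
      have hq1 : ς * q.1 ≤ ‖q‖ := by
        have i1 := le_abs_self (ς * q.1)
        rw [abs_mul, hς1, one_mul] at i1
        exact i1.trans (norm_fst_le q)
      obtain ⟨τ, t0, t1, h | h⟩ := C.Cside S gs hzsc hlev hor
      · have := (hR τ t0 t1).1
        rw [← h, hGzs] at this; linarith
      · have := (hR τ t0 t1).2
        rw [← h, hGzs] at this; linarith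
    refine ⟨hint, ?_⟩
    rcases (hzsP P2 p2).lt_or_eq with hlt | heq
    · exact ⟨ss, hss1, hss2, fun P p => by rw [Ceq p p2]; exact hlt⟩
    · have hne : ∀ P, IsC Ω l r ss P → P.1 ≠ zs.1 := by
        intro P p he
        have := eq_of_nn ((Ceq p p2).trans heq.symm) he
        exact p.nmem (this ▸ hzsΩ)
      by_cases hall : ∀ P, IsC Ω l r ss P → zs.1 < P.1
      · have ev := C.Cupper S gs (U := {y | zs.1 < y.1})
          (isOpen_lt continuous_const continuous_fst) hall
        obtain ⟨s, hs1, hs2, hs3⟩ := ((ev.filter_mono nhdsWithin_le_nhds).and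
          (Ioo_mem_nhdsGT hss2)).exists
        refine ⟨s, hss1.trans hs2, hs3, fun P p => ?_⟩
        have k1 : zs.1 < P.1 := hs1 P p
        have k2 := p2.min _ p.mem p.nmem
        rw [← heq] at k2
        rw [nn_apply, nn_apply] at k2 ⊢
        nlinarith
      · push Not at hall
        obtain ⟨P3, p3, h3⟩ := hall
        have h3' : P3.1 < zs.1 := h3.lt_of_ne (hne P3 p3)
        have hall2 : ∀ P, IsC Ω l r ss P → P.1 < zs.1 := by
          intro P p
          by_contra! h4
          exact hNG ss hss.1 hss.2 P3 P zs p3 p hzsΩ (heq.trans (Ceq p2 p3)) h3'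
            (h4.lt_of_ne (hne P p).symm)
        have ev := C.Cupper S gs (U := {y | y.1 < zs.1})
          (isOpen_lt continuous_fst continuous_const) hall2
        obtain ⟨s, hs1, hs2, hs3⟩ := ((ev.filter_mono nhdsWithin_le_nhds).and
          (Ioo_mem_nhdsLT hss1)).exists
        refine ⟨s, hs2, hs3.trans hss2, fun P p => ?_⟩
        have k1 : P.1 < zs.1 := hs1 P p
        have k2 := p2.min _ p.mem p.nmem
        rw [← heq] at k2
        rw [nn_apply, nn_apply] at k2 ⊢
        nlinarith
  have hGf : ∀ q ∈ D, f q ∈ N ∧ G (f q) = q := by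
    intro q hq
    obtain ⟨z, hz, rfl⟩ := hsub hq
    rw [C.fG z (hNΩ z hz)]; exact ⟨hz, rfl⟩
  refine area C.hd (c := ε ^ 2 / 4) (by have := C.εpos; positivity) hDo ⟨p1, hp1D⟩ ?_ ?_
    (fun q hq => hNb _ (hGf q hq).1) (C.det_bound hneg)
  · rintro q ⟨d1, d2, d3⟩
    refine ⟨?_, ?_, ?_⟩
    · simp; nlinarith
    · simp; nlinarith
    · simp; nlinarith
  · intro a ha b hb hab
    rw [← (hGf a ha).2, hab, (hGf b hb).2]

lemma final (C : Core f f' ε Ω G) (S : Sett Ω l r z0) (g : Good l r z0 0) : False := by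
  obtain ⟨M, hM0, hM⟩ := C.unifM S
  obtain ⟨P0, p0, hmin⟩ := C.Cmin S g
  obtain ⟨r0, hr0, hb⟩ := C.Cblow S g p0 M
  have ev := (C.Cright S g p0 hmin isOpen_ball (mem_ball_self hr0)).and
    ((good_nhds g).filter_mono nhdsWithin_le_nhds)
  obtain ⟨δ, hδ, hsub⟩ := mem_nhdsGT_iff_exists_Ioo_subset.1 ev
  have hδ : 0 < δ := hδ
  have hI : ∀ s, δ / 3 ≤ s → s ≤ 2 * δ / 3 → s ∈ Ioo 0 δ := fun s h h' =>
    ⟨by linarith, by linarith⟩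
  refine C.sector S (sa := δ / 3) (sb := 2 * δ / 3) (by linarith)
    (fun s h h' => (hsub (hI s h h')).2) ?_ (C.reg S g)
  intro s h h' P P' z p p' hz e h1 h2
  exact C.nogap S hM hb (hsub (hI s h h')).2 (hsub (hI s h h')).1 p p' hz e h1 h2
end Core
end Emb

namespace Emb
lemma inj_lin {L : W →L[ℝ] W} (h : ∀ v, L v = (0:ℝ) • v → v = 0) : Injective L := by
  intro a b hab
  have : a - b = 0 := h _ (by rw [map_sub, hab]; simp)
  exact sub_eq_zero.mp this

lemma hcore (f : W → W) (f' : W → W →L[ℝ] W) (ε x3 : ℝ) (hε : 0 < ε)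
    (hd : ∀ x, HasFDerivAt f (f' x) x)
    (hs : ∀ (p v : W) (t : ℝ), |t| < ε → f' p v = t • v → v = 0) (f0 : f 0 = 0)
    (hx : |x3| ≤ 1) (hl : (-1, 1) ∈ Om f univ 0) (hr : (1, 1) ∈ Om f univ 0)
    (h3 : (x3, 1) ∉ Om f univ 0) : False := by
  have hi : ∀ x, Injective (f' x) := fun x => inj_lin fun v hv => hs x v 0 (by simpa using hε) hv
  have li := locInj hd hi
  have ho := isOpenMap_of hd hi
  have hc : Continuous f := continuous_iff_continuousAt.2 fun x => (hd x).continuousAt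
  have C : Core f f' ε (Om f univ 0) (Gs f univ 0) := by
    refine ⟨hε, hd, hs, f0, Om_open, ?_, ?_, Gs_cont li, fun z hz => f_Gs li hz, ?_, li, ?_⟩
    · have := Om_base ho isOpen_univ li (mem_univ (0:W)); rwa [f0] at this
    · intro z hz t h h'
      have := Om_star (f := f) (E := univ) (p := 0) hz (sub_nonneg.2 h') h (by ring)
      simpa [f0] using this
    · have := Gs_base ho isOpen_univ li (mem_univ (0:W)); rwa [f0] at this
    · intro zs hz hseg M
      refine blowup hc ho li (fun t h h' => ?_) hz M
      have := hseg t h h'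
      simpa [f0, AffineMap.lineMap_apply] using this
  have key : ∀ z : W, z ∈ Om f univ 0 → ∀ᶠ η in 𝓝[>] (0:ℝ), (1+η) • z ∈ Om f univ 0 := by
    intro z hz
    have hcz : Continuous fun η : ℝ => (1+η) • z := by fun_prop
    have : (fun η : ℝ => (1+η) • z) ⁻¹' (Om f univ 0) ∈ 𝓝 (0:ℝ) :=
      (Om_open.preimage hcz).mem_nhds (by simpa using hz)
    exact nhdsWithin_le_nhds this
  obtain ⟨η, ⟨h1, h2⟩, hη⟩ := (((key _ hl).and (key _ hr)).and self_mem_nhdsWithin).exists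
  have hη : 0 < η := hη
  obtain ⟨ha, hb⟩ := abs_le.1 hx
  refine C.final (l := (1+η) • ((-1,1):W)) (r := (1+η) • ((1,1):W)) (z0 := (x3,1))
    ⟨?_, h1, h2, ⟨?_, ?_⟩, h3⟩ ⟨by simp, ?_, ?_, ?_, ?_⟩
  · simp [det2]; nlinarith
  · simp [det2]; nlinarith
  · simp [det2]; nlinarith
  all_goals simp [nn]; try linarith

lemma injA {f : W → W} {f' : W → W →L[ℝ] W} {ε : ℝ} (hε : 0 < ε)
    (hd : ∀ x, HasFDerivAt f (f' x) x)
    (hs : ∀ (p v : W) (t : ℝ), |t| < ε → f' p v = t • v → v = 0) : Injective f :=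
  inj_of_core hcore hε hd hs

lemma injB {f : W → W} {f' : W → W →L[ℝ] W} {ε : ℝ} (hε : 0 < ε)
    (hd : ∀ x, HasFDerivAt f (f' x) x)
    (hs : ∀ (p v : W) (t : ℝ), 0 ≤ t → t < ε → f' p v = t • v → v = 0) : Injective f := by
  have hi : ∀ x, Injective (f' x) := fun x => inj_lin fun v hv => hs x v 0 le_rfl hε hv
  set F : ℝ → W → W := fun t x => f x - t • x with hF
  set F' : ℝ → W → W →L[ℝ] W := fun t x => f' x - t • ContinuousLinearMap.id ℝ W with hF'
  have hFd : ∀ t x, HasFDerivAt (F t) (F' t x) x := by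
    intro t x
    exact (hd x).sub ((hasFDerivAt_id x).const_smul t)
  have hFs : ∀ t, 0 < t → t < ε → ∀ (p v : W) (s : ℝ), |s| < min t (ε-t) → F' t p v = s • v → v = 0 := by
    intro t h h' p v s hsm hv
    rw [lt_min_iff, abs_lt, abs_lt] at hsm
    refine hs p v (s+t) (by linarith) (by linarith) ?_
    have : f' p v - t • v = s • v := by simpa [hF'] using hv
    rw [add_smul, ← this]; abel
  have hFi : ∀ t, 0 < t → t < ε → Injective (F t) := fun t h h' =>
    injA (lt_min h (sub_pos.2 h')) (hFd t) (hFs t h h')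
  intro a b hab
  by_contra hne
  obtain ⟨c, hc, ρ, hρ, hlow⟩ := lower_bound (hd a) (hi a)
  have hnab : 0 < ‖b - a‖ := norm_pos_iff.2 (sub_ne_zero.2 (Ne.symm hne))
  obtain ⟨r, hr0, hr⟩ : ∃ r, 0 < r ∧ r < min ρ ‖b - a‖ := exists_between (lt_min hρ hnab)
  obtain ⟨hr1, hr2⟩ := lt_min_iff.1 hr
  have hbd : ∀ x ∈ sphere a r, (c*r)^2 ≤ e (f x - f a) := by
    intro x hx
    rw [mem_sphere, dist_eq_norm] at hx
    have := hlow x (by rw [hx]; exact hr1)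
    rw [hx] at this
    exact le_trans (pow_le_pow_left₀ (by positivity) this 2) (norm_sq_le_e _)
  have hesm : ∀ (t : ℝ) (u : W), e (t • u) = t^2 * e u := by
    intro t u; simp [e]; ring
  have hm : 0 < (c*r)^2 := by positivity
  set B : ℝ := 2 * r^2 + e (b-a) with hB
  have hen : ∀ u, 0 ≤ e u := fun u => (sq_nonneg _).trans (norm_sq_le_e u)
  -- small t
  have : Tendsto (fun t : ℝ => 20 * t^2 * B) (𝓝[>] 0) (𝓝 0) := by
    have hcont : Continuous fun t : ℝ => 20 * t^2 * B := by fun_prop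
    have := hcont.tendsto 0
    simp at this
    exact this.mono_left nhdsWithin_le_nhds
  have h1 : ∀ᶠ t in 𝓝[>] (0:ℝ), 20 * t^2 * B < (c*r)^2 := this.eventually (gt_mem_nhds hm)
  have h2 : ∀ᶠ t in 𝓝[>] (0:ℝ), t < ε := Eventually.filter_mono nhdsWithin_le_nhds (gt_mem_nhds hε)
  obtain ⟨t, ⟨ht1, ht2⟩, ht0⟩ := ((h1.and h2).and self_mem_nhdsWithin).exists
  have ht0 : 0 < t := ht0
  have hFL : ∀ x, Injective (F' t x) := fun x => inj_lin fun v hv =>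
    hFs t ht0 ht2 x v 0 (by simpa using ⟨ht0, ht2⟩) hv
  have htB : t^2 * B = 2 * (t^2*r^2) + t^2 * e (b-a) := by rw [hB]; ring
  have hp1 : 0 ≤ t^2*r^2 := by positivity
  have hp2 : 0 ≤ t^2 * e (b-a) := mul_nonneg (by positivity) (hen _)
  obtain ⟨x, hx, hxb⟩ := open_aux (hFd t) hFL (a := a) (r := r) (m := (c*r)^2/4) hr0 (by
      intro x hx
      have e1 := hbd x hx
      have e2 := e_add (F t x - F t a) (t • (x - a))
      have e3 : F t x - F t a + t • (x - a) = f x - f a := by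
        simp only [hF, smul_sub]; abel
      rw [e3, hesm] at e2
      have e4 := e_le_norm_sq (x - a)
      rw [mem_sphere, dist_eq_norm] at hx
      rw [hx] at e4
      have e5 := mul_le_mul_of_nonneg_left e4 (sq_nonneg t)
      nlinarith) (y := F t b) (by
      have e3 : F t b - F t a = -(t • (b - a)) := by
        simp only [hF, smul_sub, hab]; abel
      rw [e3, e_neg, hesm]
      nlinarith)
  have := hFi t ht0 ht2 hxb
  subst this
  rw [mem_ball, dist_eq_norm] at hx
  linarith
end Emb

namespace Emb
lemma eig {L : Plane →L[ℝ] Plane} {t : ℝ} {v : Plane} (hv : v ≠ 0) (h : L v = t • v) :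
    IsEigenvalueCLM L (t : ℂ) := by
  unfold IsEigenvalueCLM
  have hev : Module.End.HasEigenvalue (L.toLinearMap : Module.End ℝ Plane) t :=
    Module.End.hasEigenvalue_of_hasEigenvector (x := v)
      ⟨Module.End.mem_eigenspace_iff.2 h, hv⟩
  have hr := Module.End.hasEigenvalue_iff_isRoot_charpoly _ _ |>.1 hev
  rw [← LinearMap.charpoly_toMatrix L.toLinearMap (EuclideanSpace.basisFun (Fin 2) ℝ).toBasis] at hr
  rw [Matrix.charpoly_map]
  exact hr.map (f := algebraMap ℝ ℂ)

lemma injP {f : Plane → Plane} {f' : Plane → Plane →L[ℝ] Plane} {ε : ℝ} (hε : 0 < ε)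
    (hd : ∀ x, HasFDerivAt f (f' x) x)
    (hs : ∀ (p v : Plane) (t : ℝ), 0 ≤ t → t < ε → f' p v = t • v → v = 0) :
    Injective f ∧ IsOpenMap f := by
  have φ : Plane ≃L[ℝ] W := ContinuousLinearEquiv.ofFinrankEq (by simp)
  set g : W → W := fun x => φ (f (φ.symm x)) with hg
  set g' : W → W →L[ℝ] W := fun x =>
    (φ : Plane →L[ℝ] W).comp ((f' (φ.symm x)).comp (φ.symm : W →L[ℝ] Plane)) with hg'
  have hgd : ∀ x, HasFDerivAt g (g' x) x := by
    intro x
    exact φ.hasFDerivAt.comp x ((hd (φ.symm x)).comp x φ.symm.hasFDerivAt)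
  have hgs : ∀ (p v : W) (t : ℝ), 0 ≤ t → t < ε → g' p v = t • v → v = 0 := by
    intro p v t h1 h2 hv
    have : φ.symm v = 0 := by
      refine hs (φ.symm p) _ t h1 h2 (φ.injective ?_)
      simpa [hg'] using hv
    simpa using this
  have hgi := injB hε hgd hgs
  have hgo := isOpenMap_of hgd fun x => inj_lin fun v hv => hgs x v 0 le_rfl hε hv
  have hfg : f = φ.symm ∘ g ∘ φ := by funext x; simp [hg]
  rw [hfg]
  exact ⟨φ.symm.injective.comp (hgi.comp φ.injective),
    φ.symm.isOpenMap.comp (hgo.comp φ.isOpenMap)⟩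
end Emb

/-- A differentiable map of the plane fixing the origin with
`Spec(f) ∩ ([1, 1+ε) ∪ [0, ε)) = ∅` is a topological embedding with `Fix(f) = {0}`. -/
theorem stmt9 (f : Plane → Plane) (Df : Plane → Plane →L[ℝ] Plane)
    (hdiff : ∀ p : Plane, HasFDerivAt f (Df p) p)
    (h0 : f 0 = 0)
    (ε : ℝ) (hε : 0 < ε)
    (hspec : spec Df ∩ (Complex.ofReal '' (Ico (1 : ℝ) (1 + ε) ∪ Ico (0 : ℝ) ε)) = ∅) :
    Topology.IsEmbedding f ∧ {p : Plane | f p = p} = {0} := by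
  have hs : ∀ (p v : Plane) (t : ℝ), t ∈ Ico (1 : ℝ) (1 + ε) ∪ Ico (0 : ℝ) ε →
      Df p v = t • v → v = 0 := by
    intro p v t ht hv
    by_contra hne
    have : (t : ℂ) ∈ spec Df ∩ (Complex.ofReal '' (Ico (1 : ℝ) (1 + ε) ∪ Ico (0 : ℝ) ε)) :=
      ⟨⟨p, Emb.eig hne hv⟩, t, ht, rfl⟩
    rw [hspec] at this
    exact this
  obtain ⟨hi, ho⟩ := Emb.injP hε hdiff fun p v t h1 h2 => hs p v t (Or.inr ⟨h1, h2⟩)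
  have hc : Continuous f := continuous_iff_continuousAt.2 fun x => (hdiff x).continuousAt
  refine ⟨(IsOpenEmbedding.of_continuous_injective_isOpenMap hc hi ho).isEmbedding, ?_⟩
  obtain ⟨hi2, -⟩ := Emb.injP (f := fun x => f x - x)
    (f' := fun x => Df x - ContinuousLinearMap.id ℝ Plane) hε
    (fun x => (hdiff x).sub (hasFDerivAt_id x)) (by
      intro p v t h1 h2 hv
      refine hs p v (1 + t) (Or.inl ⟨by linarith, by linarith⟩) ?_
      have : Df p v - v = t • v := by simpa using hv
      rw [add_smul, one_smul, ← this]; abel)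
  ext p
  constructor
  · intro hp
    have hp : f p = p := hp
    exact hi2 (by simp [hp, h0])
  · intro hp
    have hp : p = 0 := hp
    subst hp
    exact h0
end
end

section
/- There exists a C^∞ diffeomorphism f : ℝ² → ℝ² satisfying: (1) f(0) = 0; (2) every complex eigenvalue of the Jacobian derivative Df_q, for every q ∈ ℝ², has modulus strictly less than 1 (i.e., Spec(f) ⊂ B(0,1)); (3) f has a periodic point of minimal period four, i.e., there is p ∈ ℝ² with f⁴(p) = p and f^k(p) ≠ p for k = 1, 2, 3; and (4) there exists R > 0 such that ‖f(q)‖ ≤ ‖q‖/2 for all q with ‖q‖ ≥ R (so that ∞ is a repellor for f). -/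
open Topology Filter Metric Set Function

noncomputable section

def WW (q : Plane) : ℝ := (√(1 + q 0 ^ 2 + q 1 ^ 2))⁻¹

def FF (q : Plane) : Plane :=
  !₂[-((1/25) * q 1 + (5/2) * (q 1 * WW q) ^ 3), (1/25) * q 0 + (5/2) * (q 0 * WW q) ^ 3]

lemma WW_pos (q : Plane) : 0 < WW q := by
  unfold WW; positivity

lemma WW_sq (q : Plane) : WW q ^ 2 * (1 + q 0 ^ 2 + q 1 ^ 2) = 1 := by
  unfold WW
  have h : 0 < 1 + q 0 ^ 2 + q 1 ^ 2 := by positivity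
  rw [inv_pow, Real.sq_sqrt h.le, inv_mul_cancel₀ h.ne']

lemma WW_rel (q : Plane) : (q 0 * WW q) ^ 2 + (q 1 * WW q) ^ 2 = 1 - WW q ^ 2 := by
  linear_combination WW_sq q

lemma WW_contDiff : ContDiff ℝ (⊤ : ℕ∞) WW := by
  unfold WW
  have h : ∀ q : Plane, 1 + q 0 ^ 2 + q 1 ^ 2 ≠ 0 := fun q => by positivity
  refine ContDiff.inv (ContDiff.sqrt (by fun_prop) h) (fun q => by positivity)

lemma FF_contDiff : ContDiff ℝ (⊤ : ℕ∞) FF := by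
  unfold FF
  have h := WW_contDiff
  rw [contDiff_euclidean]
  intro i
  fin_cases i <;> simp <;> fun_prop

lemma FF_0 (q : Plane) : FF q 0 = -((1/25) * q 1 + (5/2) * (q 1 * WW q) ^ 3) := by simp [FF]
lemma FF_1 (q : Plane) : FF q 1 = (1/25) * q 0 + (5/2) * (q 0 * WW q) ^ 3 := by simp [FF]

lemma WW_deriv (q v : Plane) :
    HasDerivAt (fun t : ℝ => WW (q + t • v)) (-(q 0 * v 0 + q 1 * v 1) * WW q ^ 3) 0 := by
  unfold WW
  have h0 : HasDerivAt (fun t : ℝ => q 0 + t * v 0) (v 0) 0 := by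
    simpa using ((hasDerivAt_id (0:ℝ)).mul_const (v 0)).const_add (q 0)
  have h1 : HasDerivAt (fun t : ℝ => q 1 + t * v 1) (v 1) 0 := by
    simpa using ((hasDerivAt_id (0:ℝ)).mul_const (v 1)).const_add (q 1)
  have hp : 0 < 1 + q 0 ^ 2 + q 1 ^ 2 := by positivity
  have h2 := (((h0.pow 2).const_add 1).add (h1.pow 2)).sqrt (by simpa using hp.ne')
  have h3 := h2.inv (by simpa using (Real.sqrt_pos.2 hp).ne')
  have hs := Real.sqrt_pos.2 hp
  refine h3.congr_deriv ?_
  simp only [zero_mul, add_zero, Pi.add_apply, Pi.pow_apply]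
  field_simp
  ring

lemma FF_deriv (q v : Plane) :
    (fderiv ℝ FF q v) 0 = -((1/25) * v 1 + (5/2) * (3 * (q 1 * WW q) ^ 2 *
      (v 1 * WW q + q 1 * (-(q 0 * v 0 + q 1 * v 1) * WW q ^ 3)))) ∧
    (fderiv ℝ FF q v) 1 = (1/25) * v 0 + (5/2) * (3 * (q 0 * WW q) ^ 2 *
      (v 0 * WW q + q 0 * (-(q 0 * v 0 + q 1 * v 1) * WW q ^ 3))) := by
  have hd : HasFDerivAt FF (fderiv ℝ FF q) q :=
    (FF_contDiff.differentiable (by simp) q).hasFDerivAt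
  have hl : HasDerivAt (fun t : ℝ => q + t • v) v 0 := by
    simpa using ((hasDerivAt_id (0:ℝ)).smul_const v).const_add q
  have hc : HasDerivAt (fun t : ℝ => FF (q + t • v)) (fderiv ℝ FF q v) 0 := by
    have hd' : HasFDerivAt FF (fderiv ℝ FF q) (q + (0:ℝ) • v) := by simpa using hd
    exact hd'.comp_hasDerivAt (0:ℝ) hl
  have hw := WW_deriv q v
  have h0 : HasDerivAt (fun t : ℝ => q 0 + t * v 0) (v 0) 0 := by
    simpa using ((hasDerivAt_id (0:ℝ)).mul_const (v 0)).const_add (q 0)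
  have h1 : HasDerivAt (fun t : ℝ => q 1 + t * v 1) (v 1) 0 := by
    simpa using ((hasDerivAt_id (0:ℝ)).mul_const (v 1)).const_add (q 1)
  have hpi : ∀ i, HasDerivAt (fun t : ℝ => FF (q + t • v) i) ((fderiv ℝ FF q v) i) 0 := by
    intro i
    exact ((EuclideanSpace.proj i : Plane →L[ℝ] ℝ).hasFDerivAt.comp_hasDerivAt
      (0:ℝ) hc)
  constructor
  · refine (hpi 0).unique ?_
    have := ((h1.const_mul (1/25)).add (((h1.mul hw).pow 3).const_mul (5/2))).neg
    convert this using 1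
    · ext t; simp [FF_0]
    · simp
  · refine (hpi 1).unique ?_
    have := ((h0.const_mul (1/25)).add (((h0.mul hw).pow 3).const_mul (5/2)))
    convert this using 1
    · ext t; simp [FF_1]
    · simp

/-- explicit matrix -/
def MM (q : Plane) : Matrix (Fin 2) (Fin 2) ℝ :=
  LinearMap.toMatrix (EuclideanSpace.basisFun (Fin 2) ℝ).toBasis
      (EuclideanSpace.basisFun (Fin 2) ℝ).toBasis (fderiv ℝ FF q).toLinearMap

lemma MM_apply (q : Plane) (i j : Fin 2) :
    MM q i j = (fderiv ℝ FF q (EuclideanSpace.single j 1)) i := by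
  simp [MM, LinearMap.toMatrix_apply]

lemma MM_trace (q : Plane) : (MM q).trace =
    15/2 * (q 0 * WW q) * (q 1 * WW q) * WW q * ((q 1 * WW q)^2 - (q 0 * WW q)^2) := by
  rw [Matrix.trace_fin_two, MM_apply, MM_apply, (FF_deriv q _).1, (FF_deriv q _).2]
  simp
  ring

lemma MM_det (q : Plane) : (MM q).det =
    1/625 + 3/10 * WW q * ((q 0 * WW q)^2 * (1 - (q 0 * WW q)^2)
      + (q 1 * WW q)^2 * (1 - (q 1 * WW q)^2))
      + 225/4 * (q 0 * WW q)^2 * (q 1 * WW q)^2 * WW q ^ 4 := by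
  rw [Matrix.det_fin_two]
  simp only [MM_apply, (FF_deriv q _).1, (FF_deriv q _).2]
  simp
  have h := WW_rel q
  have : WW q ^ 4 = WW q ^ 2 * (1 - (q 0 * WW q) ^ 2 - (q 1 * WW q) ^ 2) := by
    rw [show 1 - (q 0 * WW q) ^ 2 - (q 1 * WW q) ^ 2 = WW q ^ 2 by linarith]; ring
  rw [this]
  ring

lemma num_bounds (X Y W : ℝ) (hW : 0 < W) (h : X^2 + Y^2 = 1 - W^2) :
    (0 < 1/625 + 3/10 * W * (X^2 * (1 - X^2) + Y^2 * (1 - Y^2)) + 225/4 * X^2 * Y^2 * W ^ 4) ∧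
    (1/625 + 3/10 * W * (X^2 * (1 - X^2) + Y^2 * (1 - Y^2)) + 225/4 * X^2 * Y^2 * W ^ 4 < 1) ∧
    |15/2 * X * Y * W * (Y^2 - X^2)| < 1 := by
  have hX : 0 ≤ 1 - X^2 := by nlinarith [sq_nonneg Y]
  have hY : 0 ≤ 1 - Y^2 := by nlinarith [sq_nonneg X]
  have hW1 : W ≤ 1 := by nlinarith [sq_nonneg X, sq_nonneg Y]
  refine ⟨by positivity, ?_, ?_⟩
  · have h1 : X^2 * Y^2 ≤ (1 - W^2)^2 / 4 := by
      rw [← h]; nlinarith [sq_nonneg (X^2 - Y^2)]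
    have h2 : X^2 * (1 - X^2) + Y^2 * (1 - Y^2) ≤ 1 - W^2 := by
      nlinarith [sq_nonneg (X^2), sq_nonneg (Y^2)]
    have h3 : W * (1 - W^2) ≤ 386/1000 := by
      nlinarith [mul_nonneg hW.le (sq_nonneg (W - 577/1000)), sq_nonneg (W - 577/1000)]
    have h4 : W^2 * (1 - W^2) ≤ 1/4 := by nlinarith [sq_nonneg (W^2 - 1/2)]
    have h4' : 0 ≤ W^2 * (1 - W^2) := by
      rw [← h]; positivity
    have h5 : (W^2 * (1 - W^2))^2 ≤ 1/16 := by nlinarith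
    have h6 : X^2 * Y^2 * W^4 ≤ 1/64 := by
      calc X^2 * Y^2 * W^4 ≤ (1 - W^2)^2 / 4 * W^4 := by gcongr
        _ = (W^2 * (1 - W^2))^2 / 4 := by ring
        _ ≤ 1/64 := by linarith
    have h7 : W * (X^2 * (1 - X^2) + Y^2 * (1 - Y^2)) ≤ W * (1 - W^2) := by gcongr
    nlinarith
  · have h1 : |X * Y * (Y^2 - X^2)| ≤ (1 - W^2)^2 / 4 := by
      rw [← h, abs_le]
      constructor <;> nlinarith [sq_nonneg (2*X*Y - (Y^2 - X^2)), sq_nonneg (2*X*Y + (Y^2 - X^2))]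
    have h0 : 0 ≤ 1 - W^2 := by rw [← h]; positivity
    have h3 : W * (1 - W^2) ≤ 386/1000 := by
      nlinarith [mul_nonneg hW.le (sq_nonneg (W - 577/1000)), sq_nonneg (W - 577/1000)]
    have e : |15/2 * X * Y * W * (Y^2 - X^2)| = 15/2 * W * |X * Y * (Y^2 - X^2)| := by
      rw [show 15/2 * X * Y * W * (Y^2 - X^2) = (15/2 * W) * (X * Y * (Y^2 - X^2)) by ring,
        abs_mul, abs_of_pos (by positivity)]
    rw [e]
    have h4 : 15/2 * W * |X * Y * (Y^2 - X^2)| ≤ 15/2 * W * ((1 - W^2)^2 / 4) := by gcongr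
    have h5 : W * (1 - W^2)^2 ≤ W * (1 - W^2) := by
      have : (1 - W^2)^2 ≤ 1 - W^2 := by nlinarith [sq_nonneg W]
      gcongr
    linarith

lemma root_bound (T D : ℝ) (hD : 0 < D) (hD1 : D < 1) (hT : |T| < 1) (z : ℂ)
    (hz : z ^ 2 - (T : ℂ) * z + D = 0) : ‖z‖ < 1 := by
  have hre := congrArg Complex.re hz
  have him := congrArg Complex.im hz
  simp [pow_two] at hre him
  have hn : ‖z‖ ^ 2 = z.re ^ 2 + z.im ^ 2 := by
    rw [← Complex.normSq_eq_norm_sq, Complex.normSq_apply]; ring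
  suffices z.re ^ 2 + z.im ^ 2 < 1 by nlinarith [norm_nonneg z]
  have hb : z.im * (2 * z.re - T) = 0 := by linarith
  obtain ⟨h1, h2⟩ := abs_lt.1 hT
  rcases mul_eq_zero.1 hb with h | h
  · rw [h] at hre ⊢
    by_contra! hc
    have : 1 ≤ |z.re| := by
      by_contra! h'
      nlinarith [sq_abs z.re, abs_nonneg z.re]
    have h3 : T * z.re ≤ |T| * |z.re| := by rw [← abs_mul]; exact le_abs_self _
    nlinarith [sq_abs z.re, abs_nonneg T]
  · have : T = 2 * z.re := by linarith
    rw [this] at hre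
    nlinarith

lemma FF_inj : Function.Injective FF := by
  have key : ∀ c d k t u : ℝ, 0 < c → c ≤ d → 0 < k →
      c * t + k * t^3 = d * u + k * u^3 → u^2 ≤ t^2 := by
    intro c d k t u hc hcd hk h
    by_contra! hlt
    have h1 : (c * t + k * t^3)^2 = t^2 * (c + k * t^2)^2 := by ring
    have h2 : (d * u + k * u^3)^2 = u^2 * (d + k * u^2)^2 := by ring
    have h3 : c + k * t^2 ≤ d + k * u^2 := by nlinarith
    have h4 : 0 < c + k * t^2 := by positivity
    have h5 : (c + k * t^2)^2 ≤ (d + k * u^2)^2 := by gcongr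
    have h6 : t^2 * (c + k * t^2)^2 < u^2 * (d + k * u^2)^2 := by
      calc t^2 * (c + k * t^2)^2 < u^2 * (c + k * t^2)^2 := by gcongr
        _ ≤ _ := by gcongr
    rw [← h1, ← h2, h] at h6
    exact lt_irrefl _ h6
  have key2 : ∀ c k t u : ℝ, 0 < c → 0 < k → c * t + k * t^3 = c * u + k * u^3 → t = u := by
    intro c k t u hc hk h
    have : (t - u) * (c + k * (t^2 + t*u + u^2)) = 0 := by linear_combination h
    rcases mul_eq_zero.1 this with h | h
    · linarith
    · nlinarith [mul_nonneg hk.le (show 0 ≤ t^2 + t*u + u^2 by nlinarith [sq_nonneg (t+u), sq_nonneg t, sq_nonneg u])]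
  have half : ∀ p q : Plane, FF p = FF q → WW q ≤ WW p → WW p ≤ WW q := by
    intro p q h hw
    have e0 := congrArg (fun v : Plane => v 0) h
    have e1 := congrArg (fun v : Plane => v 1) h
    simp only [FF_0, FF_1] at e0 e1
    have hp := WW_pos p
    have hq := WW_pos q
    have hi : (1/25) * (WW p)⁻¹ ≤ (1/25) * (WW q)⁻¹ := by gcongr
    have a := key _ _ (5/2) (p 0 * WW p) (q 0 * WW q) (by positivity) hi (by norm_num)
      (by field_simp; field_simp at e1; linarith)
    have b := key _ _ (5/2) (p 1 * WW p) (q 1 * WW q) (by positivity) hi (by norm_num)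
      (by field_simp; field_simp at e0; linarith)
    have r1 := WW_rel p
    have r2 := WW_rel q
    nlinarith
  intro p q h
  have hw : WW p = WW q := by
    rcases le_total (WW q) (WW p) with h' | h'
    · exact le_antisymm (half p q h h') h'
    · exact le_antisymm h' (half q p h.symm h')
  have e0 := congrArg (fun v : Plane => v 0) h
  have e1 := congrArg (fun v : Plane => v 1) h
  simp only [FF_0, FF_1, hw] at e0 e1
  have hq := WW_pos q
  have a := key2 (1/25) (5/2 * WW q ^3) (p 0) (q 0) (by norm_num) (by positivity) (by linarith)
  have b := key2 (1/25) (5/2 * WW q ^3) (p 1) (q 1) (by norm_num) (by positivity) (by linarith)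
  ext i; fin_cases i
  · exact a
  · exact b

lemma norm_sq_plane (q : Plane) : ‖q‖^2 = q 0 ^ 2 + q 1 ^ 2 := by
  rw [EuclideanSpace.norm_sq_eq]; simp

lemma FF_lower (q : Plane) : (1/25) * ‖q‖ ≤ ‖FF q‖ := by
  refine (pow_le_pow_iff_left₀ (by positivity) (by positivity) two_ne_zero).1 ?_
  rw [mul_pow, norm_sq_plane, norm_sq_plane, FF_0, FF_1]
  have hw := WW_pos q
  have e : ∀ t : ℝ, (1/25)^2 * t^2 ≤ ((1/25) * t + (5/2) * (t * WW q)^3)^2 := by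
    intro t
    have : ((1/25) * t + (5/2) * (t * WW q)^3)^2 =
      (1/25)^2 * t^2 + (1/5) * (t^2)^2 * WW q ^3 + (25/4) * ((t * WW q)^3)^2 := by ring
    rw [this]
    have : 0 ≤ (1/5) * (t^2)^2 * WW q ^3 + (25/4) * ((t * WW q)^3)^2 := by positivity
    linarith
  have := e (q 0)
  have := e (q 1)
  rw [neg_sq]
  linarith

lemma FF_upper (q : Plane) (hq : 10 ≤ ‖q‖) : ‖FF q‖ ≤ ‖q‖ / 2 := by
  refine (pow_le_pow_iff_left₀ (by positivity) (by positivity) two_ne_zero).1 ?_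
  rw [div_pow, norm_sq_plane (FF q), FF_0, FF_1]
  have hw := WW_pos q
  have hr := WW_rel q
  have hn := norm_sq_plane q
  have h100 : 100 ≤ ‖q‖^2 := by nlinarith
  have e : ∀ t x : ℝ, x^2 ≤ 1 → ((1/25) * t + (5/2) * x^3)^2 ≤ 2/625 * t^2 + 25/2 * x^2 := by
    intro t x hx
    have : ((1/25) * t + (5/2) * x^3)^2 ≤ 2/625 * t^2 + 25/2 * (x^3)^2 := by
      nlinarith [sq_nonneg ((1/25) * t - (5/2) * x^3)]
    have h2 : (x^3)^2 ≤ x^2 := by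
      have : (x^3)^2 = x^2 * (x^2 * x^2) := by ring
      rw [this]
      have : x^2 * x^2 ≤ 1 := by nlinarith [sq_nonneg x]
      nlinarith [sq_nonneg x]
    linarith
  have a := e (q 0) (q 0 * WW q) (by nlinarith [sq_nonneg (q 1 * WW q)])
  have b := e (q 1) (q 1 * WW q) (by nlinarith [sq_nonneg (q 0 * WW q)])
  rw [neg_sq]
  nlinarith [sq_nonneg (WW q)]

lemma MM_bounds (q : Plane) : 0 < (MM q).det ∧ (MM q).det < 1 ∧ |(MM q).trace| < 1 := by
  rw [MM_det, MM_trace]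
  exact num_bounds _ _ _ (WW_pos q) (WW_rel q)

lemma fderiv_equiv (q : Plane) : ∃ e : Plane ≃L[ℝ] Plane, (e : Plane →L[ℝ] Plane) = fderiv ℝ FF q := by
  have h := (MM_bounds q).1
  have hdet : (fderiv ℝ FF q).det ≠ 0 := by
    have : (fderiv ℝ FF q).det = (MM q).det := by
      rw [MM, LinearMap.det_toMatrix]
    rw [this]; exact h.ne'
  exact ⟨ContinuousLinearMap.toContinuousLinearEquivOfDetNeZero _ hdet, rfl⟩

lemma FF_open : IsOpenMap FF := by
  choose e he using fderiv_equiv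
  refine isOpenMap_of_hasStrictFDerivAt_equiv (f' := e) (fun q => ?_)
  rw [he]
  exact FF_contDiff.contDiffAt.hasStrictFDerivAt (by simp)

lemma FF_surj : Function.Surjective FF := by
  have hp : IsProperMap FF := by
    rw [isProperMap_iff_tendsto_cocompact]
    refine ⟨FF_contDiff.continuous, ?_⟩
    rw [← Metric.cobounded_eq_cocompact, ← comap_norm_atTop, tendsto_comap_iff]
    refine tendsto_atTop_mono FF_lower ?_
    refine Tendsto.const_mul_atTop (by norm_num) ?_
    exact tendsto_comap
  have : IsClopen (range FF) := ⟨hp.isClosedMap.isClosed_range, FF_open.isOpen_range⟩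
  exact range_eq_univ.1 (this.eq_univ (range_nonempty _))

lemma FF_spec : spec (fun p => fderiv ℝ FF p) ⊆ Metric.ball (0 : ℂ) 1 := by
  rintro z ⟨q, hz⟩
  change ((MM q).map (algebraMap ℝ ℂ)).charpoly.IsRoot z at hz
  rw [Matrix.charpoly_fin_two] at hz
  obtain ⟨h1, h2, h3⟩ := MM_bounds q
  rw [mem_ball_zero_iff]
  apply root_bound _ _ h1 h2 h3
  simpa [Polynomial.IsRoot.def, Matrix.trace_fin_two, Matrix.det_fin_two] using hz

lemma WW_four (q : Plane) (h : q 0 ^2 + q 1 ^ 2 = 16/9) : WW q = 3/5 := by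
  unfold WW
  rw [show 1 + q 0 ^ 2 + q 1 ^ 2 = (5/3)^2 by linarith, Real.sqrt_sq (by norm_num)]
  norm_num

lemma FF_axis (a b : ℝ) (h : a = 0 ∧ b^2 = 16/9 ∨ b = 0 ∧ a^2 = 16/9) :
    FF !₂[a, b] = !₂[-b, a] := by
  have hw : WW !₂[a, b] = 3/5 := by
    apply WW_four
    rcases h with ⟨h, h'⟩ | ⟨h, h'⟩ <;> simp [h, h']
  have ha : 1/25 * a + 5/2 * (a * (3/5))^3 = a := by
    rcases h with ⟨h, h'⟩ | ⟨h, h'⟩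
    · simp [h]
    · linear_combination (27/50) * a * h'
  have hb : 1/25 * b + 5/2 * (b * (3/5))^3 = b := by
    rcases h with ⟨h, h'⟩ | ⟨h, h'⟩
    · linear_combination (27/50) * b * h'
    · simp [h]
  ext i; fin_cases i
  · change FF !₂[a, b] 0 = -b
    rw [FF_0, hw]; simp only [Matrix.cons_val_zero, Matrix.cons_val_one, PiLp.toLp_apply]; linarith
  · change FF !₂[a, b] 1 = a
    rw [FF_1, hw]; simpa using ha

theorem stmt18 :
    ∃ f g : Plane → Plane,
      ContDiff ℝ (⊤ : ℕ∞) f ∧ ContDiff ℝ (⊤ : ℕ∞) g ∧ f ∘ g = id ∧ g ∘ f = id ∧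
      f 0 = 0 ∧
      (spec (fun p => fderiv ℝ f p) ⊆ Metric.ball (0 : ℂ) 1) ∧
      (∃ p : Plane, f^[4] p = p ∧ f^[1] p ≠ p ∧ f^[2] p ≠ p ∧ f^[3] p ≠ p) ∧
      (∃ R : ℝ, 0 < R ∧ ∀ q : Plane, R ≤ ‖q‖ → ‖f q‖ ≤ ‖q‖ / 2) := by
  let E : Plane ≃ₜ Plane := (Equiv.ofBijective FF ⟨FF_inj, FF_surj⟩).toHomeomorphOfContinuousOpen
    FF_contDiff.continuous FF_open
  have hE : ∀ q, E q = FF q := fun q => rfl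
  choose e he using fderiv_equiv
  refine ⟨FF, E.symm, FF_contDiff, ?_, ?_, ?_, ?_, FF_spec, ?_, 10, by norm_num, FF_upper⟩
  · refine E.contDiff_symm (f₀' := e) (fun a => ?_) FF_contDiff
    rw [he]
    exact (FF_contDiff.differentiable (by simp) a).hasFDerivAt
  · ext1 x; exact E.apply_symm_apply x
  · ext1 x; exact E.symm_apply_apply x
  · ext i; fin_cases i
    · change FF 0 0 = 0
      rw [FF_0]; simp
    · change FF 0 1 = 0
      rw [FF_1]; simp
  · have s1 : FF !₂[4/3, 0] = !₂[0, 4/3] := by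
      rw [FF_axis _ _ (by norm_num)]; simp
    have s2 : FF !₂[0, 4/3] = !₂[-(4/3), 0] := FF_axis _ _ (by norm_num)
    have s3 : FF !₂[-(4/3), 0] = !₂[0, -(4/3)] := by
      rw [FF_axis _ _ (by norm_num)]; simp
    have s4 : FF !₂[0, -(4/3)] = !₂[4/3, 0] := by
      rw [FF_axis _ _ (by norm_num)]; simp
    refine ⟨!₂[4/3, 0], ?_, ?_, ?_, ?_⟩
    · simp only [Function.iterate_succ, Function.iterate_zero, Function.comp, id, s1, s2, s3, s4]
    all_goals
      simp only [Function.iterate_succ, Function.iterate_zero, Function.comp, id, s1, s2, s3]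
      intro h
      have := congrArg (fun v : Plane => v 0) h
      norm_num at this
end
end
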